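/- arXiv:1610.01965 — 4 statements merged into one kernel-verified Lean document; each statement's English description precedes it below -/
import Mathlib

section
/- Let m, n be positive integers, let λ₁, …, λₙ be distinct points of the open unit disc 𝔻 ⊆ ℂ, and let z₁, …, zₙ be m×m complex matrices. There exists a holomorphic map Φ : 𝔻 → M_m(ℂ) with Φ(λᵢ) = zᵢ for each i and sup_{λ∈𝔻} ‖Φ(λ)‖ ≤ 1 (operator norm of the matrix Φ(λ) acting on ℂ^m) if and only if the mn×mn block matrix whose (i,j) block is (I_m − zᵢ·zⱼ*)·(1 − λᵢ·conj(λⱼ))^{-1} is positive semidefinite. -/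
open Complex Metric Matrix
open scoped ComplexOrder

lemma np_iso {ι κ : Type*} [Fintype ι] [Fintype κ] [DecidableEq κ] (P Q : Matrix ι κ ℂ)
    (h : P * Pᴴ = Q * Qᴴ) : ∃ U : Matrix κ κ ℂ, U * Uᴴ = 1 ∧ P * U = Q := by
  classical
  let Lu : (ι → ℂ) →ₗ[ℂ] EuclideanSpace ℂ κ := (WithLp.linearEquiv 2 ℂ (κ → ℂ)).symm.toLinearMap ∘ₗ P.vecMulLinear
  let Lv : (ι → ℂ) →ₗ[ℂ] EuclideanSpace ℂ κ := (WithLp.linearEquiv 2 ℂ (κ → ℂ)).symm.toLinearMap ∘ₗ Q.vecMulLinear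
  have key : ∀ (R : Matrix ι κ ℂ) (c : ι → ℂ), ((‖WithLp.toLp 2 (c ᵥ* R)‖ : ℂ))^2 =
      (c ᵥ* (R * Rᴴ)) ⬝ᵥ star c := by
    intro R c
    have := inner_self_eq_norm_sq_to_K (𝕜 := ℂ) (WithLp.toLp 2 (c ᵥ* R))
    rw [EuclideanSpace.inner_eq_star_dotProduct] at this
    simp only [coe_algebraMap] at this
    rw [← this, star_vecMul, ← vecMul_vecMul, dotProduct_mulVec]
  have hnorm : ∀ c, ‖Lv c‖ = ‖Lu c‖ := by
    intro c
    have h1 := key P c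
    have h2 := key Q c
    rw [← h, ← h1] at h2
    have h3 : ‖WithLp.toLp 2 (c ᵥ* Q)‖ ^ 2 = ‖WithLp.toLp 2 (c ᵥ* P)‖ ^ 2 := by exact_mod_cast h2
    exact (pow_left_inj₀ (norm_nonneg _) (norm_nonneg _) two_ne_zero).1 h3
  obtain ⟨σ, hσ⟩ := Lu.rangeRestrict.exists_rightInverse_of_surjective Lu.range_rangeRestrict
  have hσ' : ∀ s, Lu (σ s) = s := fun s => by
    have := LinearMap.congr_fun hσ s
    exact congrArg Subtype.val this
  let L : LinearMap.range Lu →ₗᵢ[ℂ] EuclideanSpace ℂ κ := ⟨Lv ∘ₗ σ, fun s => by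
    rw [LinearMap.comp_apply, hnorm, hσ']; rfl⟩
  let T := L.extend
  have hT : ∀ c, T (Lu c) = Lv c := by
    intro c
    have h1 : T (Lu c) = L ⟨Lu c, ⟨c, rfl⟩⟩ := L.extend_apply ⟨Lu c, ⟨c, rfl⟩⟩
    rw [h1]
    change Lv (σ _) = Lv c
    rw [← sub_eq_zero, ← map_sub, ← norm_eq_zero, hnorm, map_sub, hσ', norm_eq_zero]
    simp
  refine ⟨Matrix.of fun k l => T (EuclideanSpace.single k 1) l, ?_, ?_⟩
  · ext k l
    have h1 := T.inner_map_map (EuclideanSpace.single l 1) (EuclideanSpace.single k 1)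
    rw [EuclideanSpace.inner_eq_star_dotProduct] at h1
    simp only [mul_apply, conjTranspose_apply, of_apply]
    simp only [dotProduct, Pi.star_apply] at h1
    rw [h1]
    rw [EuclideanSpace.inner_single_left]
    simp [Matrix.one_apply, eq_comm]
  · ext i l
    have h1 := congrArg (fun v : EuclideanSpace ℂ κ => v l) (hT (Pi.single i 1))
    have h2 : Lu (Pi.single i 1) = ∑ k, P i k • (EuclideanSpace.single k 1 : EuclideanSpace ℂ κ) := by
      ext k
      simp [Lu, Pi.single_apply]
    rw [h2, map_sum] at h1
    simp only [mul_apply, of_apply]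
    simp only [WithLp.ofLp_sum, map_smul, WithLp.ofLp_smul, Finset.sum_apply, Pi.smul_apply,
      smul_eq_mul] at h1
    simpa [Lv] using h1

lemma np_n0 {τ : Type*} [Fintype τ] (v : τ → ℂ) :
    v ⬝ᵥ star v = ((∑ k, ‖v k‖ ^ 2 : ℝ) : ℂ) := by
  simp [dotProduct, Complex.mul_conj, Complex.normSq_eq_norm_sq]

lemma np_contr {μ ν : Type*} [Fintype μ] [Fintype ν] [DecidableEq μ] (F : Matrix μ μ ℂ)
    (K : Matrix μ ν ℂ) (w : ℂ) (hw : ‖w‖ < 1)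
    (h : F * Fᴴ + K * Kᴴ = 1 + (w • K) * (w • K)ᴴ) :
    ‖Matrix.toEuclideanCLM (𝕜 := ℂ) F‖ ≤ 1 := by
  rw [← norm_star, ← map_star, star_eq_conjTranspose]
  refine ContinuousLinearMap.opNorm_le_bound _ zero_le_one fun x => ?_
  rw [one_mul]
  obtain ⟨y, rfl⟩ : ∃ y : μ → ℂ, x = WithLp.toLp 2 (star y) := ⟨star x.ofLp, by simp⟩
  rw [toEuclideanCLM_toLp, ← star_vecMul]
  refine le_of_sq_le_sq ?_ (norm_nonneg _)
  rw [EuclideanSpace.norm_sq_eq, EuclideanSpace.norm_sq_eq]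
  simp only [Pi.star_apply, norm_star]
  have h1 : (y ᵥ* F) ⬝ᵥ star (y ᵥ* F) + (y ᵥ* K) ⬝ᵥ star (y ᵥ* K) =
      y ⬝ᵥ star y + (y ᵥ* (w • K)) ⬝ᵥ star (y ᵥ* (w • K)) := by
    simp only [star_vecMul, dotProduct_mulVec, vecMul_vecMul]
    rw [← add_dotProduct, ← vecMul_add, h, vecMul_add, vecMul_one, add_dotProduct]
  rw [np_n0, np_n0, np_n0, np_n0] at h1
  have h2 : ∑ k, ‖(y ᵥ* F) k‖ ^ 2 + ∑ k, ‖(y ᵥ* K) k‖ ^ 2 =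
    ∑ k, ‖y k‖ ^ 2 + ∑ k, ‖(y ᵥ* (w • K)) k‖ ^ 2 := by exact_mod_cast h1
  have h3 : ∑ k, ‖(y ᵥ* (w • K)) k‖ ^ 2 ≤ ∑ k, ‖(y ᵥ* K) k‖ ^ 2 := by
    refine Finset.sum_le_sum fun k _ => ?_
    rw [vecMul_smul, Pi.smul_apply, norm_smul]
    gcongr
    exact mul_le_of_le_one_left (norm_nonneg _) hw.le
  linarith

lemma np_inv_diff {ν : Type*} [Fintype ν] [DecidableEq ν] (D : Matrix ν ν ℂ)
    (hdet : ∀ w : ℂ, ‖w‖ < 1 → (1 - w • D).det ≠ 0) (i j : ν) :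
    DifferentiableOn ℂ (fun w : ℂ => (1 - w • D)⁻¹ i j) (ball 0 1) := by
  have hdd : ∀ (M : ℂ → Matrix ν ν ℂ), (∀ i j, Differentiable ℂ fun w => M w i j) →
      Differentiable ℂ fun w => (M w).det := by
    intro M hM
    simp only [det_apply]
    fun_prop
  have hent : ∀ i j, Differentiable ℂ fun w : ℂ => (1 - w • D) i j := by
    intro i j
    simp only [Matrix.sub_apply, Matrix.smul_apply, smul_eq_mul]
    fun_prop
  simp only [Matrix.inv_def, Ring.inverse_eq_inv', Matrix.smul_apply, smul_eq_mul, adjugate_apply]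
  refine DifferentiableOn.mul
    ((hdd _ hent).differentiableOn.inv fun w hw => hdet w (by simpa using hw)) ?_
  refine (hdd _ fun a b => ?_).differentiableOn
  by_cases hab : a = j
  · subst hab
    simp
  · simpa [hab] using hent a b

set_option maxHeartbeats 1000000 in
lemma np_suff {μ ν ι : Type*} [Fintype μ] [Fintype ν] [DecidableEq μ] [DecidableEq ν]
    [Fintype ι] (lam : ι → ℂ) (hmem : ∀ i, ‖lam i‖ < 1) (z : ι → Matrix μ μ ℂ)
    (G : ι → Matrix μ ν ℂ)
    (hG : ∀ i j, (1 : Matrix μ μ ℂ) - z i * (z j)ᴴ = (1 - lam i * star (lam j)) • (G i * (G j)ᴴ)) :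
    ∃ Φ : ℂ → Matrix μ μ ℂ,
      (∀ k l, DifferentiableOn ℂ (fun w => Φ w k l) (ball (0 : ℂ) 1)) ∧
      (∀ i, Φ (lam i) = z i) ∧
      (∀ w ∈ ball (0 : ℂ) 1, ‖Matrix.toEuclideanCLM (𝕜 := ℂ) (Φ w)‖ ≤ 1) := by
  obtain ⟨U, hU, hPQ⟩ := np_iso
    (Matrix.of fun (p : ι × μ) => (fromCols 1 (lam p.1 • G p.1) : Matrix μ (μ ⊕ ν) ℂ) p.2)
    (Matrix.of fun (p : ι × μ) => (fromCols (z p.1) (G p.1) : Matrix μ (μ ⊕ ν) ℂ) p.2) (by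
      ext p q
      have := congrFun₂ (hG p.1 q.1) p.2 q.2
      simp only [mul_apply, Matrix.sub_apply, Matrix.smul_apply, conjTranspose_apply, of_apply,
        Fintype.sum_sum_type, fromCols_apply_inl, fromCols_apply_inr, smul_eq_mul] at this ⊢
      have e1 : ∑ x, (1 : Matrix μ μ ℂ) p.2 x * star ((1 : Matrix μ μ ℂ) q.2 x) =
        (1 : Matrix μ μ ℂ) p.2 q.2 := by
        simp [Matrix.one_apply, apply_ite, eq_comm]
      have e2 : ∑ x, lam p.1 * G p.1 p.2 x * star (lam q.1 * G q.1 q.2 x) =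
        lam p.1 * star (lam q.1) * ∑ x, G p.1 p.2 x * star (G q.1 q.2 x) := by
        rw [Finset.mul_sum]
        refine Finset.sum_congr rfl fun x _ => ?_
        rw [star_mul']; ring
      rw [e1, e2]
      linear_combination this)
  set A := U.toBlocks₁₁ with hA
  set B := U.toBlocks₁₂ with hB
  set C := U.toBlocks₂₁ with hC
  set D := U.toBlocks₂₂ with hD
  have hUb : U = fromBlocks A B C D := (fromBlocks_toBlocks U).symm
  have hrow : ∀ i, (fromCols 1 (lam i • G i) : Matrix μ (μ ⊕ ν) ℂ) * U = fromCols (z i) (G i) := by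
    intro i
    ext a k
    have := congrFun₂ hPQ (i, a) k
    simpa [mul_apply] using this
  have hrow1 : ∀ i, A + lam i • (G i * C) = z i ∧ B + lam i • (G i * D) = G i := by
    intro i
    have := hrow i
    rw [hUb, fromCols_mul_fromBlocks] at this
    have := fromCols_inj this
    simpa using this
  have hUU : ∀ (X : Matrix μ μ ℂ) (Y : Matrix μ ν ℂ),
      (X * A + Y * C) * (X * A + Y * C)ᴴ + (X * B + Y * D) * (X * B + Y * D)ᴴ =
      X * Xᴴ + Y * Yᴴ := by
    intro X Y
    have : (fromCols X Y * U) * (fromCols X Y * U)ᴴ = fromCols X Y * (fromCols X Y)ᴴ := by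
      rw [conjTranspose_mul, Matrix.mul_assoc, ← Matrix.mul_assoc U, hU, Matrix.one_mul]
    rw [hUb, fromCols_mul_fromBlocks, conjTranspose_fromCols_eq_fromRows_conjTranspose,
      conjTranspose_fromCols_eq_fromRows_conjTranspose, fromCols_mul_fromRows, fromCols_mul_fromRows] at this
    exact this
  have hCD : C * Cᴴ + D * Dᴴ = 1 := by
    have := hU
    rw [hUb, fromBlocks_conjTranspose, fromBlocks_multiply, ← fromBlocks_one, fromBlocks_inj] at this
    exact this.2.2.2
  have hdet : ∀ w : ℂ, ‖w‖ < 1 → (1 - w • D).det ≠ 0 := by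
    intro w hw hdet
    obtain ⟨y, hy0, hy⟩ := exists_vecMul_eq_zero_iff.2 hdet
    have hy1 : y = w • (y ᵥ* D) := by
      rw [vecMul_sub, vecMul_one, vecMul_smul, sub_eq_zero] at hy
      exact hy
    have h1 : (y ᵥ* C) ⬝ᵥ star (y ᵥ* C) + (y ᵥ* D) ⬝ᵥ star (y ᵥ* D) = y ⬝ᵥ star y := by
      simp only [star_vecMul, dotProduct_mulVec, vecMul_vecMul]
      rw [← add_dotProduct, ← vecMul_add, hCD, vecMul_one]
    rw [np_n0, np_n0, np_n0] at h1
    have h2 : ∑ k, ‖(y ᵥ* C) k‖ ^ 2 + ∑ k, ‖(y ᵥ* D) k‖ ^ 2 = ∑ k, ‖y k‖ ^ 2 := by exact_mod_cast h1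
    have h3 : ∑ k, ‖y k‖ ^ 2 = ‖w‖ ^ 2 * ∑ k, ‖(y ᵥ* D) k‖ ^ 2 := by
      rw [Finset.mul_sum]
      refine Finset.sum_congr rfl fun k _ => ?_
      conv_lhs => rw [hy1]
      simp [mul_pow]
    have h4 : 0 ≤ ∑ k, ‖(y ᵥ* C) k‖ ^ 2 := Finset.sum_nonneg fun _ _ => by positivity
    have h5 : 0 < ∑ k, ‖y k‖ ^ 2 := by
      obtain ⟨k, hk⟩ := Function.ne_iff.1 hy0
      exact Finset.sum_pos' (fun _ _ => by positivity) ⟨k, Finset.mem_univ _, by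
        have : y k ≠ 0 := hk
        positivity⟩
    have h6 : ‖w‖ ^ 2 < 1 := by nlinarith [norm_nonneg w]
    nlinarith [sq_nonneg ‖w‖]
  refine ⟨fun w => A + w • (B * (1 - w • D)⁻¹ * C), ?_, ?_, ?_⟩
  · intro k l
    have hinv := np_inv_diff D hdet
    simp only [Matrix.add_apply, Matrix.smul_apply, mul_apply, smul_eq_mul]
    refine (differentiableOn_const _).add (differentiableOn_id.mul ?_)
    refine DifferentiableOn.fun_sum fun a _ => DifferentiableOn.mul_const ?_ _
    refine DifferentiableOn.fun_sum fun b _ => DifferentiableOn.const_mul ?_ _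
    exact hinv b a
  · intro i
    obtain ⟨h1, h2⟩ := hrow1 i
    have hu : IsUnit (1 - lam i • D).det := (hdet _ (hmem i)).isUnit
    have : G i * (1 - lam i • D) = B := by
      rw [Matrix.mul_sub, Matrix.mul_one, Matrix.mul_smul, sub_eq_iff_eq_add]
      exact h2.symm
    dsimp only
    rw [← this, Matrix.mul_nonsing_inv_cancel_right _ _ hu]
    exact h1
  · intro w hw
    have hw' : ‖w‖ < 1 := by simpa using hw
    have hu : IsUnit (1 - w • D).det := (hdet _ hw').isUnit
    set K := B * (1 - w • D)⁻¹ with hK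
    have hKB : B + w • (K * D) = K := by
      have : K * (1 - w • D) = B := Matrix.nonsing_inv_mul_cancel_right _ _ hu
      rw [Matrix.mul_sub, Matrix.mul_one, Matrix.mul_smul, sub_eq_iff_eq_add] at this
      exact this.symm
    have h1 := hUU 1 (w • K)
    set F := A + w • (K * C) with hF
    rw [Matrix.one_mul, Matrix.one_mul, Matrix.smul_mul, Matrix.smul_mul, hKB, ← hF] at h1
    rw [conjTranspose_one, Matrix.one_mul] at h1
    exact np_contr F K w hw' h1

lemma np_ne {a b : ℂ} (ha : ‖a‖ < 1) (hb : ‖b‖ ≤ 1) : 1 - a * b ≠ 0 := by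
  intro h
  have h1 : a * b = 1 := (sub_eq_zero.1 h).symm
  have h2 : ‖a‖ * ‖b‖ = 1 := by rw [← norm_mul, h1, norm_one]
  nlinarith [norm_nonneg a, norm_nonneg b]

/-- the Szegő kernel -/
noncomputable def npk (l ζ : ℂ) : ℂ := (1 - star l * ζ)⁻¹

lemma npk_cont {l : ℂ} (hl : ‖l‖ < 1) : DiffContOnCl ℂ (npk l) (ball 0 1) := by
  refine DiffContOnCl.inv (f := fun ζ => 1 - star l * ζ) ?_ ?_
  · refine Differentiable.diffContOnCl ?_
    fun_prop
  · intro x hx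
    rw [closure_ball _ one_ne_zero] at hx
    exact np_ne (by simpa using hl) (by simpa using hx)

lemma np_avg {l : ℂ} (hl : ‖l‖ < 1) {h : ℂ → ℂ} (hh : DiffContOnCl ℂ h (ball 0 1)) :
    Real.circleAverage (fun ζ => h ζ * star (npk l ζ)) 0 1 = h l := by
  have h1 := DiffContOnCl.circleAverage_smul_div (R := 1) (c := 0) (w := l) (f := h)
    (by simpa using hh) (by simpa using hl)
  rw [← h1]
  refine Real.circleAverage_congr_sphere fun ζ hζ => ?_
  have hζ1 : ‖ζ‖ = 1 := by simpa using hζ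
  have hζ0 : ζ ≠ 0 := by rw [← norm_pos_iff, hζ1]; exact one_pos
  have e : star ζ = ζ⁻¹ := by
    rw [Complex.inv_def, Complex.normSq_eq_norm_sq, hζ1]; simp
  have hne : ζ - l ≠ 0 := by
    intro h0
    rw [sub_eq_zero] at h0
    rw [← h0, hζ1] at hl
    exact lt_irrefl _ hl
  have h2 : star (npk l ζ) = ζ / (ζ - l) := by
    rw [npk, star_inv₀, star_sub, star_one, star_mul', star_star, e]
    rw [eq_div_iff hne, inv_mul_eq_iff_eq_mul₀]
    · field_simp
    · intro h0
      apply hne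
      field_simp at h0
      simpa using h0
  simp only [sub_zero, smul_eq_mul, h2]
  ring

lemma np_ci {f : ℂ → ℂ} (hf : ContinuousOn f (closedBall 0 1)) : CircleIntegrable f 0 1 :=
  (hf.mono sphere_subset_closedBall).circleIntegrable zero_le_one

lemma np_avg_sum {ι : Type*} [Fintype ι] {l : ι → ℂ} (hl : ∀ i, ‖l i‖ < 1) (c : ι → ℂ)
    {h : ℂ → ℂ} (hh : DiffContOnCl ℂ h (ball 0 1)) :
    Real.circleAverage (fun ζ => h ζ * star (∑ i, npk (l i) ζ * c i)) 0 1 =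
      ∑ i, star (c i) * h (l i) := by
  have : (fun ζ => h ζ * star (∑ i, npk (l i) ζ * c i)) =
      fun ζ => ∑ i, star (c i) • (h ζ * star (npk (l i) ζ)) := by
    funext ζ
    rw [star_sum, Finset.mul_sum]
    refine Finset.sum_congr rfl fun i _ => ?_
    rw [star_mul', smul_eq_mul]; ring
  rw [this, Real.circleAverage_fun_sum]
  · refine Finset.sum_congr rfl fun i _ => ?_
    rw [Real.circleAverage_fun_smul, np_avg (hl i) hh, smul_eq_mul]
  · intro i _
    apply np_ci
    have h1 := hh.continuousOn_ball
    have h2 := (npk_cont (hl i)).continuousOn_ball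
    exact ContinuousOn.const_smul (h1.mul h2.star) (star (c i))

lemma np_nec {ι μ : Type*} [Fintype ι] [Fintype μ] [DecidableEq μ] (lam : ι → ℂ)
    (hl : ∀ i, ‖lam i‖ < 1) (F : ℂ → Matrix μ μ ℂ)
    (hF : ∀ a b, DiffContOnCl ℂ (fun w => F w a b) (ball 0 1))
    (hn : ∀ w ∈ sphere (0 : ℂ) 1, ‖Matrix.toEuclideanCLM (𝕜 := ℂ) (F w)‖ ≤ 1)
    (x : ι × μ → ℂ) :
    0 ≤ (∑ p : ι × μ, ∑ q : ι × μ, star (x p) *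
      (((1 : Matrix μ μ ℂ) - F (lam p.1) * (F (lam q.1))ᴴ) p.2 q.2 /
        (1 - lam p.1 * star (lam q.1))) * x q).re := by
  let y : ι → μ → ℂ := fun i b => ∑ a, star (F (lam i) a b) * x (i, a)
  let f : μ → ℂ → ℂ := fun a ζ => ∑ i, npk (lam i) ζ * x (i, a)
  let g : μ → ℂ → ℂ := fun b ζ => ∑ i, npk (lam i) ζ * y i b
  let e : μ → ℂ → ℂ := fun a ζ => ∑ b, F ζ a b * g b ζ
  have hsum : ∀ {τ : Type _} [Fintype τ] (c : τ → ℂ → ℂ), (∀ t, DiffContOnCl ℂ (c t) (ball 0 1)) →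
      DiffContOnCl ℂ (fun ζ => ∑ t, c t ζ) (ball 0 1) := fun c hc =>
    ⟨DifferentiableOn.fun_sum fun t _ => (hc t).1, continuousOn_finsetSum _ fun t _ => (hc t).2⟩
  have hsum' : ∀ (c : μ → ℂ → ℂ), (∀ t, DiffContOnCl ℂ (c t) (ball 0 1)) →
      DiffContOnCl ℂ (fun ζ => ∑ t, c t ζ) (ball 0 1) := fun c hc =>
    ⟨DifferentiableOn.fun_sum fun t _ => (hc t).1, continuousOn_finsetSum _ fun t _ => (hc t).2⟩
  have hf : ∀ a, DiffContOnCl ℂ (f a) (ball 0 1) := fun a =>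
    hsum _ fun i => (npk_cont (hl i)).smul diffContOnCl_const
  have hg : ∀ a, DiffContOnCl ℂ (g a) (ball 0 1) := fun a =>
    hsum _ fun i => (npk_cont (hl i)).smul diffContOnCl_const
  have he : ∀ a, DiffContOnCl ℂ (e a) (ball 0 1) := fun a =>
    hsum' _ fun b => (hF a b).smul (hg b)
  have A1 : ∀ a, Real.circleAverage (fun ζ => f a ζ * star (f a ζ)) 0 1 =
    ∑ i, star (x (i, a)) * f a (lam i) := fun a => np_avg_sum hl _ (hf a)
  have A2 : ∀ a, Real.circleAverage (fun ζ => g a ζ * star (g a ζ)) 0 1 =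
    ∑ i, star (y i a) * g a (lam i) := fun a => np_avg_sum hl _ (hg a)
  have A3 : ∀ a, Real.circleAverage (fun ζ => e a ζ * star (f a ζ)) 0 1 =
    ∑ i, star (x (i, a)) * e a (lam i) := fun a => np_avg_sum hl _ (he a)
  have ci : ∀ {u v : ℂ → ℂ}, DiffContOnCl ℂ u (ball 0 1) → DiffContOnCl ℂ v (ball 0 1) →
      CircleIntegrable (fun ζ => u ζ * star (v ζ)) 0 1 := fun hu hv =>
    np_ci (hu.continuousOn_ball.mul hv.continuousOn_ball.star)
  have cis : ∀ {u v : μ → ℂ → ℂ}, (∀ a, DiffContOnCl ℂ (u a) (ball 0 1)) →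
      (∀ a, DiffContOnCl ℂ (v a) (ball 0 1)) →
      CircleIntegrable (fun ζ => ∑ a, u a ζ * star (v a ζ)) 0 1 := fun hu hv =>
    CircleIntegrable.fun_sum _ fun a _ => ci (hu a) (hv a)
  have E1 : ∑ a, ∑ i, star (x (i, a)) * e a (lam i) = ∑ a, ∑ i, star (y i a) * g a (lam i) := by
    rw [Finset.sum_comm, Finset.sum_comm (γ := μ)]
    refine Finset.sum_congr rfl fun i _ => ?_
    simp only [e, y, star_sum, Finset.mul_sum, Finset.sum_mul]
    rw [Finset.sum_comm]
    refine Finset.sum_congr rfl fun b _ => Finset.sum_congr rfl fun a _ => ?_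
    rw [star_mul', star_star]; ring
  have E2 : (∑ p : ι × μ, ∑ q : ι × μ, star (x p) *
      (((1 : Matrix μ μ ℂ) - F (lam p.1) * (F (lam q.1))ᴴ) p.2 q.2 /
        (1 - lam p.1 * star (lam q.1))) * x q) =
      (∑ a, ∑ i, star (x (i, a)) * f a (lam i)) - ∑ a, ∑ i, star (x (i, a)) * e a (lam i) := by
    rw [Fintype.sum_prod_type_right, ← Finset.sum_sub_distrib]
    refine Finset.sum_congr rfl fun a _ => ?_
    rw [← Finset.sum_sub_distrib]
    refine Finset.sum_congr rfl fun i _ => ?_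
    rw [← mul_sub]
    simp only [mul_assoc]
    rw [← Finset.mul_sum]
    congr 1
    simp only [f, e, g, y, Finset.mul_sum]
    rw [Fintype.sum_prod_type, Finset.sum_comm (γ := μ) (α := ι), ← Finset.sum_sub_distrib]
    refine Finset.sum_congr rfl fun j _ => ?_
    rw [Finset.sum_comm]
    have k1 : npk (lam j) (lam i) * x (j, a) =
      ∑ c, npk (lam j) (lam i) * ((1 : Matrix μ μ ℂ) a c * x (j, c)) := by
      simp [Matrix.one_apply]
    rw [k1, ← Finset.sum_sub_distrib]
    refine Finset.sum_congr rfl fun c _ => ?_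
    simp only [Matrix.sub_apply, mul_apply, conjTranspose_apply, npk, div_eq_mul_inv,
      mul_comm (star (lam j))]
    rw [sub_mul, sub_mul, Finset.sum_mul, Finset.sum_mul]
    congr 1
    · ring
    · refine Finset.sum_congr rfl fun b _ => ?_
      ring
  let E : ℂ → ℂ := fun ζ => ((∑ a, f a ζ * star (f a ζ)) + ∑ a, g a ζ * star (g a ζ)) -
    ((∑ a, e a ζ * star (f a ζ)) + ∑ a, e a ζ * star (f a ζ))
  have hE : Real.circleAverage E 0 1 = ∑ p : ι × μ, ∑ q : ι × μ, star (x p) *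
      (((1 : Matrix μ μ ℂ) - F (lam p.1) * (F (lam q.1))ᴴ) p.2 q.2 /
        (1 - lam p.1 * star (lam q.1))) * x q := by
    rw [E2]
    refine (Real.circleAverage_fun_sub ((cis hf hf).add (cis hg hg)) ((cis he hf).add (cis he hf))).trans ?_
    simp only [Pi.add_def]
    rw [
      Real.circleAverage_fun_add (cis hf hf) (cis hg hg),
      Real.circleAverage_fun_add (cis he hf) (cis he hf),
      Real.circleAverage_fun_sum fun a _ => ci (hf a) (hf a),
      Real.circleAverage_fun_sum fun a _ => ci (hg a) (hg a),
      Real.circleAverage_fun_sum fun a _ => ci (he a) (hf a)]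
    simp only [A1, A2, A3]
    rw [E1]
    ring
  have hEi : CircleIntegrable E 0 1 :=
    ((cis hf hf).add (cis hg hg)).sub ((cis he hf).add (cis he hf))
  have hpos : ∀ ζ ∈ sphere (0 : ℂ) 1, 0 ≤ (E ζ).re := by
    intro ζ hζ
    have n1 := hn ζ hζ
    have n2 := (Matrix.toEuclideanCLM (𝕜 := ℂ) (F ζ)).le_of_opNorm_le n1
      (WithLp.toLp 2 fun b => g b ζ)
    rw [one_mul, toEuclideanCLM_toLp] at n2
    have n3 := pow_le_pow_left₀ (norm_nonneg _) n2 2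
    rw [EuclideanSpace.norm_sq_eq, EuclideanSpace.norm_sq_eq] at n3
    have n4 : ∀ a, (F ζ *ᵥ fun b => g b ζ) a = e a ζ := fun a => rfl
    simp only [n4] at n3
    have sq : ∀ z : ℂ, (z * star z).re = ‖z‖ ^ 2 := by
      intro z
      rw [← Complex.normSq_eq_norm_sq]
      simp [Complex.normSq_apply]
    have n5 : ∑ a, (2 * (e a ζ * star (f a ζ)).re) ≤ ∑ a, (‖e a ζ‖ ^ 2 + ‖f a ζ‖ ^ 2) := by
      refine Finset.sum_le_sum fun a _ => ?_
      have : (e a ζ * star (f a ζ)).re ≤ ‖e a ζ‖ * ‖f a ζ‖ := by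
        refine (Complex.re_le_norm _).trans ?_
        rw [norm_mul, norm_star]
      nlinarith [sq_nonneg (‖e a ζ‖ - ‖f a ζ‖)]
    rw [← Finset.mul_sum, Finset.sum_add_distrib] at n5
    simp only [E, Complex.sub_re, Complex.add_re, Complex.re_sum, sq]
    linarith
  rw [← hE]
  have c1 := Complex.reCLM.circleAverage_comp_comm hEi
  have c2 : 0 ≤ Real.circleAverage (Complex.reCLM ∘ E) 0 1 := by
    apply Real.circleAverage_nonneg_of_nonneg
    intro ζ hζ
    exact hpos ζ (by simpa using hζ)
  rw [c1] at c2
  exact c2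

/-- **Matrix-valued Nevanlinna–Pick theorem** on the unit disc. -/
theorem stmt1 (m n : ℕ) (hm : 0 < m) (hn : 0 < n) (lam : Fin n → ℂ)
    (hmem : ∀ i, lam i ∈ ball (0 : ℂ) 1) (hinj : Function.Injective lam)
    (z : Fin n → Matrix (Fin m) (Fin m) ℂ) :
    (∃ Φ : ℂ → Matrix (Fin m) (Fin m) ℂ,
      (∀ k l, DifferentiableOn ℂ (fun w => Φ w k l) (ball (0 : ℂ) 1)) ∧
      (∀ i, Φ (lam i) = z i) ∧
      (∀ w ∈ ball (0 : ℂ) 1, ‖Matrix.toEuclideanCLM (𝕜 := ℂ) (Φ w)‖ ≤ 1)) ↔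
    (Matrix.of fun p q : Fin n × Fin m =>
      ((1 : Matrix (Fin m) (Fin m) ℂ) - z p.1 * (z q.1)ᴴ) p.2 q.2 /
        (1 - lam p.1 * (starRingEnd ℂ) (lam q.1))).PosSemidef := by
  have hl : ∀ i, ‖lam i‖ < 1 := fun i => by simpa using hmem i
  have hne : ∀ i j, 1 - lam i * star (lam j) ≠ 0 := fun i j =>
    np_ne (hl i) (by rw [norm_star]; exact (hl j).le)
  constructor
  · rintro ⟨Φ, hd, hi, hb⟩
    have hherm : (Matrix.of fun p q : Fin n × Fin m =>
      ((1 : Matrix (Fin m) (Fin m) ℂ) - z p.1 * (z q.1)ᴴ) p.2 q.2 /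
        (1 - lam p.1 * (starRingEnd ℂ) (lam q.1))).IsHermitian := by
      ext p q
      have h1 : ((1 : Matrix (Fin m) (Fin m) ℂ) - z p.1 * (z q.1)ᴴ)ᴴ = 1 - z q.1 * (z p.1)ᴴ := by
        simp
      have h2 := congrFun₂ h1 q.2 p.2
      rw [conjTranspose_apply] at h2
      have h3 := congrArg star h2
      rw [star_star] at h3
      rw [conjTranspose_apply, of_apply, of_apply, h3, star_div₀]
      congr 1
      simp [mul_comm]
    rw [posSemidef_iff_dotProduct_mulVec]
    refine ⟨hherm, fun x => ?_⟩
    rw [Complex.nonneg_iff]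
    constructor
    swap
    · exact (hherm.im_star_dotProduct_mulVec_self x).symm
    have hform : star x ⬝ᵥ ((Matrix.of fun p q : Fin n × Fin m =>
      ((1 : Matrix (Fin m) (Fin m) ℂ) - z p.1 * (z q.1)ᴴ) p.2 q.2 /
        (1 - lam p.1 * (starRingEnd ℂ) (lam q.1))) *ᵥ x) =
        ∑ p : Fin n × Fin m, ∑ q : Fin n × Fin m, star (x p) *
      (((1 : Matrix (Fin m) (Fin m) ℂ) - z p.1 * (z q.1)ᴴ) p.2 q.2 /
        (1 - lam p.1 * star (lam q.1))) * x q := by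
      simp only [dotProduct, mulVec, Finset.mul_sum, mul_assoc]
      rfl
    rw [hform]
    have hent : ∀ i a b, Filter.Tendsto (fun r : ℝ => Φ (r * lam i) a b) (nhdsWithin 1 (Set.Iio 1))
        (nhds (z i a b)) := by
      intro i a b
      rw [← hi i]
      have c1 : ContinuousAt (fun w => Φ w a b) (lam i) :=
        ((hd a b).differentiableAt (isOpen_ball.mem_nhds (hmem i))).continuousAt
      have c2 : Filter.Tendsto (fun r : ℝ => (r : ℂ) * lam i) (nhdsWithin 1 (Set.Iio 1))
          (nhds (lam i)) := by
        have : Continuous fun r : ℝ => (r : ℂ) * lam i := by fun_prop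
        have h := (this.tendsto 1).mono_left (nhdsWithin_le_nhds (s := Set.Iio 1))
        simpa using h
      exact c1.tendsto.comp c2
    have hlim : Filter.Tendsto (fun r : ℝ => (∑ p : Fin n × Fin m, ∑ q : Fin n × Fin m, star (x p) *
      (((1 : Matrix (Fin m) (Fin m) ℂ) - Φ (r * lam p.1) * (Φ (r * lam q.1))ᴴ) p.2 q.2 /
        (1 - lam p.1 * star (lam q.1))) * x q).re) (nhdsWithin 1 (Set.Iio 1))
        (nhds ((∑ p : Fin n × Fin m, ∑ q : Fin n × Fin m, star (x p) *
      (((1 : Matrix (Fin m) (Fin m) ℂ) - z p.1 * (z q.1)ᴴ) p.2 q.2 /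
        (1 - lam p.1 * star (lam q.1))) * x q).re)) := by
      refine (Complex.continuous_re.tendsto _).comp ?_
      refine tendsto_finsetSum _ fun p _ => tendsto_finsetSum _ fun q _ => ?_
      refine Filter.Tendsto.mul_const _ (Filter.Tendsto.const_mul _ (Filter.Tendsto.div_const ?_ _))
      simp only [Matrix.sub_apply, mul_apply, conjTranspose_apply]
      refine Filter.Tendsto.const_sub _ (tendsto_finsetSum _ fun c _ => ?_)
      exact (hent _ _ _).mul (hent _ _ _).star
    refine ge_of_tendsto hlim ?_
    have hev : ∀ᶠ r : ℝ in nhdsWithin 1 (Set.Iio 1), 0 < r :=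
      nhdsWithin_le_nhds (lt_mem_nhds one_pos)
    filter_upwards [hev, self_mem_nhdsWithin] with r hr0 hr1
    have hr1' : r < 1 := hr1
    have hmaps : ∀ w ∈ closedBall (0 : ℂ) 1, (r : ℂ) * w ∈ ball (0 : ℂ) 1 := by
      intro w hw
      have hw' : ‖w‖ ≤ 1 := by simpa using hw
      rw [mem_ball_zero_iff, norm_mul, Complex.norm_real, Real.norm_of_nonneg hr0.le]
      nlinarith [norm_nonneg w]
    refine np_nec lam hl (fun w => Φ (r * w)) (fun a b => ?_) (fun w hw => ?_) x
    · refine DifferentiableOn.diffContOnCl ?_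
      rw [closure_ball _ one_ne_zero]
      exact (hd a b).comp (f := fun w : ℂ => (r : ℂ) * w) (by fun_prop) hmaps
    · exact hb _ (hmaps w (sphere_subset_closedBall hw))
  · intro hP
    obtain ⟨N, v, hv⟩ := posSemidef_iff_eq_sum_vecMulVec.1 hP
    refine np_suff lam hl z (fun i => Matrix.of fun a (k : Fin N) => v k (i, a)) fun i j => ?_
    ext a b
    have h1 := congrFun₂ hv (i, a) (j, b)
    rw [of_apply, Matrix.sum_apply] at h1
    have h2 := (div_eq_iff (hne i j)).1 h1
    refine h2.trans ?_
    rw [ Matrix.smul_apply, smul_eq_mul, mul_comm]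
    congr 1
end

section
/- The Dirichlet space is a complete interpolation space. That is: for all positive integers m and n, all distinct points λ₁, …, λₙ ∈ 𝔻, and all z₁, …, zₙ ∈ M_m(ℂ), there exists a holomorphic map Φ : 𝔻 → M_m(ℂ) with Φ(λᵢ) = zᵢ for each i which is a multiplier of ℂ^m ⊗ D of multiplier norm at most 1, if and only if the mn×mn block matrix whose (i,j) block is (I_m − zᵢ·zⱼ*)·k(λᵢ, λⱼ) is positive semidefinite, where k(λ,μ) = Σ_{p≥0} (λ·conj(μ))^p/(p+1) = (λ·conj(μ))^{-1}·log(1/(1 − λ·conj(μ))). -/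
open Complex Metric Matrix
open scoped ComplexOrder

noncomputable section

/-- `a` is the sequence of Taylor coefficients of `f` on the unit disc. -/
def IsCoeff (f : ℂ → ℂ) (a : ℕ → ℂ) : Prop :=
  ∀ w ∈ ball (0 : ℂ) 1, HasSum (fun p : ℕ => a p * w ^ p) (f w)

/-- The sequence of weights defining the Dirichlet norm. -/
def dirWeight (a : ℕ → ℂ) (p : ℕ) : ℝ := ((p : ℝ) + 1) * ‖a p‖ ^ 2

/-- Membership in the Dirichlet space, in terms of the coefficients. -/
def DirSummable (a : ℕ → ℂ) : Prop := Summable (dirWeight a)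

/-- The squared Dirichlet norm, in terms of the coefficients. -/
def dirNormSq (a : ℕ → ℂ) : ℝ := ∑' p : ℕ, dirWeight a p

/-- `Φ : 𝔻 → M_m(ℂ)` is a multiplier of `ℂ^m ⊗ D` of multiplier norm at most `1`:
for every `f = (f₁,…,f_m)` in `ℂ^m ⊗ D` (described by its coefficients `a`), the
pointwise product `Φ f` lies in `ℂ^m ⊗ D` and `‖Φ f‖ ≤ ‖f‖`. -/
def IsContractiveDirMultiplier (m : ℕ) (Φ : ℂ → Matrix (Fin m) (Fin m) ℂ) : Prop :=
  ∀ (f : Fin m → ℂ → ℂ) (a : Fin m → ℕ → ℂ),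
    (∀ j, IsCoeff (f j) (a j)) → (∀ j, DirSummable (a j)) →
    ∃ b : Fin m → ℕ → ℂ,
      (∀ j, IsCoeff (fun w => ∑ l, Φ w j l * f l w) (b j)) ∧
      (∀ j, DirSummable (b j)) ∧
      ∑ j, dirNormSq (b j) ≤ ∑ j, dirNormSq (a j)

lemma kaluza_exists : ∃ c : ℕ → ℝ, c 0 = 0 ∧ (∀ n, 0 ≤ c n) ∧ (∀ n, c n ≤ 1) ∧
    ∀ p, ∑ ij ∈ Finset.HasAntidiagonal.antidiagonal p, c ij.1 * (1 / ((ij.2 : ℝ) + 1)) =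
      if p = 0 then 0 else 1 / ((p : ℝ) + 1) := by
  set k : PowerSeries ℝ := PowerSeries.mk fun p => 1 / ((p : ℝ) + 1) with hk
  have hk0 : PowerSeries.constantCoeff k ≠ 0 := by simp [hk]
  have hmul : (1 - k⁻¹) * k = k - 1 := by
    rw [sub_mul, PowerSeries.inv_mul_cancel _ hk0, one_mul]
  set c : ℕ → ℝ := fun n => PowerSeries.coeff n (1 - k⁻¹) with hc
  have hid : ∀ p, ∑ ij ∈ Finset.HasAntidiagonal.antidiagonal p, c ij.1 * (1 / ((ij.2 : ℝ) + 1)) =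
      if p = 0 then 0 else 1 / ((p : ℝ) + 1) := by
    intro p
    have := congrArg (PowerSeries.coeff p) hmul
    rw [PowerSeries.coeff_mul] at this
    simp only [hk, PowerSeries.coeff_mk, map_sub, PowerSeries.coeff_one] at this
    rw [← hk] at this
    simp only [hc, map_sub, PowerSeries.coeff_one]
    rw [this]
    split_ifs with h
    · subst h; simp
    · simp
  have h0 : c 0 = 0 := by simpa using hid 0
  have hs : ∀ n, c (n + 1) = 1 / ((n : ℝ) + 2) -
      ∑ ij ∈ Finset.HasAntidiagonal.antidiagonal n, c ij.1 * (1 / ((ij.2 : ℝ) + 2)) := by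
    intro n
    have := hid (n + 1)
    rw [Finset.Nat.sum_antidiagonal_succ'] at this
    simp at this
    have e : ∀ x : ℝ, x + 1 + 1 = x + 2 := fun x => by ring
    simp only [e] at this
    simp only [one_div]
    linarith
  have hnn : ∀ n, 0 ≤ c n := by
    intro n
    induction n using Nat.strong_induction_on with
    | _ n ih =>
      rcases n with _ | n
      · exact h0.ge
      rw [hs n]
      rcases Nat.eq_zero_or_pos n with rfl | hn
      · simp [h0]
      have h1 := hid n
      rw [if_neg hn.ne'] at h1
      have h2 : 1 / ((n : ℝ) + 2) = ∑ ij ∈ Finset.HasAntidiagonal.antidiagonal n,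
          c ij.1 * (1 / ((ij.2 : ℝ) + 1)) * (((n : ℝ) + 1) / (n + 2)) := by
        rw [← Finset.sum_mul, h1]; field_simp
      rw [h2, ← Finset.sum_sub_distrib]
      refine Finset.sum_nonneg fun ij hij => ?_
      have hle := Finset.HasAntidiagonal.antidiagonal.fst_le hij
      have hle2 : (ij.2 : ℝ) ≤ n := by exact_mod_cast Finset.HasAntidiagonal.antidiagonal.snd_le hij
      have hci := ih ij.1 (by omega)
      have : 1 / ((ij.2 : ℝ) + 2) ≤ (1 / ((ij.2 : ℝ) + 1)) * (((n : ℝ) + 1) / (n + 2)) := by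
        rw [div_mul_div_comm, div_le_div_iff₀ (by positivity) (by positivity)]
        nlinarith
      have := mul_le_mul_of_nonneg_left this hci
      linarith
  refine ⟨c, h0, hnn, fun n => ?_, hid⟩
  rcases n with _ | n
  · rw [h0]; norm_num
  rw [hs n]
  have h1 : 1 / ((n : ℝ) + 2) ≤ 1 := by
    rw [div_le_one (by positivity)]; have : (0:ℝ) ≤ n := by positivity
    linarith
  have : 0 ≤ ∑ ij ∈ Finset.HasAntidiagonal.antidiagonal n, c ij.1 * (1 / ((ij.2 : ℝ) + 2)) :=
    Finset.sum_nonneg fun ij _ => mul_nonneg (hnn _) (by positivity)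
  linarith

lemma eval_mul {f g : PowerSeries ℂ} {w s t : ℂ}
    (hf : HasSum (fun p => PowerSeries.coeff p f * w ^ p) s)
    (hg : HasSum (fun p => PowerSeries.coeff p g * w ^ p) t) :
    HasSum (fun p => PowerSeries.coeff p (f * g) * w ^ p) (s * t) := by
  have h1 := hf.summable.norm
  have h2 := hg.summable.norm
  have h3 := (summable_norm_sum_mul_antidiagonal_of_summable_norm h1 h2).of_norm
  have h4 := tsum_mul_tsum_eq_tsum_sum_antidiagonal_of_summable_norm h1 h2
  rw [hf.tsum_eq, hg.tsum_eq] at h4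
  rw [h4]
  convert! h3.hasSum using 2 with p
  rw [PowerSeries.coeff_mul, Finset.sum_mul]
  refine Finset.sum_congr rfl fun ij hij => ?_
  rw [← Finset.HasAntidiagonal.mem_antidiagonal.mp hij, pow_add]; ring

lemma kernel_identity {c : ℕ → ℝ} (h0 : ∀ n, 0 ≤ c n) (h1 : ∀ n, c n ≤ 1)
    (hid : ∀ p, ∑ ij ∈ Finset.HasAntidiagonal.antidiagonal p, c ij.1 * (1 / ((ij.2 : ℝ) + 1)) =
      if p = 0 then 0 else 1 / ((p : ℝ) + 1)) {t : ℂ} (ht : ‖t‖ < 1) :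
    Summable (fun n => (c n : ℂ) * t ^ n) ∧ Summable (fun r : ℕ => t ^ r / ((r : ℂ) + 1)) ∧
    (1 - ∑' n, (c n : ℂ) * t ^ n) * ∑' r : ℕ, t ^ r / ((r : ℂ) + 1) = 1 := by
  have hg : Summable fun n : ℕ => ‖t‖ ^ n := summable_geometric_of_lt_one (norm_nonneg _) ht
  have hc : Summable (fun n => (c n : ℂ) * t ^ n) := by
    refine Summable.of_norm_bounded hg fun n => ?_
    rw [norm_mul, norm_pow, Complex.norm_real, Real.norm_of_nonneg (h0 n)]
    exact mul_le_of_le_one_left (by positivity) (h1 n)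
  have hk : Summable (fun r : ℕ => t ^ r / ((r : ℂ) + 1)) := by
    refine Summable.of_norm_bounded hg fun n => ?_
    rw [norm_div, norm_pow]
    refine div_le_self (by positivity) ?_
    have : ((n : ℂ) + 1) = ((n + 1 : ℕ) : ℂ) := by push_cast; ring
    rw [this, Complex.norm_natCast]; push_cast; linarith [(Nat.cast_nonneg n : (0:ℝ) ≤ n)]
  refine ⟨hc, hk, ?_⟩
  have hm := eval_mul (f := PowerSeries.mk fun n => (c n : ℂ))
    (g := PowerSeries.mk fun r => 1 / ((r : ℂ) + 1)) (w := t) (by simpa using hc.hasSum)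
    (by simpa [div_eq_mul_inv, mul_comm] using hk.hasSum)
  have hco : ∀ p, PowerSeries.coeff p ((PowerSeries.mk fun n => (c n : ℂ)) *
      (PowerSeries.mk fun r => 1 / ((r : ℂ) + 1))) =
      if p = 0 then 0 else 1 / ((p : ℂ) + 1) := by
    intro p
    rw [PowerSeries.coeff_mul]
    have := congrArg (fun x : ℝ => (x : ℂ)) (hid p)
    simp only [PowerSeries.coeff_mk]
    push_cast at this
    rw [this]
    split_ifs <;> simp
  simp only [hco] at hm
  have h5 : HasSum (fun p : ℕ => t ^ p / ((p : ℂ) + 1) - if p = 0 then 1 else 0)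
      (∑' r : ℕ, t ^ r / ((r : ℂ) + 1) - 1) :=
    hk.hasSum.sub (hasSum_ite_eq 0 1)
  have h6 := hm.unique (by
    convert! h5 using 2 with p
    split_ifs with h
    · subst h; simp
    · ring)
  simp only [← div_eq_mul_inv] at h6
  linear_combination -h6
lemma contraction_ext {E H1 H2 : Type*} [AddCommGroup E] [Module ℂ E] [FiniteDimensional ℂ E]
    [NormedAddCommGroup H1] [InnerProductSpace ℂ H1]
    [NormedAddCommGroup H2] [InnerProductSpace ℂ H2]
    (X : E →ₗ[ℂ] H1) (Y : E →ₗ[ℂ] H2) (h : ∀ e, ‖Y e‖ = ‖X e‖) :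
    ∃ V : H1 →L[ℂ] H2, ‖V‖ ≤ 1 ∧ ∀ e, V (X e) = Y e := by
  obtain ⟨s, hs⟩ := X.rangeRestrict.exists_rightInverse_of_surjective X.range_rangeRestrict
  have hs' : ∀ u : LinearMap.range X, X (s u) = u := fun u => by
    have := LinearMap.congr_fun hs u
    exact congrArg Subtype.val this
  let V0 : LinearMap.range X →L[ℂ] H2 := LinearMap.mkContinuous (Y ∘ₗ s) 1 (fun u => by
    rw [LinearMap.comp_apply, h, hs', one_mul]; rfl)
  have hV0 : ‖V0‖ ≤ 1 := LinearMap.mkContinuous_norm_le _ zero_le_one _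
  refine ⟨V0 ∘L (LinearMap.range X).orthogonalProjectionOnto, ?_, fun e => ?_⟩
  · refine (ContinuousLinearMap.opNorm_comp_le _ _).trans ?_
    exact mul_le_one₀ hV0 (norm_nonneg _) (Submodule.orthogonalProjectionOnto_norm_le _)
  · rw [ContinuousLinearMap.comp_apply]
    have : (LinearMap.range X).orthogonalProjectionOnto (X e) = ⟨X e, ⟨e, rfl⟩⟩ :=
      Submodule.orthogonalProjectionOnto_mem_subspace_eq_self (⟨X e, ⟨e, rfl⟩⟩ : LinearMap.range X)
    rw [this]
    change Y (s _) = Y e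
    rw [← sub_eq_zero, ← map_sub, ← norm_eq_zero, h, map_sub, hs', sub_self, norm_zero]

lemma norm_comb {P H1 H2 : Type*} [Fintype P]
    [NormedAddCommGroup H1] [InnerProductSpace ℂ H1]
    [NormedAddCommGroup H2] [InnerProductSpace ℂ H2] (X : P → H1) (Y : P → H2)
    (h : ∀ p q, inner ℂ (X p) (X q) = inner ℂ (Y p) (Y q)) (e : P → ℂ) :
    ‖∑ p, e p • Y p‖ = ‖∑ p, e p • X p‖ := by
  have : inner ℂ (∑ p, e p • Y p) (∑ p, e p • Y p) = inner ℂ (∑ p, e p • X p) (∑ p, e p • X p) := by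
    simp only [sum_inner, inner_sum, inner_smul_left, inner_smul_right, h]
  rw [inner_self_eq_norm_sq_to_K, inner_self_eq_norm_sq_to_K] at this
  have h2 : ‖∑ p, e p • Y p‖ ^ 2 = ‖∑ p, e p • X p‖ ^ 2 := by exact_mod_cast this
  exact (pow_left_inj₀ (norm_nonneg _) (norm_nonneg _) two_ne_zero).mp h2

lemma lurk {J S P : Type*} [Fintype S] [DecidableEq S] [Fintype P]
    (X : P → lp (fun _ : J => ℂ) 2) (Y : P → EuclideanSpace ℂ S)
    (h : ∀ p q, inner ℂ (X p) (X q) = inner ℂ (Y p) (Y q)) :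
    ∃ w : J → S → ℂ,
      (∀ (x : S → ℂ) (F : Finset J), ∑ j ∈ F, ‖∑ s, w j s * x s‖ ^ 2 ≤ ∑ s, ‖x s‖ ^ 2) ∧
      ∀ p s, HasSum (fun j => (starRingEnd ℂ) (w j s) * X p j) (Y p s) := by
  classical
  obtain ⟨V, hV, hVX⟩ := contraction_ext (Fintype.linearCombination ℂ X)
    (Fintype.linearCombination ℂ Y) (fun e => by
      simpa [Fintype.linearCombination_apply] using norm_comb X Y h e)
  have hV' : ∀ p, V (X p) = Y p := fun p => by
    simpa using hVX (Pi.single p 1)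
  let W := ContinuousLinearMap.adjoint V
  have hW : ‖W‖ ≤ 1 := by rw [LinearIsometryEquiv.norm_map]; exact hV
  refine ⟨fun j s => W (EuclideanSpace.single s 1) j, fun x F => ?_, fun p s => ?_⟩
  · have hx : ∀ j, ∑ s, W (EuclideanSpace.single s 1) j * x s = W (WithLp.toLp 2 x) j := by
      intro j
      have h1 : (WithLp.toLp 2 x : EuclideanSpace ℂ S) =
          ∑ s, x s • EuclideanSpace.single s (1 : ℂ) := by
        ext s; simp [Pi.single_apply]
      rw [h1, map_sum, lp.coeFn_sum, Finset.sum_apply]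
      refine Finset.sum_congr rfl fun s _ => ?_
      rw [map_smul, lp.coeFn_smul, Pi.smul_apply, smul_eq_mul, mul_comm]
    simp only [hx]
    have h2 := lp.sum_rpow_le_norm_rpow (p := 2) (by norm_num) (W (WithLp.toLp 2 x)) F
    simp only [ENNReal.toReal_ofNat, Real.rpow_ofNat] at h2
    refine h2.trans ?_
    rw [← EuclideanSpace.norm_sq_eq (WithLp.toLp 2 x : EuclideanSpace ℂ S)]
    have := (W.le_opNorm (WithLp.toLp 2 x)).trans
      (mul_le_of_le_one_left (norm_nonneg _) hW)
    exact pow_le_pow_left₀ (norm_nonneg _) this 2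
  · have h1 := lp.hasSum_inner (𝕜 := ℂ) (W (EuclideanSpace.single s 1)) (X p)
    rw [ContinuousLinearMap.adjoint_inner_left, hV'] at h1
    rw [EuclideanSpace.inner_single_left] at h1
    simpa [mul_comm] using h1

lemma sum_antidiag_le (P : ℕ) (F : ℕ × ℕ → ℝ) (hF : ∀ x, 0 ≤ F x) :
    ∑ p ∈ Finset.range P, ∑ ij ∈ Finset.HasAntidiagonal.antidiagonal p, F ij ≤
      ∑ j ∈ Finset.range P, ∑ i ∈ Finset.range P, F (i, j) := by
  have h1 : ∀ p ∈ Finset.range P, ∑ ij ∈ Finset.HasAntidiagonal.antidiagonal p, F ij =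
      ∑ ij ∈ (Finset.range P ×ˢ Finset.range P) with ij.1 + ij.2 = p, F ij := by
    intro p hp
    refine Finset.sum_congr ?_ fun _ _ => rfl
    ext ij
    simp only [Finset.HasAntidiagonal.mem_antidiagonal, Finset.mem_filter, Finset.mem_product,
      Finset.mem_range] at hp ⊢
    omega
  rw [Finset.sum_congr rfl h1, Finset.sum_fiberwise_eq_sum_filter, ← Finset.sum_product_right']
  exact Finset.sum_le_sum_of_subset_of_nonneg (Finset.filter_subset _ _) fun _ _ _ => hF _

lemma energy_term {c : ℕ → ℝ} (hc0 : c 0 = 0) (hnn : ∀ n, 0 ≤ c n)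
    (hid : ∀ p, ∑ ij ∈ Finset.HasAntidiagonal.antidiagonal p, c ij.1 * (1 / ((ij.2 : ℝ) + 1)) =
      if p = 0 then 0 else 1 / ((p : ℝ) + 1)) (g : ℕ → ℕ → ℂ) (p : ℕ) {t : ℝ} (ht0 : 0 ≤ t)
    (ht1 : t ≤ 1) :
    ((p : ℝ) + 1) * t ^ p *
      ‖∑ ij ∈ Finset.HasAntidiagonal.antidiagonal p, (Real.sqrt (c ij.1) : ℂ) * g ij.2 ij.1‖ ^ 2 ≤
    ∑ ij ∈ Finset.HasAntidiagonal.antidiagonal p,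
      t * (((ij.2 : ℝ) + 1) * t ^ ij.2 * ‖g ij.2 ij.1‖ ^ 2) := by
  set A := Finset.HasAntidiagonal.antidiagonal p with hA
  set G : ℕ × ℕ → ℝ := fun ij => if ij.1 = 0 then 0 else ((ij.2 : ℝ) + 1) * ‖g ij.2 ij.1‖ ^ 2
    with hG
  have hG0 : ∀ ij, 0 ≤ G ij := fun ij => by
    simp only [hG]; split_ifs <;> positivity
  have h1 : ‖∑ ij ∈ A, (Real.sqrt (c ij.1) : ℂ) * g ij.2 ij.1‖ ^ 2 ≤
      (∑ ij ∈ A, Real.sqrt (c ij.1) * ‖g ij.2 ij.1‖) ^ 2 := by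
    refine pow_le_pow_left₀ (norm_nonneg _) ((norm_sum_le _ _).trans_eq ?_) 2
    refine Finset.sum_congr rfl fun ij _ => ?_
    rw [norm_mul, Complex.norm_real, Real.norm_of_nonneg (Real.sqrt_nonneg _)]
  have h2 : (∑ ij ∈ A, Real.sqrt (c ij.1) * ‖g ij.2 ij.1‖) ^ 2 ≤
      (∑ ij ∈ A, c ij.1 * (1 / ((ij.2 : ℝ) + 1))) * ∑ ij ∈ A, G ij := by
    refine Finset.sum_sq_le_sum_mul_sum_of_sq_le_mul A
      (fun ij _ => mul_nonneg (hnn _) (by positivity)) (fun ij _ => hG0 ij) fun ij _ => le_of_eq ?_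
    rw [mul_pow, Real.sq_sqrt (hnn _)]
    simp only [hG]
    split_ifs with h
    · rw [h, hc0]; simp
    · field_simp
  have h3 : ∑ ij ∈ A, c ij.1 * (1 / ((ij.2 : ℝ) + 1)) ≤ 1 / ((p : ℝ) + 1) := by
    rw [hA, hid]; split_ifs
    · positivity
    · exact le_rfl
  have h4 : 0 ≤ ∑ ij ∈ A, G ij := Finset.sum_nonneg fun ij _ => hG0 ij
  have h5 := (h1.trans h2).trans (mul_le_mul_of_nonneg_right h3 h4)
  calc _ ≤ ((p : ℝ) + 1) * t ^ p * (1 / ((p : ℝ) + 1) * ∑ ij ∈ A, G ij) := by gcongr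
    _ = ∑ ij ∈ A, t ^ p * G ij := by rw [← Finset.mul_sum]; field_simp
    _ ≤ _ := by
      refine Finset.sum_le_sum fun ij hij => ?_
      rw [← Finset.HasAntidiagonal.mem_antidiagonal.mp hij, pow_add]
      simp only [hG]
      split_ifs with h
      · simp; positivity
      · have : t ^ ij.1 ≤ t := pow_le_of_le_one ht0 ht1 h
        have h7 : 0 ≤ t ^ ij.2 * (((ij.2 : ℝ) + 1) * ‖g ij.2 ij.1‖ ^ 2) := by positivity
        nlinarith [mul_le_mul_of_nonneg_right this h7]

/-- Energy estimates for the colligation. -/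
lemma energy {m N : ℕ} {c : ℕ → ℝ} (hc0 : c 0 = 0) (hnn : ∀ n, 0 ≤ c n)
    (hid : ∀ p, ∑ ij ∈ Finset.HasAntidiagonal.antidiagonal p, c ij.1 * (1 / ((ij.2 : ℝ) + 1)) =
      if p = 0 then 0 else 1 / ((p : ℝ) + 1))
    (w : Fin m ⊕ (ℕ × Fin N) → Fin m ⊕ Fin N → ℂ)
    (hw : ∀ (x : Fin m ⊕ Fin N → ℂ) (F : Finset (Fin m ⊕ (ℕ × Fin N))),
      ∑ j ∈ F, ‖∑ s, w j s * x s‖ ^ 2 ≤ ∑ s, ‖x s‖ ^ 2)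
    (x : ℕ → Fin m ⊕ Fin N → ℂ)
    (hx : ∀ p s, x p (Sum.inr s) = ∑ ij ∈ Finset.HasAntidiagonal.antidiagonal p,
      (Real.sqrt (c ij.1) : ℂ) * ∑ s', w (Sum.inr (ij.1, s)) s' * x ij.2 s')
    {t : ℝ} (ht0 : 0 ≤ t) (ht1 : t ≤ 1) (P : ℕ) :
    ∑ p ∈ Finset.range P, ((p : ℝ) + 1) * t ^ p * ∑ s, ‖x p (Sum.inr s)‖ ^ 2 ≤
    t * (∑ p ∈ Finset.range P, ((p : ℝ) + 1) * t ^ p * ∑ a, ‖x p (Sum.inl a)‖ ^ 2 +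
      ∑ p ∈ Finset.range P, ((p : ℝ) + 1) * t ^ p * ∑ s, ‖x p (Sum.inr s)‖ ^ 2 -
      ∑ p ∈ Finset.range P, ((p : ℝ) + 1) * t ^ p *
        ∑ a, ‖∑ s', w (Sum.inl a) s' * x p s'‖ ^ 2) := by
  have hA : ∀ p, ∑ a, ‖∑ s', w (Sum.inl a) s' * x p s'‖ ^ 2 +
      ∑ s, ∑ n ∈ Finset.range P, ‖∑ s', w (Sum.inr (n, s)) s' * x p s'‖ ^ 2 ≤
      ∑ a, ‖x p (Sum.inl a)‖ ^ 2 + ∑ s, ‖x p (Sum.inr s)‖ ^ 2 := by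
    intro p
    have := hw (x p) (Finset.univ.disjSum (Finset.range P ×ˢ Finset.univ))
    rw [Finset.sum_disjSum, Finset.sum_product_right, Fintype.sum_sum_type] at this
    simpa only [Fintype.sum_sum_type] using this
  have hB : ∑ p ∈ Finset.range P, ((p : ℝ) + 1) * t ^ p * ∑ s, ‖x p (Sum.inr s)‖ ^ 2 ≤
      t * ∑ p ∈ Finset.range P, ((p : ℝ) + 1) * t ^ p *
        ∑ s, ∑ n ∈ Finset.range P, ‖∑ s', w (Sum.inr (n, s)) s' * x p s'‖ ^ 2 := by
    simp only [Finset.mul_sum (s := (Finset.univ : Finset (Fin N)))]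
    rw [Finset.sum_comm, Finset.sum_comm (t := (Finset.univ : Finset (Fin N))), Finset.mul_sum]
    refine Finset.sum_le_sum fun s _ => ?_
    calc _ ≤ ∑ p ∈ Finset.range P, ∑ ij ∈ Finset.HasAntidiagonal.antidiagonal p,
          t * (((ij.2 : ℝ) + 1) * t ^ ij.2 *
            ‖∑ s', w (Sum.inr (ij.1, s)) s' * x ij.2 s'‖ ^ 2) := by
          refine Finset.sum_le_sum fun p _ => ?_
          rw [hx p s]
          exact energy_term hc0 hnn hid (fun q n => ∑ s', w (Sum.inr (n, s)) s' * x q s') p ht0 ht1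
      _ ≤ _ := sum_antidiag_le P (fun ij => t * (((ij.2 : ℝ) + 1) * t ^ ij.2 *
            ‖∑ s', w (Sum.inr (ij.1, s)) s' * x ij.2 s'‖ ^ 2)) (fun _ => by positivity)
      _ = _ := by simp only [Finset.mul_sum]
  refine hB.trans (mul_le_mul_of_nonneg_left ?_ ht0)
  rw [← Finset.sum_add_distrib, ← Finset.sum_sub_distrib]
  refine Finset.sum_le_sum fun p _ => ?_
  rw [← mul_add, ← mul_sub]
  exact mul_le_mul_of_nonneg_left (by linarith [hA p]) (by positivity)

lemma summable_of_sq {x : ℕ → ℂ} {w : ℂ} (hw : ‖w‖ < 1)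
    (h : Summable fun p => ‖x p‖ ^ 2 * ‖w‖ ^ p) : Summable fun p => x p * w ^ p := by
  refine Summable.of_norm_bounded
    (h.add (summable_geometric_of_lt_one (norm_nonneg w) hw)) fun p => ?_
  rw [norm_mul, norm_pow]
  have : 0 ≤ ‖w‖ ^ p := by positivity
  have h2 : ‖x p‖ ≤ ‖x p‖ ^ 2 + 1 := by nlinarith [sq_nonneg (‖x p‖ - 1)]
  nlinarith [mul_le_mul_of_nonneg_right h2 this]

lemma diff_of_bound {a : ℕ → ℂ} {C : ℝ} (ha : ∀ p, ‖a p‖ ≤ C) :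
    DifferentiableOn ℂ (fun w => ∑' p, a p * w ^ p) (ball (0 : ℂ) 1) := by
  intro w hw
  rw [mem_ball_zero_iff] at hw
  obtain ⟨r, hr1, hr2⟩ := exists_between hw
  have hr0 : 0 ≤ r := (norm_nonneg w).trans hr1.le
  have h := differentiableOn_tsum_of_summable_norm (U := ball (0 : ℂ) r)
    (F := fun p w => a p * w ^ p) (u := fun p => C * r ^ p)
    ((summable_geometric_of_lt_one hr0 hr2).mul_left C)
    (fun p => by fun_prop) isOpen_ball (fun p v hv => by
      rw [mem_ball_zero_iff] at hv
      rw [norm_mul, norm_pow]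
      have := (norm_nonneg _).trans (ha p)
      gcongr
      exact ha p)
  exact (h.differentiableAt (isOpen_ball.mem_nhds (by simpa using hr1))).differentiableWithinAt

def kap (t : ℂ) : ℂ := ∑' r : ℕ, t ^ r / ((r : ℂ) + 1)

lemma kap_hasSum {t : ℂ} (ht : ‖t‖ < 1) : HasSum (fun r : ℕ => t ^ r / ((r : ℂ) + 1)) (kap t) := by
  obtain ⟨c, -, h0, h1, hid⟩ := kaluza_exists
  exact (kernel_identity h0 h1 hid ht).2.1.hasSum

lemma kap_conj (t : ℂ) : (starRingEnd ℂ) (kap t) = kap ((starRingEnd ℂ) t) := by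
  unfold kap
  rw [Complex.conj_tsum]
  simp

/-- coefficients of a combination of kernel functions -/
def Fc {n : ℕ} (lam x : Fin n → ℂ) (r : ℕ) : ℂ :=
  ∑ i, (starRingEnd ℂ) (lam i) ^ r / ((r : ℂ) + 1) * x i

def Ff {n : ℕ} (lam x : Fin n → ℂ) (w : ℂ) : ℂ :=
  ∑ j, x j * kap (w * (starRingEnd ℂ) (lam j))

lemma norm_mul_conj_lt {a b : ℂ} (ha : ‖a‖ < 1) (hb : ‖b‖ < 1) :
    ‖a * (starRingEnd ℂ) b‖ < 1 := by
  rw [norm_mul, RCLike.norm_conj]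
  exact mul_lt_one_of_nonneg_of_lt_one_left (norm_nonneg _) ha hb.le

lemma Fc_isCoeff {n : ℕ} {lam : Fin n → ℂ} (hl : ∀ i, ‖lam i‖ < 1) (x : Fin n → ℂ) :
    IsCoeff (Ff lam x) (Fc lam x) := by
  intro w hw
  rw [mem_ball_zero_iff] at hw
  have := hasSum_sum (s := Finset.univ) fun j (_ : j ∈ Finset.univ) =>
    (kap_hasSum (norm_mul_conj_lt hw (hl j))).mul_left (x j)
  refine this.congr_fun ?_ |> id
  intro r
  simp only [Fc, Finset.sum_mul]
  refine Finset.sum_congr rfl fun j _ => ?_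
  rw [mul_pow]; ring

lemma reproducing {n : ℕ} {lam : Fin n → ℂ} (x : Fin n → ℂ) {b : ℕ → ℂ} {β : Fin n → ℂ}
    (hb : ∀ i, HasSum (fun r => b r * lam i ^ r) (β i)) :
    HasSum (fun r : ℕ => ((r : ℂ) + 1) * ((starRingEnd ℂ) (Fc lam x r) * b r))
      (∑ i, (starRingEnd ℂ) (x i) * β i) := by
  have := hasSum_sum (s := Finset.univ) fun j (_ : j ∈ Finset.univ) =>
    (hb j).mul_left ((starRingEnd ℂ) (x j))
  refine this.congr_fun ?_ |> id
  intro r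
  simp only [Fc, map_sum, map_mul, map_div₀, map_pow, Complex.conj_conj, map_add, map_natCast,
    map_one, Finset.sum_mul, Finset.mul_sum]
  refine Finset.sum_congr rfl fun j _ => ?_
  have : ((r : ℂ) + 1) ≠ 0 := Nat.cast_add_one_ne_zero r
  field_simp

lemma Fc_norm {n : ℕ} {lam : Fin n → ℂ} (hl : ∀ i, ‖lam i‖ < 1) (x : Fin n → ℂ) :
    DirSummable (Fc lam x) ∧
    (dirNormSq (Fc lam x) : ℂ) = ∑ i, (starRingEnd ℂ) (x i) * Ff lam x (lam i) := by
  have h := reproducing x (fun i => Fc_isCoeff hl x (lam i) (by simpa using hl i))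
  have h2 : ∀ r : ℕ, ((r : ℂ) + 1) * ((starRingEnd ℂ) (Fc lam x r) * Fc lam x r) =
      ((dirWeight (Fc lam x) r : ℝ) : ℂ) := by
    intro r
    rw [Complex.conj_mul', dirWeight]; push_cast; ring
  simp only [h2] at h
  have h3 : Summable (dirWeight (Fc lam x)) := Complex.summable_ofReal.mp h.summable
  exact ⟨h3, by rw [dirNormSq, Complex.ofReal_tsum, h.tsum_eq]⟩

lemma necessity (m n : ℕ) (lam : Fin n → ℂ) (hl : ∀ i, ‖lam i‖ < 1)
    (z : Fin n → Matrix (Fin m) (Fin m) ℂ) (Φ : ℂ → Matrix (Fin m) (Fin m) ℂ)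
    (hz : ∀ i, Φ (lam i) = z i) (hΦ : IsContractiveDirMultiplier m Φ) :
    (Matrix.of fun p q : Fin n × Fin m =>
      ((1 : Matrix (Fin m) (Fin m) ℂ) - z p.1 * (z q.1)ᴴ) p.2 q.2 *
        kap (lam p.1 * (starRingEnd ℂ) (lam q.1))).PosSemidef := by
  refine Matrix.PosSemidef.of_dotProduct_mulVec_nonneg ?_ fun x => ?_
  · ext p q
    rw [Matrix.conjTranspose_apply, Matrix.of_apply, Matrix.of_apply, star_mul',
      ← Matrix.conjTranspose_apply, Matrix.conjTranspose_sub, Matrix.conjTranspose_mul,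
      Matrix.conjTranspose_conjTranspose, Matrix.conjTranspose_one]
    congr 1
    rw [← starRingEnd_apply, kap_conj, map_mul, Complex.conj_conj, mul_comm]
  set X : Fin m → Fin n → ℂ := fun a i => x (i, a) with hX
  set u : Fin m → Fin n → ℂ := fun l i => ∑ a, (starRingEnd ℂ) (z i a l) * x (i, a) with hu
  obtain ⟨b, hb1, hb2, hb3⟩ := hΦ (fun l => Ff lam (u l)) (fun l => Fc lam (u l))
    (fun l => Fc_isCoeff hl _) (fun l => (Fc_norm hl _).1)
  have hin : ∀ a, HasSum (fun r : ℕ => ((r : ℂ) + 1) *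
      ((starRingEnd ℂ) (Fc lam (X a) r) * b a r))
      (∑ i, (starRingEnd ℂ) (X a i) * ∑ l, z i a l * Ff lam (u l) (lam i)) := by
    intro a
    refine reproducing (X a) fun i => ?_
    have := hb1 a (lam i) (by simpa using hl i)
    simpa [hz] using this
  have hG : ∑ a, ∑ i, (starRingEnd ℂ) (X a i) * ∑ l, z i a l * Ff lam (u l) (lam i) =
      ((∑ l, dirNormSq (Fc lam (u l)) : ℝ) : ℂ) := by
    push_cast
    rw [Finset.sum_congr rfl fun l _ => (Fc_norm hl (u l)).2]
    simp only [hu, hX, map_sum, map_mul, Complex.conj_conj, Finset.sum_mul, Finset.mul_sum]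
    rw [Finset.sum_comm, Finset.sum_comm (s := (Finset.univ : Finset (Fin m)))
      (t := (Finset.univ : Finset (Fin n)))]
    refine Finset.sum_congr rfl fun i _ => ?_
    rw [Finset.sum_comm]
    refine Finset.sum_congr rfl fun l _ => Finset.sum_congr rfl fun a _ => ?_
    ring
  have hle : 2 * ∑ l, dirNormSq (Fc lam (u l)) ≤
      ∑ a, dirNormSq (Fc lam (X a)) + ∑ a, dirNormSq (b a) := by
    have h1 := Complex.hasSum_re (hasSum_sum (s := Finset.univ) fun a (_ : a ∈ Finset.univ) => hin a)
    rw [hG, Complex.ofReal_re] at h1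
    have h2 := hasSum_sum (s := Finset.univ) fun a (_ : a ∈ Finset.univ) =>
      ((Fc_norm hl (X a)).1.hasSum.add (hb2 a).hasSum)
    rw [← Finset.sum_add_distrib]
    refine hasSum_le (fun r => ?_) (h1.mul_left 2) h2
    rw [Complex.re_sum, Finset.mul_sum]
    refine Finset.sum_le_sum fun a _ => ?_
    have e : (r : ℂ) + 1 = ((r + 1 : ℝ) : ℂ) := by push_cast; ring
    rw [e, Complex.re_ofReal_mul]
    simp only [dirWeight]
    rw [← Complex.normSq_eq_norm_sq, ← Complex.normSq_eq_norm_sq, Complex.normSq_apply,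
      Complex.normSq_apply, Complex.mul_re, Complex.conj_re, Complex.conj_im]
    have hr : (0 : ℝ) ≤ (r : ℝ) + 1 := by positivity
    nlinarith [mul_nonneg hr (sq_nonneg ((Fc lam (X a) r).re - (b a r).re)),
      mul_nonneg hr (sq_nonneg ((Fc lam (X a) r).im - (b a r).im))]
  have hfin : star x ⬝ᵥ (Matrix.of (fun p q : Fin n × Fin m =>
      ((1 : Matrix (Fin m) (Fin m) ℂ) - z p.1 * (z q.1)ᴴ) p.2 q.2 *
        kap (lam p.1 * (starRingEnd ℂ) (lam q.1))) *ᵥ x) =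
      ((∑ a, dirNormSq (Fc lam (X a)) - ∑ l, dirNormSq (Fc lam (u l)) : ℝ) : ℂ) := by
    push_cast
    rw [Finset.sum_congr rfl fun l _ => (Fc_norm hl (u l)).2,
      Finset.sum_congr rfl fun l _ => (Fc_norm hl (X l)).2]
    simp only [dotProduct, mulVec, Matrix.of_apply, Fintype.sum_prod_type, Pi.star_apply,
      Matrix.sub_apply, sub_mul, Finset.sum_sub_distrib, mul_sub]
    congr 1
    · rw [Finset.sum_comm]
      refine Finset.sum_congr rfl fun a _ => Finset.sum_congr rfl fun i _ => ?_
      simp only [Matrix.one_apply, Ff, hX]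
      congr 1
      refine Finset.sum_congr rfl fun j _ => ?_
      simp [mul_comm]
    · rw [Finset.sum_comm (s := (Finset.univ : Finset (Fin m))) (t := (Finset.univ : Finset (Fin n)))]
      refine Finset.sum_congr rfl fun i _ => ?_
      simp only [Ff, hu, Finset.mul_sum, map_sum, Finset.sum_mul, Matrix.mul_apply,
        Matrix.conjTranspose_apply]
      refine (Finset.sum_comm.trans ?_).trans Finset.sum_comm
      refine Finset.sum_congr rfl fun j _ => ?_
      refine (Finset.sum_comm.trans ?_).trans Finset.sum_comm
      refine Finset.sum_congr rfl fun b _ => ?_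
      refine Finset.sum_comm.trans ?_
      refine Finset.sum_congr rfl fun l _ => Finset.sum_congr rfl fun a _ => ?_
      simp only [starRingEnd_apply, star_mul', star_star]
      ring
  rw [hfin]
  exact_mod_cast (by linarith : (0:ℝ) ≤ ∑ a, dirNormSq (Fc lam (X a)) -
    ∑ l, dirNormSq (Fc lam (u l)))

lemma hasSum_J {m N : ℕ} {f : Fin m ⊕ (ℕ × Fin N) → ℂ} {a : Fin N → ℂ}
    (h : ∀ s, HasSum (fun n => f (Sum.inr (n, s))) (a s)) :
    HasSum f (∑ b, f (Sum.inl b) + ∑ s, a s) := by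
  have h1 : ∀ s, HasSum (fun j : ℕ × Fin N => if j.2 = s then f (Sum.inr j) else 0) (a s) := by
    intro s
    have hi : Function.Injective fun n : ℕ => (n, s) := fun x y h => by simpa using h
    refine (hi.hasSum_iff ?_).mp ?_
    · rintro ⟨n, s'⟩ hx
      refine if_neg fun h => hx ⟨n, ?_⟩
      simpa using h.symm
    · simpa [Function.comp_def] using h s
  have h2 := hasSum_sum (s := Finset.univ) fun s (_ : s ∈ Finset.univ) => h1 s
  simp only [Finset.sum_ite_eq, Finset.mem_univ, if_true] at h2
  exact HasSum.sum (hasSum_fintype _) h2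

lemma colligation_series {m N : ℕ} {c : ℕ → ℝ} (hc0 : c 0 = 0)
    (w : Fin m ⊕ (ℕ × Fin N) → Fin m ⊕ Fin N → ℂ) :
    ∃ Φ : Matrix (Fin m) (Fin m) (PowerSeries ℂ), ∀ f : Fin m → PowerSeries ℂ,
      ∃ x : ℕ → Fin m ⊕ Fin N → ℂ, (∀ p b, x p (Sum.inl b) = PowerSeries.coeff p (f b)) ∧
      (∀ p s, x p (Sum.inr s) = ∑ ij ∈ Finset.HasAntidiagonal.antidiagonal p,
        (Real.sqrt (c ij.1) : ℂ) * ∑ s', w (Sum.inr (ij.1, s)) s' * x ij.2 s') ∧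
      (∀ p a, PowerSeries.coeff p ((Φ *ᵥ f) a) = ∑ s', w (Sum.inl a) s' * x p s') := by
  let K : Matrix (Fin N) (Fin N) (PowerSeries ℂ) := Matrix.of fun s s' =>
    PowerSeries.mk fun n => (Real.sqrt (c n) : ℂ) * w (Sum.inr (n, s)) (Sum.inr s')
  let L : Matrix (Fin N) (Fin m) (PowerSeries ℂ) := Matrix.of fun s b =>
    PowerSeries.mk fun n => (Real.sqrt (c n) : ℂ) * w (Sum.inr (n, s)) (Sum.inl b)
  let A : Matrix (Fin m) (Fin m) (PowerSeries ℂ) := Matrix.of fun a b =>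
    PowerSeries.C (w (Sum.inl a) (Sum.inl b))
  let B : Matrix (Fin m) (Fin N) (PowerSeries ℂ) := Matrix.of fun a s =>
    PowerSeries.C (w (Sum.inl a) (Sum.inr s))
  have hdet : IsUnit (1 - K).det := by
    rw [PowerSeries.isUnit_iff_constantCoeff, RingHom.map_det]
    have : (PowerSeries.constantCoeff (R := ℂ)).mapMatrix (1 - K) = 1 := by
      rw [map_sub, map_one]
      ext s s'
      simp [K, hc0]
    rw [this]; simp
  let H : Matrix (Fin N) (Fin m) (PowerSeries ℂ) := (1 - K)⁻¹ * L
  have hH : H = L + K * H := by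
    have : (1 - K) * H = L := Matrix.mul_nonsing_inv_cancel_left _ _ hdet
    rw [Matrix.sub_mul, Matrix.one_mul] at this
    rw [← this]; abel
  refine ⟨A + B * H, fun f => ⟨fun p => Sum.elim (fun b => PowerSeries.coeff p (f b))
    (fun s => PowerSeries.coeff p ((H *ᵥ f) s)), fun p b => rfl, fun p s => ?_, fun p a => ?_⟩⟩
  · have h1 : H *ᵥ f = L *ᵥ f + K *ᵥ (H *ᵥ f) := by
      rw [Matrix.mulVec_mulVec, ← Matrix.add_mulVec, ← hH]
    generalize H *ᵥ f = h at h1 ⊢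
    have h2 := congrArg (PowerSeries.coeff p) (congrFun h1 s)
    simp only [Sum.elim_inl, Sum.elim_inr, Fintype.sum_sum_type]
    rw [h2, Pi.add_apply, map_add]
    simp only [mulVec, dotProduct, map_sum, PowerSeries.coeff_mul, mul_add, Finset.mul_sum,
      Finset.sum_add_distrib, L, K, Matrix.of_apply, PowerSeries.coeff_mk, mul_assoc]
    congr 1
    · exact Finset.sum_comm
    · exact Finset.sum_comm
  · rw [Matrix.add_mulVec, ← Matrix.mulVec_mulVec]
    simp only [Fintype.sum_sum_type, Sum.elim_inl, Sum.elim_inr, Pi.add_apply, map_add]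
    simp only [mulVec, dotProduct, map_sum, A, B, Matrix.of_apply, PowerSeries.coeff_C_mul]

lemma weight_bound {x : ℕ → ℂ} (h : DirSummable x) : ∃ C, ∀ p, ‖x p‖ ≤ C := by
  refine ⟨dirNormSq x + 1, fun p => ?_⟩
  have h1 : dirWeight x p ≤ dirNormSq x :=
    h.le_tsum p fun q _ => by unfold dirWeight; positivity
  unfold dirWeight at h1
  have h2 : ‖x p‖ ≤ ‖x p‖ ^ 2 + 1 := by nlinarith [sq_nonneg (‖x p‖ - 1)]
  have h3 : 0 ≤ (p : ℝ) * ‖x p‖ ^ 2 := by positivity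
  nlinarith

lemma summable_of_dir {x : ℕ → ℂ} (h : DirSummable x) {w : ℂ} (hw : ‖w‖ < 1) :
    Summable fun p => x p * w ^ p := by
  refine summable_of_sq hw (Summable.of_nonneg_of_le (fun p => by positivity) (fun p => ?_) h)
  unfold dirWeight
  have h1 : ‖w‖ ^ p ≤ 1 := pow_le_one₀ (norm_nonneg _) hw.le
  have h2 : 0 ≤ (p : ℝ) * ‖x p‖ ^ 2 := by positivity
  nlinarith [mul_le_mul_of_nonneg_left h1 (sq_nonneg ‖x p‖)]

lemma contractive_of_partial {m : ℕ} {a b : Fin m → ℕ → ℂ} (ha : ∀ j, DirSummable (a j))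
    (h : ∀ P : ℕ, ∑ p ∈ Finset.range P, ((p : ℝ) + 1) * ∑ j, ‖b j p‖ ^ 2 ≤
      ∑ p ∈ Finset.range P, ((p : ℝ) + 1) * ∑ j, ‖a j p‖ ^ 2) :
    (∀ j, DirSummable (b j)) ∧ ∑ j, dirNormSq (b j) ≤ ∑ j, dirNormSq (a j) := by
  have e : ∀ (y : Fin m → ℕ → ℂ) (p : ℕ), ((p : ℝ) + 1) * ∑ j, ‖y j p‖ ^ 2 =
      ∑ j, dirWeight (y j) p := fun y p => by simp only [dirWeight, Finset.mul_sum]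
  simp only [e] at h
  have nn : ∀ (y : ℕ → ℂ) p, 0 ≤ dirWeight y p := fun y p => by unfold dirWeight; positivity
  have hA := hasSum_sum (s := Finset.univ) fun j (_ : j ∈ Finset.univ) => (ha j).hasSum
  have hb : ∀ P : ℕ, ∑ p ∈ Finset.range P, ∑ j, dirWeight (b j) p ≤ ∑ j, dirNormSq (a j) :=
    fun P => (h P).trans (sum_le_hasSum _ (fun p _ => Finset.sum_nonneg fun j _ => nn _ _) hA)
  have hS : Summable fun p => ∑ j, dirWeight (b j) p :=
    summable_of_sum_range_le (fun p => Finset.sum_nonneg fun j _ => nn _ _) hb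
  have hj : ∀ j, DirSummable (b j) := fun j =>
    Summable.of_nonneg_of_le (nn _) (fun p => Finset.single_le_sum
      (f := fun j => dirWeight (b j) p) (fun j _ => nn _ _) (Finset.mem_univ j)) hS
  refine ⟨hj, ?_⟩
  have hB := hasSum_sum (s := Finset.univ) fun j (_ : j ∈ Finset.univ) => (hj j).hasSum
  exact hasSum_le_of_sum_le hB fun F => by
    obtain ⟨P, hP⟩ := F.exists_nat_subset_range
    exact (Finset.sum_le_sum_of_subset_of_nonneg hP
      fun p _ _ => Finset.sum_nonneg fun j _ => nn _ _).trans (hb P)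

lemma sufficiency (m n : ℕ) (lam : Fin n → ℂ) (hl : ∀ i, ‖lam i‖ < 1)
    (z : Fin n → Matrix (Fin m) (Fin m) ℂ)
    (hM : (Matrix.of fun p q : Fin n × Fin m =>
      ((1 : Matrix (Fin m) (Fin m) ℂ) - z p.1 * (z q.1)ᴴ) p.2 q.2 *
        kap (lam p.1 * (starRingEnd ℂ) (lam q.1))).PosSemidef) :
    ∃ Φ : ℂ → Matrix (Fin m) (Fin m) ℂ,
      (∀ k l, DifferentiableOn ℂ (fun w => Φ w k l) (ball (0 : ℂ) 1)) ∧
      (∀ i, Φ (lam i) = z i) ∧ IsContractiveDirMultiplier m Φ := by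
  obtain ⟨N, v, hv⟩ := Matrix.posSemidef_iff_eq_sum_vecMulVec.mp hM
  obtain ⟨c, hc0, hnn, hc1, hid⟩ := kaluza_exists
  have hv' : ∀ p q : Fin n × Fin m, ((1 : Matrix (Fin m) (Fin m) ℂ) - z p.1 * (z q.1)ᴴ) p.2 q.2 *
        kap (lam p.1 * (starRingEnd ℂ) (lam q.1)) = ∑ s, v s p * (starRingEnd ℂ) (v s q) := by
    intro p q
    have := congrFun (congrFun hv p) q
    simpa [Matrix.sum_apply, vecMulVec_apply] using this
  have hsq : ∀ k : ℕ, (Real.sqrt (c k) : ℂ) * (Real.sqrt (c k) : ℂ) = (c k : ℂ) := fun k => by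
    rw [← Complex.ofReal_mul, Real.mul_self_sqrt (hnn k)]
  -- the vectors of the lurking isometry
  let X0 : Fin n × Fin m → Fin m ⊕ (ℕ × Fin N) → ℂ := fun p =>
    Sum.elim (fun b => if b = p.2 then 1 else 0)
      (fun k => (Real.sqrt (c k.1) : ℂ) * (starRingEnd ℂ) (lam p.1) ^ k.1 *
        (starRingEnd ℂ) (v k.2 p))
  have hX0 : ∀ p q, HasSum (fun j => (starRingEnd ℂ) (X0 p j) * X0 q j)
      ((if p.2 = q.2 then 1 else 0) +
        (∑' k, (c k : ℂ) * (lam p.1 * (starRingEnd ℂ) (lam q.1)) ^ k) *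
          ∑ s, v s p * (starRingEnd ℂ) (v s q)) := by
    intro p q
    have hs := (kernel_identity hnn hc1 hid (norm_mul_conj_lt (hl p.1) (hl q.1))).1.hasSum
    have h1 := hasSum_J (f := fun j => (starRingEnd ℂ) (X0 p j) * X0 q j)
      (a := fun s => (∑' k, (c k : ℂ) * (lam p.1 * (starRingEnd ℂ) (lam q.1)) ^ k) *
        (v s p * (starRingEnd ℂ) (v s q))) (fun s => by
        refine (hs.mul_right _).congr_fun ?_ |> id
        intro k
        simp only [X0, Sum.elim_inr, map_mul, map_pow, Complex.conj_conj, Complex.conj_ofReal,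
          ← hsq k, mul_pow]
        ring)
    rw [← Finset.mul_sum] at h1
    convert! h1 using 2
    simp [X0, eq_comm]
  have hmem : ∀ p, Memℓp (X0 p) 2 := by
    intro p
    refine memℓp_gen ?_
    have h1 := (hX0 p p).summable
    have h2 : ∀ j, (starRingEnd ℂ) (X0 p j) * X0 p j = ((‖X0 p j‖ ^ 2 : ℝ) : ℂ) := fun j => by
      rw [Complex.conj_mul']; push_cast; rfl
    simp only [h2] at h1
    simpa using Complex.summable_ofReal.mp h1
  let X : Fin n × Fin m → lp (fun _ : Fin m ⊕ (ℕ × Fin N) => ℂ) 2 := fun p => ⟨X0 p, hmem p⟩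
  let Y0 : Fin n × Fin m → Fin m ⊕ Fin N → ℂ := fun p =>
    Sum.elim (fun b => (starRingEnd ℂ) (z p.1 p.2 b)) (fun s => (starRingEnd ℂ) (v s p))
  have hgram : ∀ p q, inner ℂ (X p) (X q) =
      inner ℂ (WithLp.toLp 2 (Y0 p) : EuclideanSpace ℂ (Fin m ⊕ Fin N)) (WithLp.toLp 2 (Y0 q)) := by
    intro p q
    have h1 : inner ℂ (X p) (X q) = _ := (lp.hasSum_inner (𝕜 := ℂ) (X p) (X q)).unique
      (by simpa [X, mul_comm] using hX0 p q)
    rw [h1, PiLp.inner_apply, Fintype.sum_sum_type]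
    have hk := (kernel_identity hnn hc1 hid (norm_mul_conj_lt (hl p.1) (hl q.1))).2.2
    have hm := hv' p q
    rw [Matrix.sub_apply, Matrix.one_apply, Matrix.mul_apply] at hm
    have e1 : ∑ x, inner ℂ ((WithLp.toLp 2 (Y0 p) : EuclideanSpace ℂ (Fin m ⊕ Fin N)) (Sum.inl x))
        ((WithLp.toLp 2 (Y0 q) : EuclideanSpace ℂ (Fin m ⊕ Fin N)) (Sum.inl x)) =
        ∑ j, z p.1 p.2 j * (z q.1)ᴴ j q.2 := by
      refine Finset.sum_congr rfl fun j _ => ?_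
      simp [Y0, mul_comm]
    have e2 : ∑ x, inner ℂ ((WithLp.toLp 2 (Y0 p) : EuclideanSpace ℂ (Fin m ⊕ Fin N)) (Sum.inr x))
        ((WithLp.toLp 2 (Y0 q) : EuclideanSpace ℂ (Fin m ⊕ Fin N)) (Sum.inr x)) =
        ∑ s, v s p * (starRingEnd ℂ) (v s q) := by
      refine Finset.sum_congr rfl fun j _ => ?_
      simp [Y0, mul_comm]
    rw [e1, e2, ← hm]
    change _ * kap _ = 1 at hk
    linear_combination (-((if p.2 = q.2 then 1 else 0) - ∑ j, z p.1 p.2 j * (z q.1)ᴴ j q.2)) * hk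
  obtain ⟨w, hw, hwX⟩ := lurk X (fun p => WithLp.toLp 2 (Y0 p)) hgram
  have hwb : ∀ j s, ‖w j s‖ ≤ 1 := by
    intro j s
    have := hw (Pi.single s 1) {j}
    have e : ∑ s', ‖(Pi.single s (1 : ℂ) : Fin m ⊕ Fin N → ℂ) s'‖ ^ 2 = 1 := by
      rw [Finset.sum_eq_single s]
      · simp
      · intro b _ hb; simp [hb]
      · simp
    rw [e, Finset.sum_singleton] at this
    simp only [Pi.single_apply, mul_ite, mul_one, mul_zero, Finset.sum_ite_eq', Finset.mem_univ,
      if_true] at this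
    exact (sq_le_one_iff₀ (norm_nonneg _)).mp this
  obtain ⟨Φ, hΦ⟩ := colligation_series hc0 w
  have hcon : ∀ a : Fin m → ℕ → ℂ, (∀ j, DirSummable (a j)) →
      (∀ j, DirSummable fun p => PowerSeries.coeff p ((Φ *ᵥ fun l => PowerSeries.mk (a l)) j)) ∧
      ∑ j, dirNormSq (fun p => PowerSeries.coeff p ((Φ *ᵥ fun l => PowerSeries.mk (a l)) j)) ≤
        ∑ j, dirNormSq (a j) := by
    intro a ha
    obtain ⟨x, hx1, hx2, hx3⟩ := hΦ fun l => PowerSeries.mk (a l)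
    refine contractive_of_partial ha fun P => ?_
    have hE := energy hc0 hnn hid w hw x hx2 (t := 1) zero_le_one le_rfl P
    simp only [one_pow, mul_one, one_mul, ← hx3, hx1, PowerSeries.coeff_mk] at hE
    linarith
  have hsingle : ∀ l : Fin m, (Φ *ᵥ Pi.single l 1) = fun j => Φ j l := fun l => by
    ext1 j; simp
  have hdir : ∀ j l, DirSummable fun p => PowerSeries.coeff p (Φ j l) := by
    intro j l
    have h1 := (hcon (fun b p => PowerSeries.coeff p ((Pi.single l 1 : Fin m → PowerSeries ℂ) b))
      (fun b => by
        refine summable_of_ne_finset_zero (s := {0}) fun p hp => ?_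
        have hp : p ≠ 0 := by simpa using hp
        by_cases hb : b = l
        · subst hb; simp [dirWeight, PowerSeries.coeff_one, hp]
        · simp [dirWeight, hb])).1 j
    have e : (fun b => PowerSeries.mk fun p =>
        PowerSeries.coeff p ((Pi.single l 1 : Fin m → PowerSeries ℂ) b)) = Pi.single l 1 := by
      ext b p; simp
    rw [e, hsingle] at h1
    exact h1
  have hPhi : ∀ (u : ℂ), ‖u‖ < 1 → ∀ j l, HasSum (fun p => PowerSeries.coeff p (Φ j l) * u ^ p)
      (∑' p, PowerSeries.coeff p (Φ j l) * u ^ p) := fun u hu j l =>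
    (summable_of_dir (hdir j l) hu).hasSum
  refine ⟨fun u => Matrix.of fun j l => ∑' p, PowerSeries.coeff p (Φ j l) * u ^ p, ?_, ?_, ?_⟩
  · intro j l
    obtain ⟨C, hC⟩ := weight_bound (hdir j l)
    exact diff_of_bound hC
  · intro i
    ext a l
    change ∑' p, PowerSeries.coeff p (Φ a l) * lam i ^ p = z i a l
    obtain ⟨x, hx1, hx2, hx3⟩ := hΦ (Pi.single l 1)
    -- convergence of the state series
    have hsum : ∀ s, Summable fun p => x p (Sum.inr s) * lam i ^ p := by
      intro s
      refine summable_of_sq (hl i) ?_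
      have ht1 : 0 < 1 - ‖lam i‖ := by linarith [hl i]
      refine summable_of_sum_range_le (c := 1 / (1 - ‖lam i‖)) (fun p => by positivity) fun P => ?_
      have hE := energy hc0 hnn hid w hw x hx2 (t := ‖lam i‖) (norm_nonneg _) (hl i).le P
      have hf : ∑ p ∈ Finset.range P, ((p : ℝ) + 1) * ‖lam i‖ ^ p *
          ∑ a, ‖x p (Sum.inl a)‖ ^ 2 ≤ 1 := by
        have e : ∀ p, ∑ a, ‖x p (Sum.inl a)‖ ^ 2 = if p = 0 then 1 else 0 := by
          intro p
          rw [Finset.sum_eq_single l]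
          · rw [hx1, Pi.single_eq_same, PowerSeries.coeff_one]; split_ifs <;> simp
          · intro b _ hb; rw [hx1, Pi.single_eq_of_ne hb]; simp
          · simp
        simp only [e, mul_ite, mul_one, mul_zero, Finset.sum_ite_eq']
        split_ifs <;> simp
      have hy : 0 ≤ ∑ p ∈ Finset.range P, ((p : ℝ) + 1) * ‖lam i‖ ^ p *
        ∑ a, ‖∑ s', w (Sum.inl a) s' * x p s'‖ ^ 2 :=
        Finset.sum_nonneg fun p _ => by positivity
      have hf0 : 0 ≤ ∑ p ∈ Finset.range P, ((p : ℝ) + 1) * ‖lam i‖ ^ p *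
          ∑ a, ‖x p (Sum.inl a)‖ ^ 2 :=
        Finset.sum_nonneg fun p _ => by positivity
      have hle : ∑ p ∈ Finset.range P, ‖x p (Sum.inr s)‖ ^ 2 * ‖lam i‖ ^ p ≤
          ∑ p ∈ Finset.range P, ((p : ℝ) + 1) * ‖lam i‖ ^ p * ∑ s, ‖x p (Sum.inr s)‖ ^ 2 := by
        refine Finset.sum_le_sum fun p _ => ?_
        have h1 : ‖x p (Sum.inr s)‖ ^ 2 ≤ ∑ s, ‖x p (Sum.inr s)‖ ^ 2 :=
          Finset.single_le_sum (f := fun s => ‖x p (Sum.inr s)‖ ^ 2) (fun s _ => by positivity)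
            (Finset.mem_univ s)
        have h2 : ‖lam i‖ ^ p ≤ ((p : ℝ) + 1) * ‖lam i‖ ^ p :=
          le_mul_of_one_le_left (by positivity) (by linarith [(Nat.cast_nonneg p : (0:ℝ) ≤ p)])
        calc _ ≤ (∑ s, ‖x p (Sum.inr s)‖ ^ 2) * (((p : ℝ) + 1) * ‖lam i‖ ^ p) := by gcongr
          _ = _ := mul_comm _ _
      refine hle.trans ?_
      rw [le_div_iff₀ ht1]
      nlinarith [mul_nonneg (norm_nonneg (lam i)) hy, hl i, norm_nonneg (lam i)]
    let ξ : Fin m ⊕ Fin N → ℂ := Sum.elim (fun b => if b = l then 1 else 0)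
      (fun s => ∑' p, x p (Sum.inr s) * lam i ^ p)
    have hξ : ∀ s, HasSum (fun p => x p s * lam i ^ p) (ξ s) := by
      rintro (b | s)
      · have h1 : HasSum (fun p : ℕ => if p = 0 then ξ (Sum.inl b) else 0) (ξ (Sum.inl b)) :=
          hasSum_ite_eq 0 _
        refine h1.congr_fun ?_ |> id
        intro p
        rw [hx1]
        by_cases hb : b = l
        · subst hb
          simp only [Pi.single_eq_same, PowerSeries.coeff_one, ξ, Sum.elim_inl, if_true]
          split_ifs with hp
          · subst hp; simp
          · simp
        · simp [ξ, hb]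
      · exact (hsum s).hasSum
    have hω : ∀ s s', Summable fun k =>
        (Real.sqrt (c k) : ℂ) * w (Sum.inr (k, s)) s' * lam i ^ k := by
      intro s s'
      refine Summable.of_norm_bounded (summable_geometric_of_lt_one (norm_nonneg _) (hl i))
        fun k => ?_
      rw [norm_mul, norm_mul, norm_pow, Complex.norm_real,
        Real.norm_of_nonneg (Real.sqrt_nonneg _)]
      refine mul_le_of_le_one_left (by positivity) ?_
      exact mul_le_one₀ (Real.sqrt_le_one.mpr (hc1 k)) (norm_nonneg _) (hwb _ _)
    let ω : Fin N → Fin m ⊕ Fin N → ℂ := fun s s' =>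
      ∑' k, (Real.sqrt (c k) : ℂ) * w (Sum.inr (k, s)) s' * lam i ^ k
    have hξr : ∀ s, ξ (Sum.inr s) = ∑ s', ω s s' * ξ s' := by
      intro s
      refine (hξ (Sum.inr s)).unique ?_
      have h1 := hasSum_sum (s := Finset.univ) fun s' (_ : s' ∈ Finset.univ) =>
        eval_mul (f := PowerSeries.mk fun k => (Real.sqrt (c k) : ℂ) * w (Sum.inr (k, s)) s')
          (g := PowerSeries.mk fun p => x p s') (w := lam i)
          (by simpa using (hω s s').hasSum) (by simpa using hξ s')
      refine h1.congr_fun ?_ |> id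
      intro p
      rw [hx2, ← Finset.sum_mul]
      congr 1
      simp only [PowerSeries.coeff_mul, PowerSeries.coeff_mk, Finset.mul_sum, mul_assoc]
      exact Finset.sum_comm
    have hval : ∑' p, PowerSeries.coeff p (Φ a l) * lam i ^ p = ∑ s', w (Sum.inl a) s' * ξ s' := by
      refine (hPhi _ (hl i) a l).unique ?_
      have h1 := hasSum_sum (s := Finset.univ) fun s' (_ : s' ∈ Finset.univ) =>
        (hξ s').mul_left (w (Sum.inl a) s')
      refine h1.congr_fun ?_ |> id
      intro p
      have := hx3 p a
      rw [hsingle] at this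
      rw [this, Finset.sum_mul]
      simp only [mul_assoc]
    have hdual : ∀ s', w (Sum.inl a) s' + ∑ s, ω s s' * v s (i, a) =
        (starRingEnd ℂ) (Y0 (i, a) s') := by
      intro s'
      have h1 := hwX (i, a) s'
      have h2 := hasSum_J (f := fun j => (starRingEnd ℂ) (w j s') * X0 (i, a) j)
        (a := fun s => (starRingEnd ℂ) (ω s s') * (starRingEnd ℂ) (v s (i, a))) (fun s => by
          have h3 := (Complex.hasSum_conj'.mpr (hω s s').hasSum).mul_right
            ((starRingEnd ℂ) (v s (i, a)))
          refine h3.congr_fun ?_ |> id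
          intro k
          simp only [X0, Sum.elim_inr, map_mul, map_pow, Complex.conj_ofReal]
          ring)
      have h3 := h1.unique h2
      have h4 := congrArg (starRingEnd ℂ) h3
      rw [h4]
      simp [X0]
    rw [hval]
    have h5 : ∑ s', (w (Sum.inl a) s' + ∑ s, ω s s' * v s (i, a)) * ξ s' =
        ∑ s', (starRingEnd ℂ) (Y0 (i, a) s') * ξ s' :=
      Finset.sum_congr rfl fun s' _ => by rw [hdual]
    have h6 : ∑ s', (∑ s, ω s s' * v s (i, a)) * ξ s' = ∑ s, v s (i, a) * ξ (Sum.inr s) := by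
      simp only [hξr, Finset.sum_mul, Finset.mul_sum]
      rw [Finset.sum_comm]
      refine Finset.sum_congr rfl fun s _ => Finset.sum_congr rfl fun s' _ => ?_
      ring
    have h7 : ∑ s', (starRingEnd ℂ) (Y0 (i, a) s') * ξ s' =
        z i a l + ∑ s, v s (i, a) * ξ (Sum.inr s) := by
      rw [Fintype.sum_sum_type]
      simp [Y0, ξ]
    simp only [add_mul, Finset.sum_add_distrib] at h5
    rw [h6, h7] at h5
    exact add_right_cancel h5
  · intro f a hf ha
    obtain ⟨h1, h2⟩ := hcon a ha
    refine ⟨_, fun j u hu => ?_, h1, h2⟩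
    have hu' : ‖u‖ < 1 := by simpa using hu
    have h3 := hasSum_sum (s := Finset.univ) fun l (_ : l ∈ Finset.univ) =>
      eval_mul (g := PowerSeries.mk (a l)) (hPhi u hu' j l) (by simpa using hf l u hu)
    refine h3.congr_fun ?_ |> id
    intro p
    simp only [mulVec, dotProduct, map_sum, Finset.sum_mul]

/-- **The Dirichlet space is a complete interpolation space.** -/
theorem stmt2 (m n : ℕ) (hm : 0 < m) (hn : 0 < n)
    (lam : Fin n → ℂ) (hmem : ∀ i, lam i ∈ ball (0 : ℂ) 1)
    (hinj : Function.Injective lam) (z : Fin n → Matrix (Fin m) (Fin m) ℂ) :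
    (∃ Φ : ℂ → Matrix (Fin m) (Fin m) ℂ,
      (∀ k l, DifferentiableOn ℂ (fun w => Φ w k l) (ball (0 : ℂ) 1)) ∧
      (∀ i, Φ (lam i) = z i) ∧ IsContractiveDirMultiplier m Φ) ↔
    (Matrix.of fun p q : Fin n × Fin m =>
      ((1 : Matrix (Fin m) (Fin m) ℂ) - z p.1 * (z q.1)ᴴ) p.2 q.2 *
        ∑' r : ℕ, (lam p.1 * (starRingEnd ℂ) (lam q.1)) ^ r / ((r : ℂ) + 1)).PosSemidef := by
  have hl : ∀ i, ‖lam i‖ < 1 := fun i => by simpa using hmem i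
  constructor
  · rintro ⟨Φ, -, hz, hΦ⟩
    exact necessity m n lam hl z Φ hz hΦ
  · intro h
    exact sufficiency m n lam hl z h
end
end

section
/- The Drury–Arveson space on the unit ball of ℂ^d is a complete interpolation space. That is: for all positive integers d, m, n, all distinct points λ₁, …, λₙ in the open unit ball B of ℂ^d, and all z₁, …, zₙ ∈ M_m(ℂ), there exists a holomorphic map Φ : B → M_m(ℂ) with Φ(λᵢ) = zᵢ for each i which is a multiplier of ℂ^m ⊗ H²_d of multiplier norm at most 1, if and only if the mn×mn block matrix whose (i,j) block is (I_m − zᵢ·zⱼ*)·(1 − ⟨λᵢ, λⱼ⟩)^{-1} is positive semidefinite. -/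
open Complex Metric Matrix
open scoped ComplexOrder

noncomputable section

/-- The Drury–Arveson weight `α!/|α|!` of a multi-index `α`. -/
def daWeight (d : ℕ) (α : Fin d → ℕ) : ℝ :=
  ((∏ i, Nat.factorial (α i) : ℕ) : ℝ) / ((Nat.factorial (∑ i, α i) : ℕ) : ℝ)

/-- `a` is the family of Taylor coefficients of `f` on the unit ball of `ℂ^d`. -/
def IsCoeffDA (d : ℕ) (f : EuclideanSpace ℂ (Fin d) → ℂ) (a : (Fin d → ℕ) → ℂ) : Prop :=
  ∀ w ∈ ball (0 : EuclideanSpace ℂ (Fin d)) 1,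
    HasSum (fun α : Fin d → ℕ => a α * ∏ i, w i ^ α i) (f w)

/-- Membership in the Drury–Arveson space `H²_d`, in terms of the coefficients. -/
def DASummable (d : ℕ) (a : (Fin d → ℕ) → ℂ) : Prop :=
  Summable fun α : Fin d → ℕ => ‖a α‖ ^ 2 * daWeight d α

/-- The squared Drury–Arveson norm, in terms of the coefficients. -/
def daNormSq (d : ℕ) (a : (Fin d → ℕ) → ℂ) : ℝ :=
  ∑' α : Fin d → ℕ, ‖a α‖ ^ 2 * daWeight d α

/-- `Φ : B → M_m(ℂ)` is a multiplier of `ℂ^m ⊗ H²_d` of multiplier norm at most `1`. -/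
def IsContractiveDAMultiplier (d m : ℕ)
    (Φ : EuclideanSpace ℂ (Fin d) → Matrix (Fin m) (Fin m) ℂ) : Prop :=
  ∀ (f : Fin m → EuclideanSpace ℂ (Fin d) → ℂ) (a : Fin m → (Fin d → ℕ) → ℂ),
    (∀ j, IsCoeffDA d (f j) (a j)) → (∀ j, DASummable d (a j)) →
    ∃ b : Fin m → (Fin d → ℕ) → ℂ,
      (∀ j, IsCoeffDA d (fun w => ∑ l, Φ w j l * f l w) (b j)) ∧
      (∀ j, DASummable d (b j)) ∧
      ∑ j, daNormSq d (b j) ≤ ∑ j, daNormSq d (a j)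

theorem daWeight_pos (d : ℕ) (α : Fin d → ℕ) : 0 < daWeight d α := by
  unfold daWeight
  have : 0 < ∏ i, Nat.factorial (α i) := Finset.prod_pos fun i _ => Nat.factorial_pos _
  positivity

theorem daWeight_inv (d : ℕ) (α : Fin d → ℕ) :
    (daWeight d α)⁻¹ = (Nat.multinomial Finset.univ α : ℝ) := by
  unfold daWeight
  have h := Nat.multinomial_spec Finset.univ α
  have hp : 0 < ∏ i, Nat.factorial (α i) := Finset.prod_pos fun i _ => Nat.factorial_pos _
  rw [inv_div, div_eq_iff (by positivity), ← h]
  push_cast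
  ring

/-- multi-indices of degree `k`. -/
def lev (d k : ℕ) : Finset (Fin d → ℕ) := Finset.piAntidiag Finset.univ k

theorem mem_lev {d k : ℕ} {α : Fin d → ℕ} : α ∈ lev d k ↔ ∑ i, α i = k := by
  simp [lev]

/-- multi-indices of degree `< k`. -/
def levs (d K : ℕ) : Finset (Fin d → ℕ) := (Finset.range K).biUnion (lev d)

theorem mem_levs {d K : ℕ} {α : Fin d → ℕ} : α ∈ levs d K ↔ ∑ i, α i < K := by
  simp [levs, mem_lev]

theorem sum_levs {d K : ℕ} {M : Type*} [AddCommMonoid M] (f : (Fin d → ℕ) → M) :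
    ∑ α ∈ levs d K, f α = ∑ k ∈ Finset.range K, ∑ α ∈ lev d k, f α := by
  unfold levs
  rw [Finset.sum_biUnion]
  intro i _ j _ hij
  rw [Function.onFun, Finset.disjoint_left]
  intro α h1 h2
  rw [mem_lev] at h1 h2
  exact hij (h1.symm.trans h2)

theorem levs_tendsto (d : ℕ) : Filter.Tendsto (levs d) Filter.atTop Filter.atTop := by
  apply Filter.tendsto_atTop_finset_of_monotone
  · intro a b hab α h
    rw [mem_levs] at *
    omega
  · intro α
    exact ⟨∑ i, α i + 1, by rw [mem_levs]; omega⟩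

theorem sum_le_levs {d : ℕ} (f : (Fin d → ℕ) → ℝ) (hf : ∀ α, 0 ≤ f α) (c : ℝ)
    (h : ∀ K, ∑ k ∈ Finset.range K, ∑ α ∈ lev d k, f α ≤ c) (s : Finset (Fin d → ℕ)) :
    ∑ α ∈ s, f α ≤ c := by
  obtain ⟨K, hK⟩ := ((levs_tendsto d).eventually (Filter.eventually_ge_atTop s)).exists
  calc _ ≤ ∑ α ∈ levs d K, f α :=
        Finset.sum_le_sum_of_subset_of_nonneg hK fun α _ _ => hf α
    _ ≤ c := by rw [sum_levs]; exact h K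

theorem kernel_lev (d k : ℕ) {R : Type*} [RCLike R] (u : Fin d → R) :
    ∑ α ∈ lev d k, (((daWeight d α)⁻¹ : ℝ) : R) * ∏ i, u i ^ α i = (∑ i, u i) ^ k := by
  rw [Finset.sum_pow_eq_sum_piAntidiag]
  simp only [daWeight_inv, lev]
  push_cast
  rfl

theorem kernel_summable (d : ℕ) (u : Fin d → ℝ) (h0 : ∀ i, 0 ≤ u i) (h1 : ∑ i, u i < 1) :
    Summable fun α : Fin d → ℕ => (daWeight d α)⁻¹ * ∏ i, u i ^ α i := by
  have hn : ∀ α : Fin d → ℕ, 0 ≤ (daWeight d α)⁻¹ * ∏ i, u i ^ α i := fun α =>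
    mul_nonneg (inv_nonneg.2 (daWeight_pos d α).le)
      (Finset.prod_nonneg fun i _ => pow_nonneg (h0 i) _)
  have hs0 : 0 ≤ ∑ i, u i := Finset.sum_nonneg fun i _ => h0 i
  refine summable_of_sum_le (c := (1 - ∑ i, u i)⁻¹) hn (sum_le_levs _ hn _ fun K => ?_)
  have : ∀ k, ∑ α ∈ lev d k, (daWeight d α)⁻¹ * ∏ i, u i ^ α i = (∑ i, u i) ^ k := fun k => by
    simpa using kernel_lev d k (R := ℝ) u
  simp only [this]
  rw [← tsum_geometric_of_lt_one hs0 h1]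
  exact (summable_geometric_of_lt_one hs0 h1).sum_le_tsum _ fun i _ => pow_nonneg hs0 _

theorem kernel_hasSum (d : ℕ) (u : Fin d → ℂ) (h1 : ∑ i, ‖u i‖ < 1) :
    HasSum (fun α : Fin d → ℕ => (((daWeight d α)⁻¹ : ℝ) : ℂ) * ∏ i, u i ^ α i)
      (1 - ∑ i, u i)⁻¹ := by
  have hs : Summable (fun α : Fin d → ℕ => (((daWeight d α)⁻¹ : ℝ) : ℂ) * ∏ i, u i ^ α i) := by
    apply Summable.of_norm
    have := kernel_summable d (fun i => ‖u i‖) (fun i => norm_nonneg _) h1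
    refine this.congr fun α => ?_
    rw [norm_mul, norm_prod, Complex.norm_real, Real.norm_of_nonneg
      (inv_nonneg.2 (daWeight_pos d α).le)]
    simp
  have h2 : Filter.Tendsto (fun K => ∑ k ∈ Finset.range K, (∑ i, u i) ^ k) Filter.atTop
      (nhds (∑' α : Fin d → ℕ, (((daWeight d α)⁻¹ : ℝ) : ℂ) * ∏ i, u i ^ α i)) := by
    refine ((show Filter.Tendsto _ _ _ from hs.hasSum).comp (levs_tendsto d)).congr fun K => ?_
    simp only [Function.comp]
    rw [sum_levs]
    exact Finset.sum_congr rfl fun k _ => kernel_lev d k u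
  have h3 := (hasSum_geometric_of_norm_lt_one
    (lt_of_le_of_lt (norm_sum_le _ _) h1 : ‖∑ i, u i‖ < 1)).tendsto_sum_nat
  rw [← tendsto_nhds_unique h2 h3]
  exact hs.hasSum

theorem ball_cs {d : ℕ} {w v : EuclideanSpace ℂ (Fin d)}
    (hw : w ∈ ball (0 : EuclideanSpace ℂ (Fin d)) 1)
    (hv : v ∈ ball (0 : EuclideanSpace ℂ (Fin d)) 1) :
    ∑ i, ‖w i * (starRingEnd ℂ) (v i)‖ < 1 := by
  rw [mem_ball_zero_iff] at hw hv
  have h1 : ∑ i, ‖w i‖ ^ 2 < 1 := by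
    rw [← EuclideanSpace.norm_sq_eq]; nlinarith [norm_nonneg w]
  have h2 : ∑ i, ‖v i‖ ^ 2 < 1 := by
    rw [← EuclideanSpace.norm_sq_eq]; nlinarith [norm_nonneg v]
  calc ∑ i, ‖w i * (starRingEnd ℂ) (v i)‖ ≤ ∑ i, (‖w i‖ ^ 2 + ‖v i‖ ^ 2) / 2 := by
        refine Finset.sum_le_sum fun i _ => ?_
        rw [norm_mul, RCLike.norm_conj]
        nlinarith [sq_nonneg (‖w i‖ - ‖v i‖)]
    _ = (∑ i, ‖w i‖ ^ 2 + ∑ i, ‖v i‖ ^ 2) / 2 := by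
        rw [← Finset.sum_div, Finset.sum_add_distrib]
    _ < 1 := by linarith

/-- Taylor coefficients of `∑ j, x j • k_{lam j}`. -/
def kc {d n : ℕ} (lam : Fin n → EuclideanSpace ℂ (Fin d)) (x : Fin n → ℂ)
    (α : Fin d → ℕ) : ℂ :=
  ∑ j, x j * ((((daWeight d α)⁻¹ : ℝ) : ℂ) * ∏ i, (starRingEnd ℂ) (lam j i) ^ α i)

theorem kc_isCoeff {d n : ℕ} (lam : Fin n → EuclideanSpace ℂ (Fin d))
    (hmem : ∀ i, lam i ∈ ball (0 : EuclideanSpace ℂ (Fin d)) 1) (x : Fin n → ℂ) :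
    IsCoeffDA d (fun w => ∑ j, x j * (1 - ∑ t, w t * (starRingEnd ℂ) (lam j t))⁻¹)
      (kc lam x) := by
  intro w hw
  have h := hasSum_sum (s := Finset.univ) fun j (_ : j ∈ Finset.univ) =>
    (kernel_hasSum d (fun t => w t * (starRingEnd ℂ) (lam j t))
      (ball_cs hw (hmem j))).mul_left (x j)
  refine h.congr_fun fun α => ?_
  simp only [kc, Finset.sum_mul, mul_pow, Finset.prod_mul_distrib]
  exact Finset.sum_congr rfl fun j _ => by ring

theorem kc_inner {d n : ℕ} (lam : Fin n → EuclideanSpace ℂ (Fin d))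
    (hmem : ∀ i, lam i ∈ ball (0 : EuclideanSpace ℂ (Fin d)) 1) (x : Fin n → ℂ)
    (f : EuclideanSpace ℂ (Fin d) → ℂ) (b : (Fin d → ℕ) → ℂ) (hb : IsCoeffDA d f b) :
    HasSum (fun α => b α * (starRingEnd ℂ) (kc lam x α) * (daWeight d α : ℂ))
      (∑ j, (starRingEnd ℂ) (x j) * f (lam j)) := by
  have h := hasSum_sum (s := Finset.univ) fun j (_ : j ∈ Finset.univ) =>
    (hb (lam j) (hmem j)).mul_left ((starRingEnd ℂ) (x j))
  refine h.congr_fun fun α => ?_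
  have hw : (daWeight d α : ℂ) ≠ 0 := by exact_mod_cast (daWeight_pos d α).ne'
  simp only [kc, map_sum, map_mul, map_prod, map_pow, Complex.conj_conj, Complex.conj_ofReal,
    Finset.mul_sum, Finset.sum_mul]
  refine Finset.sum_congr rfl fun j _ => ?_
  push_cast
  field_simp

theorem kc_norm {d n : ℕ} (lam : Fin n → EuclideanSpace ℂ (Fin d))
    (hmem : ∀ i, lam i ∈ ball (0 : EuclideanSpace ℂ (Fin d)) 1) (x : Fin n → ℂ) :
    HasSum (fun α => ((‖kc lam x α‖ ^ 2 * daWeight d α : ℝ) : ℂ))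
      (∑ i, (starRingEnd ℂ) (x i) *
        ∑ j, x j * (1 - ∑ t, lam i t * (starRingEnd ℂ) (lam j t))⁻¹) := by
  refine (kc_inner lam hmem x _ _ (kc_isCoeff lam hmem x)).congr_fun fun α => ?_
  push_cast
  rw [Complex.mul_conj, Complex.normSq_eq_norm_sq]
  push_cast
  ring

theorem forward (d m n : ℕ)
    (lam : Fin n → EuclideanSpace ℂ (Fin d))
    (hmem : ∀ i, lam i ∈ ball (0 : EuclideanSpace ℂ (Fin d)) 1)
    (z : Fin n → Matrix (Fin m) (Fin m) ℂ)
    (Φ : EuclideanSpace ℂ (Fin d) → Matrix (Fin m) (Fin m) ℂ)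
    (hz : ∀ i, Φ (lam i) = z i) (hΦ : IsContractiveDAMultiplier d m Φ) :
    (Matrix.of fun p q : Fin n × Fin m =>
      ((1 : Matrix (Fin m) (Fin m) ℂ) - z p.1 * (z q.1)ᴴ) p.2 q.2 *
        (1 - ∑ t, lam p.1 t * (starRingEnd ℂ) (lam q.1 t))⁻¹).PosSemidef := by
  rw [Matrix.posSemidef_iff_dotProduct_mulVec]
  constructor
  · ext p q
    simp only [conjTranspose_apply, of_apply, Matrix.sub_apply, Matrix.mul_apply, star_mul',
      star_sub, star_sum, star_inv₀, star_one, star_star, Matrix.one_apply, RCLike.star_def,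
      Complex.conj_conj, apply_ite (starRingEnd ℂ), map_one, map_zero, eq_comm (a := q.2), map_sum,
      map_inv₀, map_sub, map_mul, mul_comm]
  intro x
  set c : Fin m → Fin n → ℂ := fun l j => ∑ k, (starRingEnd ℂ) (z j k l) * x (j, k) with hc
  set y : Fin m → Fin n → ℂ := fun l j => x (j, l) with hy
  set Q : (Fin n → ℂ) → ℂ := fun x => ∑ i, (starRingEnd ℂ) (x i) *
        ∑ j, x j * (1 - ∑ t, lam i t * (starRingEnd ℂ) (lam j t))⁻¹ with hQ
  have hQn : ∀ x, HasSum (fun α => ‖kc lam x α‖ ^ 2 * daWeight d α) (Q x).re ∧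
      ((Q x).re : ℂ) = Q x := by
    intro x
    have h := kc_norm lam hmem x
    have h2 : HasSum (fun α => ‖kc lam x α‖ ^ 2 * daWeight d α) (Q x).re := by
      simpa only [Complex.ofReal_re] using Complex.hasSum_re h
    refine ⟨h2, (Complex.hasSum_ofReal.2 h2).unique h⟩
  obtain ⟨b, hb1, hb2, hb3⟩ := hΦ _ (fun l => kc lam (c l))
    (fun l => kc_isCoeff lam hmem (c l)) (fun l => (hQn (c l)).1.summable)
  have hcross : ∀ l, HasSum (fun α => (b l α * (starRingEnd ℂ) (kc lam (y l) α)
      * (daWeight d α : ℂ)).re) _ := fun l =>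
    Complex.hasSum_re (kc_inner lam hmem (y l) _ (b l) (hb1 l))
  have hG : ∑ l, ∑ j, (starRingEnd ℂ) (y l j) * ∑ l', Φ (lam j) l l' *
      ∑ i, c l' i * (1 - ∑ t, lam j t * (starRingEnd ℂ) (lam i t))⁻¹ = ∑ l, Q (c l) := by
    simp only [hz, hQ, hc, hy, map_sum, map_mul, Complex.conj_conj]
    rw [Finset.sum_comm]
    conv_rhs => rw [Finset.sum_comm]
    refine Finset.sum_congr rfl fun j _ => ?_
    simp only [Finset.mul_sum (s := (Finset.univ : Finset (Fin m))),
      Finset.sum_mul (s := (Finset.univ : Finset (Fin m)))]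
    rw [Finset.sum_comm]
    simp only [Finset.mul_sum, mul_assoc, mul_left_comm]
  have hpos : ∀ l, 0 ≤ daNormSq d (b l) - 2 * (∑ j, (starRingEnd ℂ) (y l j) * ∑ l', Φ (lam j) l l' *
      ∑ i, c l' i * (1 - ∑ t, lam j t * (starRingEnd ℂ) (lam i t))⁻¹).re + (Q (y l)).re := by
    intro l
    refine (((hb2 l).hasSum.sub ((hcross l).mul_left 2)).add (hQn (y l)).1).nonneg fun α => ?_
    have h1 : ‖b l α - kc lam (y l) α‖ ^ 2 = ‖b l α‖ ^ 2
      - 2 * (b l α * (starRingEnd ℂ) (kc lam (y l) α)).re + ‖kc lam (y l) α‖ ^ 2 := by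
      simp only [← Complex.normSq_eq_norm_sq, Complex.normSq_sub]
      ring
    have h2 : 0 ≤ ‖b l α - kc lam (y l) α‖ ^ 2 * daWeight d α :=
      mul_nonneg (sq_nonneg _) (daWeight_pos d α).le
    rw [h1] at h2
    rw [Complex.re_mul_ofReal]
    linarith
  have hsum := Finset.sum_nonneg fun l (_ : l ∈ Finset.univ) => hpos l
  rw [Finset.sum_add_distrib, Finset.sum_sub_distrib, ← Finset.mul_sum, ← Complex.re_sum, hG,
    Complex.re_sum] at hsum
  have hb4 : ∑ j, daNormSq d (b j) ≤ ∑ l, (Q (c l)).re := by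
    refine hb3.trans_eq (Finset.sum_congr rfl fun l _ => (hQn (c l)).1.tsum_eq)
  have hfin : star x ⬝ᵥ ((Matrix.of fun p q : Fin n × Fin m =>
      ((1 : Matrix (Fin m) (Fin m) ℂ) - z p.1 * (z q.1)ᴴ) p.2 q.2 *
        (1 - ∑ t, lam p.1 t * (starRingEnd ℂ) (lam q.1 t))⁻¹) *ᵥ x)
      = ∑ l, Q (y l) - ∑ l, Q (c l) := by
    have e1 : ∑ l, Q (y l) = ∑ i, ∑ l, ∑ j, ∑ k, (starRingEnd ℂ) (x (i, l)) *
        ((1 : Matrix (Fin m) (Fin m) ℂ) l k * (1 - ∑ t, lam i t * (starRingEnd ℂ) (lam j t))⁻¹ *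
          x (j, k)) := by
      rw [Finset.sum_comm]
      refine Finset.sum_congr rfl fun i _ => ?_
      refine Finset.sum_congr rfl fun l _ => ?_
      rw [Finset.mul_sum]
      refine Finset.sum_congr rfl fun j _ => ?_
      simp only [hy, Matrix.one_apply, ite_mul, mul_ite, zero_mul, mul_zero, one_mul,
        Finset.sum_ite_eq, Finset.mem_univ, if_true]
      ring
    have e2 : ∑ l, Q (c l) = ∑ i, ∑ l, ∑ j, ∑ k, (starRingEnd ℂ) (x (i, l)) *
        ((z i * (z j)ᴴ) l k * (1 - ∑ t, lam i t * (starRingEnd ℂ) (lam j t))⁻¹ *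
          x (j, k)) := by
      rw [Finset.sum_comm]
      refine Finset.sum_congr rfl fun i _ => ?_
      have e3 : ∀ l j k, (starRingEnd ℂ) (x (i, l)) *
        ((z i * (z j)ᴴ) l k * (1 - ∑ t, lam i t * (starRingEnd ℂ) (lam j t))⁻¹ *
          x (j, k)) = ∑ s, (z i l s * (starRingEnd ℂ) (x (i, l))) *
          ((starRingEnd ℂ) (z j k s) * x (j, k) *
            (1 - ∑ t, lam i t * (starRingEnd ℂ) (lam j t))⁻¹) := by
        intro l j k
        rw [Matrix.mul_apply, Finset.sum_mul, Finset.sum_mul, Finset.mul_sum]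
        refine Finset.sum_congr rfl fun s _ => ?_
        rw [conjTranspose_apply, RCLike.star_def]
        ring
      simp only [e3, hc, map_sum, map_mul, Complex.conj_conj]
      conv_rhs =>
        enter [2, l]
        enter [2, j]
        rw [Finset.sum_comm]
      conv_rhs =>
        enter [2, l]
        rw [Finset.sum_comm]
      rw [Finset.sum_comm]
      refine Finset.sum_congr rfl fun s _ => ?_
      rw [Finset.sum_mul]
      refine Finset.sum_congr rfl fun l _ => ?_
      rw [Finset.mul_sum]
      refine Finset.sum_congr rfl fun j _ => ?_
      rw [Finset.sum_mul, Finset.mul_sum]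
    rw [e1, e2]
    simp only [dotProduct, mulVec, Fintype.sum_prod_type, of_apply, ← Finset.sum_sub_distrib,
      Finset.mul_sum, Matrix.sub_apply, Pi.star_apply, RCLike.star_def]
    refine Finset.sum_congr rfl fun i _ => Finset.sum_congr rfl fun l _ =>
      Finset.sum_congr rfl fun j _ => Finset.sum_congr rfl fun k _ => ?_
    ring
  rw [hfin, ← Finset.sum_congr rfl fun l _ => (hQn (y l)).2,
    ← Finset.sum_congr rfl fun l _ => (hQn (c l)).2, ← Complex.ofReal_sum, ← Complex.ofReal_sum,
    ← Complex.ofReal_sub]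
  rw [Complex.zero_le_real]
  linarith

theorem lurking {ι E F : Type*} [Fintype ι] [NormedAddCommGroup E] [InnerProductSpace ℂ E]
    [FiniteDimensional ℂ E] [NormedAddCommGroup F] [InnerProductSpace ℂ F]
    [FiniteDimensional ℂ F]
    (u : ι → E) (v : ι → F) (h : ∀ p q, inner ℂ (u p) (u q) = inner ℂ (v p) (v q)) :
    ∃ V : E →L[ℂ] F, (∀ p, V (u p) = v p) ∧ ‖V‖ ≤ 1 := by
  classical
  let T : (ι → ℂ) →ₗ[ℂ] E := Fintype.linearCombination ℂ u
  let S : (ι → ℂ) →ₗ[ℂ] F := Fintype.linearCombination ℂ v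
  have hn : ∀ c, ‖T c‖ = ‖S c‖ := by
    intro c
    have : inner ℂ (T c) (T c) = inner ℂ (S c) (S c) := by
      simp only [T, S, Fintype.linearCombination_apply, sum_inner, inner_sum, inner_smul_left,
        inner_smul_right, h]
    rw [inner_self_eq_norm_sq_to_K, inner_self_eq_norm_sq_to_K] at this
    have h2 : ‖T c‖ ^ 2 = ‖S c‖ ^ 2 := by exact_mod_cast this
    exact (sq_eq_sq₀ (norm_nonneg _) (norm_nonneg _)).1 h2
  have hker : LinearMap.ker T ≤ LinearMap.ker S := by
    intro c hc
    rw [LinearMap.mem_ker] at *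
    rw [← norm_eq_zero, ← hn, hc, norm_zero]
  obtain ⟨R, hR⟩ := LinearMap.exists_rightInverse_of_surjective T.rangeRestrict
    (LinearMap.range_rangeRestrict T)
  have hRT : ∀ y : LinearMap.range T, T (R y) = y := by
    intro y
    have := congrArg (fun f => ((f y : LinearMap.range T) : E)) hR
    simpa using this
  let V : E →ₗ[ℂ] F := S ∘ₗ R ∘ₗ ((LinearMap.range T).orthogonalProjectionOnto : E →L[ℂ] _)
  have hVn : ∀ x, ‖V x‖ ≤ 1 * ‖x‖ := by
    intro x
    simp only [V, LinearMap.comp_apply]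
    rw [← hn, hRT, one_mul]
    exact Submodule.norm_orthogonalProjectionOnto_apply_le _ _
  refine ⟨V.mkContinuous 1 hVn, fun p => ?_, LinearMap.mkContinuous_norm_le _ zero_le_one _⟩
  have hTp : T (Pi.single p 1) = u p := by simp [T]
  have hSp : S (Pi.single p 1) = v p := by simp [S]
  have hmem : u p ∈ LinearMap.range T := ⟨_, hTp⟩
  have hproj : ((LinearMap.range T).orthogonalProjectionOnto (u p)) = ⟨u p, hmem⟩ := by
    exact Submodule.orthogonalProjectionOnto_mem_subspace_eq_self (⟨u p, hmem⟩ : LinearMap.range T)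
  show S (R ((LinearMap.range T).orthogonalProjectionOnto (u p))) = v p
  rw [hproj, ← hSp, ← sub_eq_zero, ← map_sub]
  apply hker
  rw [LinearMap.mem_ker, map_sub, hRT, hTp, sub_self]

theorem realization (d m n : ℕ)
    (lam : Fin n → EuclideanSpace ℂ (Fin d))
    (hmem : ∀ i, lam i ∈ ball (0 : EuclideanSpace ℂ (Fin d)) 1)
    (z : Fin n → Matrix (Fin m) (Fin m) ℂ)
    (hA : (Matrix.of fun p q : Fin n × Fin m =>
      ((1 : Matrix (Fin m) (Fin m) ℂ) - z p.1 * (z q.1)ᴴ) p.2 q.2 *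
        (1 - ∑ t, lam p.1 t * (starRingEnd ℂ) (lam q.1 t))⁻¹).PosSemidef) :
    ∃ (D : Matrix (Fin m) (Fin m) ℂ) (C : Matrix (Fin m) (Fin n × Fin m) ℂ)
      (B : Fin d → Matrix (Fin n × Fin m) (Fin m) ℂ)
      (A : Fin d → Matrix (Fin n × Fin m) (Fin n × Fin m) ℂ)
      (Γ : Fin n → Matrix (Fin m) (Fin n × Fin m) ℂ),
      (∀ (u : Fin m → ℂ) (y : Fin n × Fin m → ℂ),
        ∑ j, ‖(D *ᵥ u + C *ᵥ y) j‖ ^ 2 + ∑ t, ∑ s, ‖(B t *ᵥ u + A t *ᵥ y) s‖ ^ 2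
          ≤ ∑ j, ‖u j‖ ^ 2 + ∑ s, ‖y s‖ ^ 2) ∧
      (∀ j, z j = D + Γ j * ∑ t, lam j t • B t) ∧
      (∀ j, Γ j = C + Γ j * ∑ t, lam j t • A t) := by
  classical
  obtain ⟨G, hG⟩ : ∃ G : Matrix (Fin n × Fin m) (Fin n × Fin m) ℂ, _ = Gᴴ * G := by
    open scoped MatrixOrder in
    obtain ⟨X, hX⟩ := CStarAlgebra.nonneg_iff_eq_star_mul_self.1 hA.nonneg
    exact ⟨X, hX⟩
  have hG' : ∀ i k j l, (1 : Matrix (Fin m) (Fin m) ℂ) k l +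
      (∑ t, lam i t * (starRingEnd ℂ) (lam j t)) *
        (∑ s, (starRingEnd ℂ) (G s (i, k)) * G s (j, l)) =
      ∑ r, z i k r * (starRingEnd ℂ) (z j l r) +
        ∑ s, (starRingEnd ℂ) (G s (i, k)) * G s (j, l) := by
    intro i k j l
    have h := congrFun (congrFun hG (i, k)) (j, l)
    have hne : (1 - ∑ t, lam i t * (starRingEnd ℂ) (lam j t)) ≠ 0 := by
      intro h0
      have h1 := (norm_sum_le Finset.univ fun t => lam i t * (starRingEnd ℂ) (lam j t)).trans_lt
        (ball_cs (hmem i) (hmem j))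
      rw [← sub_eq_zero.1 h0, norm_one] at h1
      exact lt_irrefl _ h1
    simp only [of_apply, Matrix.mul_apply, Matrix.sub_apply, conjTranspose_apply,
      RCLike.star_def] at h
    rw [← div_eq_mul_inv, div_eq_iff hne] at h
    linear_combination h
  let u : Fin n × Fin m → EuclideanSpace ℂ (Fin m ⊕ (Fin d × (Fin n × Fin m))) := fun q =>
    WithLp.toLp 2 (Sum.elim (fun k => (1 : Matrix (Fin m) (Fin m) ℂ) k q.2)
      fun ts => (starRingEnd ℂ) (lam q.1 ts.1) * G ts.2 q)
  let v : Fin n × Fin m → EuclideanSpace ℂ (Fin m ⊕ (Fin n × Fin m)) := fun q =>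
    WithLp.toLp 2 (Sum.elim (fun k => (starRingEnd ℂ) (z q.1 q.2 k)) fun s => G s q)
  obtain ⟨V, hV, hVn⟩ := lurking u v (by
    rintro ⟨i, k⟩ ⟨j, l⟩
    have h := hG' i k j l
    simp only [PiLp.inner_apply, u, v, Fintype.sum_sum_type, Sum.elim_inl, Sum.elim_inr,
      RCLike.inner_apply, map_mul, Complex.conj_conj]
    have e1 : ∑ x, (1 : Matrix (Fin m) (Fin m) ℂ) x l *
        (starRingEnd ℂ) ((1 : Matrix (Fin m) (Fin m) ℂ) x k) =
        (1 : Matrix (Fin m) (Fin m) ℂ) k l := by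
      simp [Matrix.one_apply]
    rw [e1, Fintype.sum_prod_type]
    rw [Finset.sum_mul_sum] at h
    convert h using 2
    · exact Finset.sum_congr rfl fun t _ => Finset.sum_congr rfl fun s _ => by ring
    · exact Finset.sum_congr rfl fun t _ => by ring
    · exact Finset.sum_congr rfl fun t _ => by ring)
  let W := ContinuousLinearMap.adjoint V
  have hW : ∀ x, ‖W x‖ ≤ ‖x‖ := fun x => by
    have := W.le_opNorm x
    have h2 : ‖W‖ ≤ 1 := by simpa [W] using hVn
    nlinarith [norm_nonneg x]
  let M : Matrix (Fin m ⊕ (Fin d × (Fin n × Fin m))) (Fin m ⊕ (Fin n × Fin m)) ℂ :=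
    Matrix.toEuclideanLin.symm (W : _ →ₗ[ℂ] _)
  have hM : ∀ x i, W x i = ∑ k, M i k * x k := by
    intro x i
    have : (W : _ →ₗ[ℂ] _) = Matrix.toEuclideanLin M := by simp [M]
    have h2 : W x = Matrix.toEuclideanLin M x := by rw [← this]; rfl
    rw [h2]
    rfl
  have hMV : ∀ x k, V x k = ∑ i, (starRingEnd ℂ) (M i k) * x i := by
    intro x k
    have h1 : V x k = inner ℂ (EuclideanSpace.single k (1 : ℂ)) (V x) := by
      rw [EuclideanSpace.inner_single_left]; simp
    rw [h1, ← ContinuousLinearMap.adjoint_inner_left, PiLp.inner_apply]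
    refine Finset.sum_congr rfl fun i _ => ?_
    rw [RCLike.inner_apply, mul_comm]
    congr 2
  refine ⟨Matrix.of fun a b => M (.inl a) (.inl b), Matrix.of fun a b => M (.inl a) (.inr b),
    fun t => Matrix.of fun a b => M (.inr (t, a)) (.inl b),
    fun t => Matrix.of fun a b => M (.inr (t, a)) (.inr b),
    fun j => Matrix.of fun k s => (starRingEnd ℂ) (G s (j, k)), ?_, ?_, ?_⟩
  · intro u y
    have h := hW (WithLp.toLp 2 (Sum.elim u y))
    have h2 := pow_le_pow_left₀ (norm_nonneg _) h 2
    rw [EuclideanSpace.norm_sq_eq, EuclideanSpace.norm_sq_eq] at h2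
    simp only [hM, Fintype.sum_sum_type, Sum.elim_inl, Sum.elim_inr] at h2
    rw [Fintype.sum_prod_type] at h2
    exact h2
  · intro j
    ext k r
    have h := congrArg (fun x => (starRingEnd ℂ) (x (.inl r))) (hV (j, k))
    simp only [hMV, u, v, Fintype.sum_sum_type, Sum.elim_inl, Sum.elim_inr, map_add, map_sum,
      map_mul, Complex.conj_conj] at h
    refine Eq.trans h.symm ?_
    rw [Fintype.sum_prod_type]
    simp only [Matrix.add_apply, Matrix.mul_apply, Matrix.sum_apply, Matrix.smul_apply, of_apply]
    congr 1
    · simp [Matrix.one_apply]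
    · simp only [Finset.mul_sum, smul_eq_mul]
      rw [Finset.sum_comm]
      refine Finset.sum_congr rfl fun s _ => Finset.sum_congr rfl fun t _ => by ring
  · intro j
    ext k r
    have h := congrArg (fun x => (starRingEnd ℂ) (x (.inr r))) (hV (j, k))
    simp only [hMV, u, v, Fintype.sum_sum_type, Sum.elim_inl, Sum.elim_inr, map_add, map_sum,
      map_mul, Complex.conj_conj] at h
    refine Eq.trans h.symm ?_
    rw [Fintype.sum_prod_type]
    simp only [Matrix.add_apply, Matrix.mul_apply, Matrix.sum_apply, Matrix.smul_apply, of_apply]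
    congr 1
    · simp [Matrix.one_apply]
    · simp only [Finset.mul_sum, smul_eq_mul]
      rw [Finset.sum_comm]
      refine Finset.sum_congr rfl fun s _ => Finset.sum_congr rfl fun t _ => by ring

theorem daWeight_shift {d : ℕ} (β : Fin d → ℕ) (t : Fin d) :
    daWeight d (β + Pi.single t 1) * ((∑ i, (β + Pi.single t 1 : Fin d → ℕ) i : ℕ) : ℝ) =
      daWeight d β * (((β + Pi.single t 1 : Fin d → ℕ) t : ℕ) : ℝ) := by
  have h1 : ∑ i, (β + Pi.single t 1 : Fin d → ℕ) i = ∑ i, β i + 1 := by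
    simp [Finset.sum_add_distrib]
  have h2 : ∏ i, Nat.factorial ((β + Pi.single t 1 : Fin d → ℕ) i) =
      (∏ i, Nat.factorial (β i)) * (β t + 1) := by
    have : ∀ i, Nat.factorial ((β + Pi.single t 1 : Fin d → ℕ) i) =
        Nat.factorial (β i) * (if t = i then β t + 1 else 1) := by
      intro i
      by_cases h : t = i
      · subst h
        simp [Nat.factorial_succ, mul_comm]
      · simp [h, Pi.single_apply, Ne.symm h]
    simp only [this, Finset.prod_mul_distrib, Finset.prod_ite_eq, Finset.mem_univ, if_true]
  unfold daWeight
  rw [h2, h1, Nat.factorial_succ]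
  have hp : 0 < ∏ i, Nat.factorial (β i) := Finset.prod_pos fun i _ => Nat.factorial_pos _
  have : (Nat.factorial (∑ i, β i) : ℝ) ≠ 0 := by positivity
  simp only [Pi.add_apply, Pi.single_eq_same]
  push_cast
  field_simp

theorem sub_add_single {d : ℕ} {α : Fin d → ℕ} {t : Fin d} (h : α t ≠ 0) :
    α - Pi.single t 1 + Pi.single t 1 = α := by
  ext i
  by_cases hi : i = t
  · subst hi
    simp
    omega
  · simp [Pi.single_apply, hi]

theorem row_contraction {d : ℕ} (α : Fin d → ℕ) (x : Fin d → ℂ) :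
    ‖∑ t, (if α t = 0 then 0 else x t)‖ ^ 2 * daWeight d α ≤
      ∑ t, if α t = 0 then 0 else ‖x t‖ ^ 2 * daWeight d (α - Pi.single t 1) := by
  have h1 : (∑ t, ‖if α t = 0 then 0 else x t‖) ^ 2 ≤
      (∑ t, (α t : ℝ)) * ∑ t, (if α t = 0 then 0 else ‖x t‖ ^ 2 / α t) := by
    apply Finset.sum_sq_le_sum_mul_sum_of_sq_eq_mul
    · intro i _; positivity
    · intro i _; split_ifs <;> positivity
    · intro i _
      split_ifs with h
      · simp
      · have : (α i : ℝ) ≠ 0 := by exact_mod_cast h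
        field_simp
  have h2 : ‖∑ t, (if α t = 0 then 0 else x t)‖ ^ 2 ≤
      (∑ t, (α t : ℝ)) * ∑ t, (if α t = 0 then 0 else ‖x t‖ ^ 2 / α t) :=
    (pow_le_pow_left₀ (norm_nonneg _) (norm_sum_le _ _) 2).trans h1
  refine (mul_le_mul_of_nonneg_right h2 (daWeight_pos d α).le).trans_eq ?_
  rw [Finset.mul_sum, Finset.sum_mul]
  refine Finset.sum_congr rfl fun t _ => ?_
  split_ifs with h
  · simp
  · have hs := daWeight_shift (α - Pi.single t 1) t
    rw [sub_add_single h] at hs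
    have h3 : (α t : ℝ) ≠ 0 := by exact_mod_cast h
    push_cast at hs
    rw [mul_div_assoc', div_mul_eq_mul_div, div_eq_iff h3]
    linear_combination (‖x t‖ ^ 2) * hs

theorem lev_shift {d k : ℕ} (F : Fin d → (Fin d → ℕ) → ℝ) :
    ∑ α ∈ lev d (k + 1), ∑ t, (if α t = 0 then 0 else F t (α - Pi.single t 1)) =
      ∑ β ∈ lev d k, ∑ t, F t β := by
  rw [Finset.sum_comm]
  conv_rhs => rw [Finset.sum_comm]
  refine Finset.sum_congr rfl fun t _ => ?_
  have : ∀ α : Fin d → ℕ, (if α t = 0 then 0 else F t (α - Pi.single t 1)) =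
      if α t ≠ 0 then F t (α - Pi.single t 1) else 0 := by
    intro α; split_ifs <;> simp_all
  simp only [this]
  rw [← Finset.sum_filter]
  refine Finset.sum_bij' (fun α _ => α - Pi.single t 1) (fun β _ => β + Pi.single t 1)
    ?_ ?_ ?_ ?_ ?_
  · intro α hα
    rw [Finset.mem_filter, mem_lev] at hα
    rw [mem_lev]
    have h := hα.1
    rw [← sub_add_single hα.2] at h
    simp only [Pi.add_apply, Finset.sum_add_distrib, Finset.sum_pi_single', Finset.mem_univ,
      if_true] at h
    simpa using h
  · intro β hβ
    rw [mem_lev] at hβ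
    rw [Finset.mem_filter, mem_lev]
    constructor
    · simp [Finset.sum_add_distrib, hβ]
    · simp
  · intro α hα
    exact sub_add_single (Finset.mem_filter.1 hα).2
  · intro β hβ
    ext i; simp
  · intro α hα
    rfl

theorem conv_summable {d : ℕ} (c : (Fin d → ℕ) → ℂ) (M : ℝ)
    (hc : ∀ k, ∑ α ∈ lev d k, ‖c α‖ ^ 2 * daWeight d α ≤ M)
    (w : EuclideanSpace ℂ (Fin d)) (hw : w ∈ ball (0 : EuclideanSpace ℂ (Fin d)) 1) :
    Summable fun α : Fin d → ℕ => c α * ∏ i, w i ^ α i := by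
  rw [mem_ball_zero_iff] at hw
  have h1 : ∑ i, ‖w i‖ ^ 2 < 1 := by
    rw [← EuclideanSpace.norm_sq_eq]; nlinarith [norm_nonneg w]
  obtain ⟨r, hr1, hr2⟩ := exists_between h1
  have hr0 : 0 < r := lt_of_le_of_lt (Finset.sum_nonneg fun i _ => by positivity) hr1
  have hM : 0 ≤ M := le_trans (Finset.sum_nonneg fun α _ =>
    mul_nonneg (sq_nonneg _) (daWeight_pos d α).le) (hc 0)
  have s1 : Summable fun α : Fin d → ℕ => ‖c α‖ ^ 2 * daWeight d α * r ^ (∑ i, α i) := by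
    have hn : ∀ α : Fin d → ℕ, 0 ≤ ‖c α‖ ^ 2 * daWeight d α * r ^ (∑ i, α i) := fun α =>
      mul_nonneg (mul_nonneg (sq_nonneg _) (daWeight_pos d α).le) (by positivity)
    refine summable_of_sum_le (c := M * (1 - r)⁻¹) hn (sum_le_levs _ hn _ fun K => ?_)
    calc _ ≤ ∑ k ∈ Finset.range K, M * r ^ k := by
          refine Finset.sum_le_sum fun k _ => ?_
          have : ∑ α ∈ lev d k, ‖c α‖ ^ 2 * daWeight d α * r ^ (∑ i, α i) =
              (∑ α ∈ lev d k, ‖c α‖ ^ 2 * daWeight d α) * r ^ k := by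
            rw [Finset.sum_mul]
            exact Finset.sum_congr rfl fun α hα => by rw [mem_lev.1 hα]
          rw [this]
          exact mul_le_mul_of_nonneg_right (hc k) (by positivity)
      _ ≤ _ := by
          rw [← Finset.mul_sum, ← tsum_geometric_of_lt_one hr0.le hr2]
          exact mul_le_mul_of_nonneg_left ((summable_geometric_of_lt_one hr0.le hr2).sum_le_tsum _
            fun i _ => by positivity) hM
  have s2 := kernel_summable d (fun i => ‖w i‖ ^ 2 / r) (fun i => by positivity)
    (by rw [← Finset.sum_div, div_lt_one hr0]; exact hr1)
  refine Summable.of_norm_bounded (s1.add s2) fun α => ?_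
  rw [norm_mul, norm_prod]
  simp only [norm_pow, div_pow, Finset.prod_div_distrib, Finset.prod_pow_eq_pow_sum]
  have e : ∏ i, (‖w i‖ ^ 2) ^ α i = (∏ i, ‖w i‖ ^ α i) ^ 2 := by
    rw [← Finset.prod_pow]
    exact Finset.prod_congr rfl fun i _ => by rw [← pow_mul, ← pow_mul, mul_comm]
  rw [e]
  have hp := daWeight_pos d α
  have hP : 0 ≤ ∏ i, ‖w i‖ ^ α i := Finset.prod_nonneg fun i _ => by positivity
  have hq : 0 < r ^ (∑ i, α i) := by positivity
  generalize ∏ i, ‖w i‖ ^ α i = P at *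
  generalize r ^ (∑ i, α i) = q at *
  generalize daWeight d α = o at *
  have hx : 0 < o * q := by positivity
  have e2 : o⁻¹ * (P ^ 2 / q) = P ^ 2 / (o * q) := by field_simp
  have e3 : ‖c α‖ ^ 2 * o * q + o⁻¹ * (P ^ 2 / q) - 2 * (‖c α‖ * P) =
      (‖c α‖ * (o * q) - P) ^ 2 / (o * q) := by
    field_simp
    ring
  have e4 : 0 ≤ (‖c α‖ * (o * q) - P) ^ 2 / (o * q) := by positivity
  have e5 : 0 ≤ ‖c α‖ * P := by positivity
  linarith

theorem hasSum_shift {d : ℕ} (c : (Fin d → ℕ) → ℂ) (w : Fin d → ℂ) (S : ℂ) (t : Fin d)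
    (h : HasSum (fun α : Fin d → ℕ => c α * ∏ i, w i ^ α i) S) :
    HasSum (fun α : Fin d → ℕ => (if α t = 0 then 0 else c (α - Pi.single t 1)) *
      ∏ i, w i ^ α i) (w t * S) := by
  have hinj : Function.Injective fun β : Fin d → ℕ => β + Pi.single t 1 :=
    add_left_injective _
  rw [← hinj.hasSum_iff]
  · refine (h.mul_left (w t)).congr_fun fun β => ?_
    simp only [Function.comp, Pi.add_apply, Pi.single_eq_same, Nat.add_eq_zero_iff, one_ne_zero,
      and_false, if_false, pow_add, Finset.prod_mul_distrib, add_tsub_cancel_right]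
    have : ∏ i, w i ^ (Pi.single t 1 : Fin d → ℕ) i = w t := by
      simp [Pi.single_apply, pow_ite]
    rw [this]
    ring
  · intro α hα
    by_cases h0 : α t = 0
    · simp [h0]
    · exact absurd ⟨_, sub_add_single h0⟩ hα

theorem hasSum_mulVec {d : ℕ} {κ κ' : Type*} [Fintype κ] (M : Matrix κ' κ ℂ)
    (v : (Fin d → ℕ) → κ → ℂ) (x : κ → ℂ) (p : (Fin d → ℕ) → ℂ)
    (h : ∀ s, HasSum (fun α => v α s * p α) (x s)) (i : κ') :
    HasSum (fun α => (M *ᵥ v α) i * p α) ((M *ᵥ x) i) := by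
  have := hasSum_sum (s := Finset.univ) fun s (_ : s ∈ Finset.univ) => (h s).mul_left (M i s)
  refine this.congr_fun fun α => ?_
  simp only [mulVec, dotProduct, Finset.sum_mul]
  exact Finset.sum_congr rfl fun s _ => by ring

/-- Auxiliary recursion for the state coefficients. -/
def stY {d m : ℕ} {ι : Type*} [Fintype ι] (B : Fin d → Matrix ι (Fin m) ℂ)
    (A : Fin d → Matrix ι ι ℂ) (a : Fin m → (Fin d → ℕ) → ℂ) : ℕ → (Fin d → ℕ) → ι → ℂ
  | 0, _ => 0
  | k + 1, α => ∑ t, if α t = 0 then 0 else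
      (B t *ᵥ fun l => a l (α - Pi.single t 1)) + A t *ᵥ stY B A a k (α - Pi.single t 1)

/-- Taylor coefficients of the state. -/
def yc {d m : ℕ} {ι : Type*} [Fintype ι] (B : Fin d → Matrix ι (Fin m) ℂ)
    (A : Fin d → Matrix ι ι ℂ) (a : Fin m → (Fin d → ℕ) → ℂ) (α : Fin d → ℕ) : ι → ℂ :=
  stY B A a (∑ i, α i) α

theorem yc_rec {d m : ℕ} {ι : Type*} [Fintype ι] (B : Fin d → Matrix ι (Fin m) ℂ)
    (A : Fin d → Matrix ι ι ℂ) (a : Fin m → (Fin d → ℕ) → ℂ) (α : Fin d → ℕ) :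
    yc B A a α = ∑ t, if α t = 0 then 0 else
      (B t *ᵥ fun l => a l (α - Pi.single t 1)) + A t *ᵥ yc B A a (α - Pi.single t 1) := by
  have hsub : ∀ t, α t ≠ 0 → ∑ i, α i = ∑ i, (α - Pi.single t 1 : Fin d → ℕ) i + 1 := by
    intro t ht
    conv_lhs => rw [← sub_add_single ht]
    simp only [Pi.add_apply, Finset.sum_add_distrib, Finset.sum_pi_single', Finset.mem_univ,
      if_true]
  rcases hk : ∑ i, α i with _ | k
  · have h0 : ∀ t, α t = 0 := fun t => (Finset.sum_eq_zero_iff.1 hk) t (Finset.mem_univ t)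
    simp only [yc, hk, stY, h0, if_true, Finset.sum_const_zero]
  · conv_lhs => rw [yc, hk, stY]
    refine Finset.sum_congr rfl fun t _ => ?_
    split_ifs with h
    · rfl
    · have := hsub t h
      rw [hk] at this
      have h2 : ∑ i, (α - Pi.single t 1 : Fin d → ℕ) i = k := by omega
      rw [yc, h2]

theorem ball_unit {d m : ℕ} {ι : Type*} [Fintype ι] [DecidableEq ι]
    (D : Matrix (Fin m) (Fin m) ℂ)
    (C : Matrix (Fin m) ι ℂ) (B : Fin d → Matrix ι (Fin m) ℂ) (A : Fin d → Matrix ι ι ℂ)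
    (hcon : ∀ (u : Fin m → ℂ) (y : ι → ℂ),
        ∑ j, ‖(D *ᵥ u + C *ᵥ y) j‖ ^ 2 + ∑ t, ∑ s, ‖(B t *ᵥ u + A t *ᵥ y) s‖ ^ 2
          ≤ ∑ j, ‖u j‖ ^ 2 + ∑ s, ‖y s‖ ^ 2)
    (w : EuclideanSpace ℂ (Fin d)) (hw : w ∈ ball (0 : EuclideanSpace ℂ (Fin d)) 1) :
    IsUnit (1 - ∑ t, w t • A t) := by
  rw [← Matrix.mulVec_injective_iff_isUnit]
  rw [mem_ball_zero_iff] at hw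
  have h1 : ∑ i, ‖w i‖ ^ 2 < 1 := by
    rw [← EuclideanSpace.norm_sq_eq]; nlinarith [norm_nonneg w]
  have key : ∀ y : ι → ℂ, (1 - ∑ t, w t • A t) *ᵥ y = 0 → y = 0 := by
    intro y hy
    rw [Matrix.sub_mulVec, Matrix.one_mulVec, sub_eq_zero, Matrix.sum_mulVec] at hy
    have hc := hcon 0 y
    simp only [Matrix.mulVec_zero, zero_add, Pi.zero_apply, norm_zero, ne_eq, OfNat.ofNat_ne_zero,
      not_false_eq_true, zero_pow, Finset.sum_const_zero] at hc
    have hc2 : ∑ t, ∑ s, ‖(A t *ᵥ y) s‖ ^ 2 ≤ ∑ s, ‖y s‖ ^ 2 :=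
      le_trans (le_add_of_nonneg_left (Finset.sum_nonneg fun _ _ => by positivity)) hc
    have hs : ∀ s, ‖y s‖ ^ 2 ≤ (∑ i, ‖w i‖ ^ 2) * ∑ t, ‖(A t *ᵥ y) s‖ ^ 2 := by
      intro s
      have e : y s = ∑ t, w t * (A t *ᵥ y) s := by
        conv_lhs => rw [hy]
        simp [Finset.sum_apply, Matrix.smul_mulVec]
      calc ‖y s‖ ^ 2 ≤ (∑ t, ‖w t‖ * ‖(A t *ᵥ y) s‖) ^ 2 := by
            rw [e]
            refine pow_le_pow_left₀ (norm_nonneg _) ((norm_sum_le _ _).trans_eq ?_) 2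
            simp only [norm_mul]
        _ ≤ _ := Finset.sum_mul_sq_le_sq_mul_sq _ _ _
    have h2 : ∑ s, ‖y s‖ ^ 2 ≤ (∑ i, ‖w i‖ ^ 2) * ∑ s, ‖y s‖ ^ 2 := by
      calc _ ≤ ∑ s, (∑ i, ‖w i‖ ^ 2) * ∑ t, ‖(A t *ᵥ y) s‖ ^ 2 :=
            Finset.sum_le_sum fun s _ => hs s
        _ ≤ _ := by
            rw [← Finset.mul_sum, Finset.sum_comm]
            exact mul_le_mul_of_nonneg_left hc2 (Finset.sum_nonneg fun _ _ => by positivity)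
    have h3 : ∑ s, ‖y s‖ ^ 2 = 0 := by
      have : 0 ≤ ∑ s, ‖y s‖ ^ 2 := Finset.sum_nonneg fun _ _ => by positivity
      nlinarith
    rw [Finset.sum_eq_zero_iff_of_nonneg fun _ _ => by positivity] at h3
    ext s
    simpa using h3 s (Finset.mem_univ s)
  intro x y hxy
  rw [← sub_eq_zero]
  apply key
  rw [Matrix.mulVec_sub]
  exact sub_eq_zero.2 hxy

/-- The transfer function. -/
def transfer {d m : ℕ} {ι : Type*} [Fintype ι] [DecidableEq ι]
    (D : Matrix (Fin m) (Fin m) ℂ)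
    (C : Matrix (Fin m) ι ℂ) (B : Fin d → Matrix ι (Fin m) ℂ) (A : Fin d → Matrix ι ι ℂ)
    (w : EuclideanSpace ℂ (Fin d)) : Matrix (Fin m) (Fin m) ℂ :=
  D + C * (1 - ∑ t, w t • A t)⁻¹ * ∑ t, w t • B t

theorem det_diff {E : Type*} [NormedAddCommGroup E] [NormedSpace ℂ E] {ι : Type*} [Fintype ι]
    [DecidableEq ι] (N : E → Matrix ι ι ℂ) (h : ∀ i j, Differentiable ℂ fun w => N w i j) :
    Differentiable ℂ fun w => (N w).det := by
  simp only [Matrix.det_apply']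
  refine Differentiable.fun_sum fun σ _ => Differentiable.const_mul ?_ _
  have hp : ∀ s : Finset ι, Differentiable ℂ fun w => ∏ i ∈ s, N w (σ i) i := by
    intro s
    induction s using Finset.induction_on with
    | empty => simp only [Finset.prod_empty]; exact differentiable_const _
    | insert i s hi ih =>
      simp only [Finset.prod_insert hi]
      exact (h _ _).mul ih
  exact hp _

theorem transfer_diff {d m : ℕ} {ι : Type*} [Fintype ι] [DecidableEq ι]
    (D : Matrix (Fin m) (Fin m) ℂ)
    (C : Matrix (Fin m) ι ℂ) (B : Fin d → Matrix ι (Fin m) ℂ) (A : Fin d → Matrix ι ι ℂ)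
    (U : Set (EuclideanSpace ℂ (Fin d)))
    (hu : ∀ w ∈ U, IsUnit (1 - ∑ t, w t • A t)) (k l : Fin m) :
    DifferentiableOn ℂ (fun w => transfer D C B A w k l) U := by
  have hent : ∀ i j, Differentiable ℂ
      fun w : EuclideanSpace ℂ (Fin d) => (1 - ∑ t, w t • A t) i j := by
    intro i j
    simp only [Matrix.sub_apply, Matrix.sum_apply, Matrix.smul_apply]
    fun_prop
  have hdet : Differentiable ℂ
      fun w : EuclideanSpace ℂ (Fin d) => (1 - ∑ t, w t • A t).det := by
    exact det_diff _ hent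
  have hadj : ∀ i j, Differentiable ℂ
      fun w : EuclideanSpace ℂ (Fin d) => (1 - ∑ t, w t • A t).adjugate i j := by
    intro i j
    simp only [Matrix.adjugate_apply]
    refine det_diff _ ?_
    intro a b
    simp only [Matrix.updateRow_apply]
    split_ifs
    · exact differentiable_const _
    · exact hent a b
  have hinv : ∀ i j, DifferentiableOn ℂ
      (fun w : EuclideanSpace ℂ (Fin d) => (1 - ∑ t, w t • A t)⁻¹ i j) U := by
    intro i j
    simp only [Matrix.inv_def, Matrix.smul_apply, Ring.inverse_eq_inv']
    refine DifferentiableOn.smul (DifferentiableOn.inv hdet.differentiableOn fun w hw => ?_)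
      (hadj i j).differentiableOn
    exact ((Matrix.isUnit_iff_isUnit_det _).1 (hu w hw)).ne_zero
  simp only [transfer, Matrix.add_apply, Matrix.mul_apply, Matrix.sum_apply, Matrix.smul_apply]
  have hB : ∀ i j, Differentiable ℂ
      fun w : EuclideanSpace ℂ (Fin d) => ∑ t, w t • B t i j := by
    intro i j
    fun_prop
  refine DifferentiableOn.add (differentiableOn_const _) ?_
  refine DifferentiableOn.fun_sum fun s _ => DifferentiableOn.mul ?_ (hB s l).differentiableOn
  exact DifferentiableOn.fun_sum fun s _ => DifferentiableOn.const_mul (hinv _ _) _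

theorem transfer_mult {d m : ℕ} {ι : Type*} [Fintype ι] [DecidableEq ι]
    (D : Matrix (Fin m) (Fin m) ℂ)
    (C : Matrix (Fin m) ι ℂ) (B : Fin d → Matrix ι (Fin m) ℂ) (A : Fin d → Matrix ι ι ℂ)
    (hcon : ∀ (u : Fin m → ℂ) (y : ι → ℂ),
        ∑ j, ‖(D *ᵥ u + C *ᵥ y) j‖ ^ 2 + ∑ t, ∑ s, ‖(B t *ᵥ u + A t *ᵥ y) s‖ ^ 2
          ≤ ∑ j, ‖u j‖ ^ 2 + ∑ s, ‖y s‖ ^ 2) :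
    IsContractiveDAMultiplier d m (transfer D C B A) := by
  intro f a hfa ha
  let av : (Fin d → ℕ) → Fin m → ℂ := fun α l => a l α
  let y : (Fin d → ℕ) → ι → ℂ := yc B A a
  let g : Fin d → (Fin d → ℕ) → ι → ℂ := fun t α => B t *ᵥ av α + A t *ᵥ y α
  let h : (Fin d → ℕ) → Fin m → ℂ := fun α => D *ᵥ av α + C *ᵥ y α
  have hy : ∀ α s, y α s = ∑ t, if α t = 0 then 0 else g t (α - Pi.single t 1) s := by
    intro α s
    have := congrFun (yc_rec B A a α) s
    rw [Finset.sum_apply] at this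
    refine this.trans (Finset.sum_congr rfl fun t _ => ?_)
    split_ifs <;> rfl
  -- energies
  let eF : (Fin d → ℕ) → ℝ := fun α => ∑ j, ‖a j α‖ ^ 2 * daWeight d α
  let eH : (Fin d → ℕ) → ℝ := fun α => ∑ j, ‖h α j‖ ^ 2 * daWeight d α
  let eY : (Fin d → ℕ) → ℝ := fun α => ∑ s, ‖y α s‖ ^ 2 * daWeight d α
  let eG : Fin d → (Fin d → ℕ) → ℝ := fun t α => ∑ s, ‖g t α s‖ ^ 2 * daWeight d α
  have nn : ∀ (c : ℂ) α, 0 ≤ ‖c‖ ^ 2 * daWeight d α := fun c α =>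
    mul_nonneg (sq_nonneg _) (daWeight_pos d α).le
  have nF : ∀ α, 0 ≤ eF α := fun α => Finset.sum_nonneg fun j _ => nn _ _
  have nH : ∀ α, 0 ≤ eH α := fun α => Finset.sum_nonneg fun j _ => nn _ _
  have nY : ∀ α, 0 ≤ eY α := fun α => Finset.sum_nonneg fun j _ => nn _ _
  have nG : ∀ t α, 0 ≤ eG t α := fun t α => Finset.sum_nonneg fun j _ => nn _ _
  have pt : ∀ α, eH α + ∑ t, eG t α ≤ eF α + eY α := by
    intro α
    have := mul_le_mul_of_nonneg_right (hcon (av α) (y α)) (daWeight_pos d α).le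
    simpa only [eH, eG, eF, eY, ← Finset.sum_mul, add_mul] using this
  have ptY : ∀ α, eY α ≤ ∑ t, if α t = 0 then 0 else eG t (α - Pi.single t 1) := by
    intro α
    calc eY α ≤ ∑ s, ∑ t, (if α t = 0 then 0 else ‖g t (α - Pi.single t 1) s‖ ^ 2 *
          daWeight d (α - Pi.single t 1)) := by
          refine Finset.sum_le_sum fun s _ => ?_
          rw [hy]
          exact row_contraction α fun t => g t (α - Pi.single t 1) s
      _ = _ := by
          rw [Finset.sum_comm]
          refine Finset.sum_congr rfl fun t _ => ?_
          split_ifs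
          · simp
          · rfl
  have levY : ∀ k, ∑ α ∈ lev d (k + 1), eY α ≤ ∑ α ∈ lev d k, ∑ t, eG t α := by
    intro k
    rw [← lev_shift eG]
    exact Finset.sum_le_sum fun α _ => ptY α
  have levpt : ∀ k, ∑ α ∈ lev d k, eH α + ∑ α ∈ lev d k, ∑ t, eG t α ≤
      ∑ α ∈ lev d k, eF α + ∑ α ∈ lev d k, eY α := by
    intro k
    rw [← Finset.sum_add_distrib, ← Finset.sum_add_distrib]
    exact Finset.sum_le_sum fun α _ => pt α
  have energy : ∀ K, ∑ k ∈ Finset.range K, ∑ α ∈ lev d k, eH α + ∑ α ∈ lev d K, eY α ≤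
      ∑ k ∈ Finset.range K, ∑ α ∈ lev d k, eF α := by
    intro K
    induction K with
    | zero =>
      simp only [Finset.range_zero, Finset.sum_empty, zero_add]
      refine (Finset.sum_eq_zero fun α hα => ?_).le
      have h0 : y α = 0 := by
        simp only [y, yc, mem_lev.1 hα, stY]
      simp [eY, h0]
    | succ K ih =>
      rw [Finset.sum_range_succ, Finset.sum_range_succ]
      linarith [levY K, levpt K]
  have sF : Summable eF := summable_sum fun j _ => ha j
  have tF : ∑' α, eF α = ∑ j, daNormSq d (a j) := Summable.tsum_finsetSum fun j _ => ha j
  have boundF : ∀ K, ∑ k ∈ Finset.range K, ∑ α ∈ lev d k, eF α ≤ ∑' α, eF α := by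
    intro K
    rw [← sum_levs]
    exact sF.sum_le_tsum _ fun α _ => nF α
  have boundH : ∀ s : Finset (Fin d → ℕ), ∑ α ∈ s, eH α ≤ ∑' α, eF α := by
    refine sum_le_levs eH nH _ fun K => ?_
    have := Finset.sum_nonneg fun α (_ : α ∈ lev d K) => nY α
    linarith [energy K, boundF K]
  have boundG : ∀ k, ∑ α ∈ lev d k, ∑ t, eG t α ≤ ∑' α, eF α := by
    intro k
    have h1 := energy k
    have h2 := levpt k
    have h3 := boundF (k + 1)
    rw [Finset.sum_range_succ] at h3
    have h4 := Finset.sum_nonneg fun α (_ : α ∈ lev d k) => nH α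
    have h5 := Finset.sum_nonneg fun i (_ : i ∈ Finset.range k) =>
      Finset.sum_nonneg fun α (_ : α ∈ lev d i) => nH α
    linarith
  have sH : Summable eH := summable_of_sum_le nH boundH
  have sHj : ∀ j, Summable fun α => ‖h α j‖ ^ 2 * daWeight d α := fun j =>
    Summable.of_nonneg_of_le (fun α => nn _ _) (fun α =>
      Finset.single_le_sum (f := fun j => ‖h α j‖ ^ 2 * daWeight d α)
        (fun j _ => nn _ _) (Finset.mem_univ j)) sH
  refine ⟨fun j α => h α j, ?_, sHj, ?_⟩
  · -- values
    intro j w hw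
    have hg : ∀ t s, Summable fun α : Fin d → ℕ => g t α s * ∏ i, w i ^ α i := by
      intro t s
      refine conv_summable _ (∑' α, eF α) (fun k => ?_) w hw
      refine le_trans (Finset.sum_le_sum fun α _ => ?_) (boundG k)
      exact (Finset.single_le_sum (f := fun s => ‖g t α s‖ ^ 2 * daWeight d α)
        (fun j _ => nn _ _) (Finset.mem_univ s)).trans
        (Finset.single_le_sum (f := fun t => eG t α) (fun t _ => nG t α) (Finset.mem_univ t))
    let S : Fin d → ι → ℂ := fun t s => ∑' α : Fin d → ℕ, g t α s * ∏ i, w i ^ α i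
    let Y : ι → ℂ := fun s => ∑ t, w t * S t s
    let F : Fin m → ℂ := fun l => f l w
    have hF : ∀ l, HasSum (fun α : Fin d → ℕ => av α l * ∏ i, w i ^ α i) (F l) :=
      fun l => hfa l w hw
    have hY : ∀ s, HasSum (fun α : Fin d → ℕ => y α s * ∏ i, w i ^ α i) (Y s) := by
      intro s
      have := hasSum_sum (s := Finset.univ) fun t (_ : t ∈ Finset.univ) =>
        hasSum_shift (fun α => g t α s) w _ t (hg t s).hasSum
      refine this.congr_fun fun α => ?_
      rw [hy, Finset.sum_mul]
    have hS : ∀ t, S t = B t *ᵥ F + A t *ᵥ Y := by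
      intro t
      ext s
      refine HasSum.unique (hg t s).hasSum ?_
      refine ((hasSum_mulVec (B t) _ _ _ hF s).add (hasSum_mulVec (A t) _ _ _ hY s)).congr_fun
        fun α => ?_
      simp only [g, Pi.add_apply, add_mul]
    have hYeq : (1 - ∑ t, w t • A t) *ᵥ Y = (∑ t, w t • B t) *ᵥ F := by
      have e : Y = (∑ t, w t • B t) *ᵥ F + (∑ t, w t • A t) *ᵥ Y := by
        conv_lhs => change fun s => ∑ t, w t * S t s
        ext s
        simp only [hS, Pi.add_apply, Matrix.sum_mulVec, Matrix.smul_mulVec, Finset.sum_apply,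
          Pi.smul_apply, smul_eq_mul, mul_add, Finset.sum_add_distrib]
      rw [Matrix.sub_mulVec, Matrix.one_mulVec, sub_eq_iff_eq_add]
      exact e
    have hYeq2 : Y = (1 - ∑ t, w t • A t)⁻¹ *ᵥ ((∑ t, w t • B t) *ᵥ F) := by
      rw [← hYeq, Matrix.mulVec_mulVec, Matrix.nonsing_inv_mul, Matrix.one_mulVec]
      exact (Matrix.isUnit_iff_isUnit_det _).1 (ball_unit D C B A hcon w hw)
    have hval : ∑ l, transfer D C B A w j l * f l w = (D *ᵥ F) j + (C *ᵥ Y) j := by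
      change (transfer D C B A w *ᵥ F) j = _
      rw [transfer, Matrix.add_mulVec, hYeq2, Matrix.mulVec_mulVec, Matrix.mulVec_mulVec,
        Pi.add_apply, Matrix.mul_assoc]
    change HasSum _ (∑ l, transfer D C B A w j l * f l w)
    rw [hval]
    refine ((hasSum_mulVec D _ _ _ hF j).add (hasSum_mulVec C _ _ _ hY j)).congr_fun fun α => ?_
    simp only [h, Pi.add_apply, add_mul]
  · rw [← tF]
    calc ∑ j, daNormSq d (fun α => h α j) = ∑' α, eH α :=
          (Summable.tsum_finsetSum fun j _ => sHj j).symm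
      _ ≤ _ := sH.tsum_le_of_sum_le boundH

/-- **The Drury–Arveson space on the unit ball of `ℂ^d` is a complete interpolation
space.** -/
theorem stmt3 (d m n : ℕ) (hd : 0 < d) (hm : 0 < m) (hn : 0 < n)
    (lam : Fin n → EuclideanSpace ℂ (Fin d))
    (hmem : ∀ i, lam i ∈ ball (0 : EuclideanSpace ℂ (Fin d)) 1)
    (hinj : Function.Injective lam) (z : Fin n → Matrix (Fin m) (Fin m) ℂ) :
    (∃ Φ : EuclideanSpace ℂ (Fin d) → Matrix (Fin m) (Fin m) ℂ,
      (∀ k l, DifferentiableOn ℂ (fun w => Φ w k l)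
        (ball (0 : EuclideanSpace ℂ (Fin d)) 1)) ∧
      (∀ i, Φ (lam i) = z i) ∧ IsContractiveDAMultiplier d m Φ) ↔
    (Matrix.of fun p q : Fin n × Fin m =>
      ((1 : Matrix (Fin m) (Fin m) ℂ) - z p.1 * (z q.1)ᴴ) p.2 q.2 *
        (1 - ∑ t, lam p.1 t * (starRingEnd ℂ) (lam q.1 t))⁻¹).PosSemidef := by
  constructor
  · rintro ⟨Φ, -, hz, hΦ⟩
    exact forward d m n lam hmem z Φ hz hΦ
  · intro h
    obtain ⟨D, C, B, A, Γ, hcon, h1, h2⟩ := realization d m n lam hmem z h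
    refine ⟨transfer D C B A, fun k l => transfer_diff D C B A _
      (ball_unit D C B A hcon) k l, fun i => ?_, transfer_mult D C B A hcon⟩
    have hu := (Matrix.isUnit_iff_isUnit_det _).1 (ball_unit D C B A hcon (lam i) (hmem i))
    have h3 : Γ i * (1 - ∑ t, lam i t • A t) = C := by
      rw [Matrix.mul_sub, Matrix.mul_one, sub_eq_iff_eq_add]
      exact h2 i
    rw [transfer, ← h3, Matrix.mul_assoc (Γ i), Matrix.mul_nonsing_inv _ hu, Matrix.mul_one]
    exact (h1 i).symm
end
end

section
/- Let d be a positive integer and B the open unit ball of ℂ^d. Let k : B × B → ℂ satisfy: (a) for each fixed λ ∈ B the function μ ↦ k(μ,λ) is holomorphic on B; (b) k is Hermitian, i.e. k(λ,μ) = conj(k(μ,λ)) for all λ, μ ∈ B; (c) k(0,0) is a strictly positive real number; and (d) for every λ ∈ B and every z ∈ ℂ, the 2×2 matrix with rows (k(0,0), conj(k(λ,0))) and (k(λ,0), (1−|z|²)·k(λ,λ)) is positive semidefinite if and only if |z| ≤ ‖λ‖. Then, defining f : B → ℂ by f(μ) = k(μ,0)/√(k(0,0)), the function f is holomorphic and nonvanishing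 on B and k(μ,λ) = f(μ)·conj(f(λ))·(1 − ⟨μ,λ⟩)^{-1} for all μ, λ ∈ B, where ⟨μ,λ⟩ = Σᵢ μᵢ·conj(λᵢ). -/
open Complex Metric
open scoped ComplexOrder

lemma psd_two_iff (a c : ℝ) (b : ℂ) (ha : 0 < a) :
    (!![(a : ℂ), (starRingEnd ℂ) b; b, (c : ℂ)] : Matrix (Fin 2) (Fin 2) ℂ).PosSemidef
      ↔ normSq b ≤ a * c := by
  constructor
  · intro h
    have h1 := h.det_nonneg
    rw [Matrix.det_fin_two_of, mul_comm ((starRingEnd ℂ) b), Complex.mul_conj] at h1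
    have h2 : (0:ℂ) ≤ ((a * c - normSq b : ℝ) : ℂ) := by push_cast; exact h1
    have := Complex.zero_le_real.mp h2
    linarith
  · intro h
    refine Matrix.PosSemidef.of_dotProduct_mulVec_nonneg ?_ ?_
    · ext i j
      fin_cases i <;> fin_cases j <;> simp
    · intro x
      have key : star x ⬝ᵥ ((!![(a : ℂ), (starRingEnd ℂ) b; b, (c : ℂ)] : Matrix (Fin 2) (Fin 2) ℂ).mulVec x)
          = (((normSq (a * x 0 + (starRingEnd ℂ) b * x 1) + (a * c - normSq b) * normSq (x 1)) / a : ℝ) : ℂ) := by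
        have ha' : (a : ℂ) ≠ 0 := by exact_mod_cast ha.ne'
        simp only [Matrix.mulVec, dotProduct, Fin.sum_univ_two]
        push_cast
        rw [eq_div_iff ha']
        simp only [← Complex.mul_conj]
        simp
        ring
      rw [key]
      apply Complex.zero_le_real.mpr
      apply div_nonneg _ ha.le
      have := normSq_nonneg (a * x 0 + (starRingEnd ℂ) b * x 1)
      have := mul_nonneg (sub_nonneg.mpr h) (normSq_nonneg (x 1))
      linarith

/-- joint continuity of a partial derivative -/
lemma cont_partial (G : ℂ → ℂ → ℂ) (r M : ℝ)
    (h1 : ∀ w ∈ ball (0:ℂ) r, DifferentiableOn ℂ (fun z => G z w) (ball 0 r))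
    (h2 : ∀ z ∈ ball (0:ℂ) r, DifferentiableOn ℂ (fun w => G z w) (ball 0 r))
    (hM : ∀ z ∈ ball (0:ℂ) r, ∀ w ∈ ball (0:ℂ) r, ‖G z w‖ ≤ M)
    (z₀ w₀ : ℂ) (hz : z₀ ∈ ball (0:ℂ) r) (hw : w₀ ∈ ball (0:ℂ) r) :
    ContinuousAt (fun p : ℂ × ℂ => deriv (fun z => G z p.2) p.1) (z₀, w₀) := by
  obtain ⟨ε, hε, hεz⟩ : ∃ ε > 0, closedBall z₀ (2*ε) ⊆ ball (0:ℂ) r := by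
    obtain ⟨e, he, h⟩ := nhds_basis_closedBall.mem_iff.mp (isOpen_ball.mem_nhds hz)
    exact ⟨e/2, by positivity, by convert h using 2; ring⟩
  obtain ⟨δ, hδ, hδw⟩ : ∃ δ > 0, ball w₀ δ ⊆ ball (0:ℂ) r :=
    Metric.mem_nhds_iff.mp (isOpen_ball.mem_nhds hw)
  have lip : ∀ z ∈ ball (0:ℂ) r, ∀ w ∈ ball w₀ δ, ‖G z w - G z w₀‖ ≤ 2 * M / δ * dist w w₀ := by
    intro z hz w hw'
    rw [← dist_eq_norm]
    refine Complex.dist_le_div_mul_dist_of_mapsTo_ball (f := fun w => G z w) ((h2 z hz).mono hδw) ?_ hw'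
    intro w' hw''
    rw [mem_closedBall, dist_eq_norm]
    have := norm_sub_le (G z w') (G z w₀)
    have := hM z hz w' (hδw hw'')
    have := hM z hz w₀ hw
    linarith
  have dl : ∀ z ∈ ball z₀ ε, ∀ w ∈ ball w₀ δ,
      ‖deriv (fun z => G z w) z - deriv (fun z => G z w₀) z‖ ≤ 2 * M / δ * dist w w₀ / ε := by
    intro z hz' w hw'
    have hsub : closedBall z ε ⊆ ball 0 r := by
      refine subset_trans (closedBall_subset_closedBall' ?_) hεz
      have := mem_ball.mp hz'
      linarith
    have hzr : z ∈ ball (0:ℂ) r := hsub (mem_closedBall_self hε.le)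
    have e : deriv (fun z => G z w) z - deriv (fun z => G z w₀) z
        = deriv (fun z => G z w - G z w₀) z := by
      rw [deriv_fun_sub]
      · exact (h1 w (hδw hw')).differentiableAt (isOpen_ball.mem_nhds hzr)
      · exact (h1 w₀ hw).differentiableAt (isOpen_ball.mem_nhds hzr)
    rw [e]
    refine Complex.norm_deriv_le_of_forall_mem_sphere_norm_le hε ?_ ?_
    · apply DifferentiableOn.diffContOnCl
      rw [closure_ball _ hε.ne']
      exact ((h1 w (hδw hw')).sub (h1 w₀ hw)).mono hsub
    · intro s hs
      exact lip s (hsub (sphere_subset_closedBall hs)) w hw'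
  have c1 : ContinuousAt (fun p : ℂ × ℂ => deriv (fun z => G z w₀) p.1) (z₀, w₀) := by
    have : ContinuousAt (deriv (fun z => G z w₀)) z₀ :=
      (((h1 w₀ hw).analyticOnNhd isOpen_ball) z₀ hz).deriv.continuousAt
    exact ContinuousAt.comp (x := (z₀, w₀)) (f := fun p : ℂ × ℂ => p.1) this continuousAt_fst
  have c2 : Filter.Tendsto (fun p : ℂ × ℂ => deriv (fun z => G z p.2) p.1 - deriv (fun z => G z w₀) p.1)
      (nhds (z₀, w₀)) (nhds 0) := by
    have t : Filter.Tendsto (fun p : ℂ × ℂ => 2 * M / δ * dist p.2 w₀ / ε) (nhds (z₀, w₀)) (nhds 0) := by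
      have : Continuous (fun p : ℂ × ℂ => 2 * M / δ * dist p.2 w₀ / ε) := by fun_prop
      simpa using this.tendsto (z₀, w₀)
    refine squeeze_zero_norm' ?_ t
    filter_upwards [(isOpen_ball.prod isOpen_ball).mem_nhds
      (Set.mk_mem_prod (mem_ball_self hε : z₀ ∈ ball z₀ ε) (mem_ball_self hδ : w₀ ∈ ball w₀ δ))] with p hp
    exact dl p.1 hp.1 p.2 hp.2
  have := c2.add c1
  simpa [ContinuousAt] using this

lemma joint_diff (G : ℂ → ℂ → ℂ) (r M : ℝ)
    (h1 : ∀ w ∈ ball (0:ℂ) r, DifferentiableOn ℂ (fun z => G z w) (ball 0 r))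
    (h2 : ∀ z ∈ ball (0:ℂ) r, DifferentiableOn ℂ (fun w => G z w) (ball 0 r))
    (hM : ∀ z ∈ ball (0:ℂ) r, ∀ w ∈ ball (0:ℂ) r, ‖G z w‖ ≤ M)
    (z₀ w₀ : ℂ) (hz : z₀ ∈ ball (0:ℂ) r) (hw : w₀ ∈ ball (0:ℂ) r) :
    DifferentiableAt ℂ (fun p : ℂ × ℂ => G p.1 p.2) (z₀, w₀) := by
  have ev : ∀ᶠ v : ℂ × ℂ in nhds (z₀, w₀), v.1 ∈ ball (0:ℂ) r ∧ v.2 ∈ ball (0:ℂ) r :=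
    (isOpen_ball.prod isOpen_ball).mem_nhds (Set.mk_mem_prod hz hw)
  have c1 := cont_partial G r M h1 h2 hM z₀ w₀ hz hw
  have c2 := cont_partial (fun a b => G b a) r M h2 h1 (fun z hz w hw => hM w hw z hz) w₀ z₀ hw hz
  have c2' : ContinuousAt (fun p : ℂ × ℂ => deriv (fun w => G p.1 w) p.2) (z₀, w₀) :=
    ContinuousAt.comp (x := (z₀, w₀)) (f := fun p : ℂ × ℂ => (p.2, p.1)) (g := fun p : ℂ × ℂ => deriv (fun z => G p.2 z) p.1) c2 (by fun_prop)
  have := hasStrictFDerivAt_uncurry_coprod (𝕜 := ℂ) (u := (z₀, w₀)) (f := G)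
    (f₁ := fun z w => ContinuousLinearMap.toSpanSingleton ℂ (deriv (fun z => G z w) z))
    (f₂ := fun z w => ContinuousLinearMap.toSpanSingleton ℂ (deriv (fun w => G z w) w))
    (by
      filter_upwards [ev] with v hv
      exact ((h1 v.2 hv.2).differentiableAt (isOpen_ball.mem_nhds hv.1)).hasDerivAt.hasFDerivAt)
    (by
      filter_upwards [ev] with v hv
      exact ((h2 v.1 hv.1).differentiableAt (isOpen_ball.mem_nhds hv.2)).hasDerivAt.hasFDerivAt)
    (by
      exact (ContinuousLinearMap.toSpanSingletonCLE (𝕜 := ℂ) (E := ℂ)).continuous.continuousAt.comp c1)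
    (by
      exact (ContinuousLinearMap.toSpanSingletonCLE (𝕜 := ℂ) (E := ℂ)).continuous.continuousAt.comp c2')
  exact this.hasFDerivAt.differentiableAt

/-- a holomorphic function on a disc vanishing at real points vanishes -/
lemma zero_of_real (f : ℂ → ℂ) (r : ℝ) (hr : 0 < r) (hf : DifferentiableOn ℂ f (ball 0 r))
    (h0 : ∀ x : ℝ, (x : ℂ) ∈ ball (0:ℂ) r → f x = 0) : ∀ z ∈ ball (0:ℂ) r, f z = 0 := by
  refine (hf.analyticOnNhd isOpen_ball).eqOn_zero_of_preconnected_of_frequently_eq_zero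
    (convex_ball _ _).isPreconnected (mem_ball_self hr) ?_
  have t : Filter.Tendsto (fun x : ℝ => (x : ℂ)) (nhdsWithin 0 {0}ᶜ) (nhdsWithin 0 {0}ᶜ) := by
    apply tendsto_nhdsWithin_of_tendsto_nhds_of_eventually_within
    · exact (Complex.continuous_ofReal.tendsto' 0 0 (by simp)).mono_left nhdsWithin_le_nhds
    · filter_upwards [self_mem_nhdsWithin] with x hx
      simpa using hx
  refine t.frequently (Filter.Eventually.frequently ?_)
  have : ∀ᶠ x : ℝ in nhds 0, (x : ℂ) ∈ ball (0:ℂ) r :=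
    Complex.continuous_ofReal.continuousAt.eventually_mem (isOpen_ball.mem_nhds (by simpa using hr))
  filter_upwards [nhdsWithin_le_nhds this] with x hx using h0 x hx

lemma local_zero (G : ℂ → ℂ → ℂ) (r M : ℝ) (hr : 0 < r)
    (h1 : ∀ w ∈ ball (0:ℂ) r, DifferentiableOn ℂ (fun z => G z w) (ball 0 r))
    (h2 : ∀ z ∈ ball (0:ℂ) r, DifferentiableOn ℂ (fun w => G z w) (ball 0 r))
    (hM : ∀ z ∈ ball (0:ℂ) r, ∀ w ∈ ball (0:ℂ) r, ‖G z w‖ ≤ M)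
    (hd : ∀ z ∈ ball (0:ℂ) r, G z ((starRingEnd ℂ) z) = 0) :
    ∀ z ∈ ball (0:ℂ) (r/2), ∀ w ∈ ball (0:ℂ) (r/2), G z w = 0 := by
  have mem : ∀ x ∈ ball (0:ℂ) (r/2), ∀ y ∈ ball (0:ℂ) (r/2),
      x + I * y ∈ ball (0:ℂ) r ∧ x - I * y ∈ ball (0:ℂ) r := by
    intro x hx y hy
    simp only [mem_ball_zero_iff] at *
    have e : ‖I * y‖ = ‖y‖ := by simp
    constructor
    · have := norm_add_le x (I * y)
      linarith
    · have := norm_sub_le x (I * y)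
      linarith
  have hr2 : 0 < r / 2 := by positivity
  have kx : ∀ y : ℝ, (y : ℂ) ∈ ball (0:ℂ) (r/2) → ∀ x ∈ ball (0:ℂ) (r/2),
      G (x + I * y) (x - I * y) = 0 := by
    intro y hy
    refine zero_of_real (fun x => G (x + I * y) (x - I * y)) _ hr2 ?_ ?_
    · intro x hx
      have m := mem x hx y hy
      have := joint_diff G r M h1 h2 hM _ _ m.1 m.2
      exact (DifferentiableAt.comp (f := fun x : ℂ => (x + I * y, x - I * y)) x this
        (by fun_prop)).differentiableWithinAt
    · intro x hx
      have := hd _ (mem x hx y hy).1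
      simpa [sub_eq_add_neg] using this
  have ky : ∀ x ∈ ball (0:ℂ) (r/2), ∀ y ∈ ball (0:ℂ) (r/2),
      G (x + I * y) (x - I * y) = 0 := by
    intro x hx
    refine zero_of_real (fun y => G (x + I * y) (x - I * y)) _ hr2 ?_ ?_
    · intro y hy
      have m := mem x hx y hy
      have := joint_diff G r M h1 h2 hM _ _ m.1 m.2
      exact (DifferentiableAt.comp (f := fun y : ℂ => (x + I * y, x - I * y)) y this
        (by fun_prop)).differentiableWithinAt
    · intro y hy
      exact kx y hy x hx
  intro z hz w hw
  simp only [mem_ball_zero_iff] at hz hw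
  have := ky ((z + w)/2) ?_ (-I * (z - w)/2) ?_
  · convert this using 2
    · linear_combination (z-w)/2 * I_mul_I
    · linear_combination -(z-w)/2 * I_mul_I
  · have := norm_add_le z w
    simp; linarith
  · have := norm_sub_le z w
    simp; linarith

/-- one-variable polarization for separately (anti)holomorphic hermitian functions -/
lemma polar (D : Set ℂ) (hDo : IsOpen D) (hDc : IsPreconnected D) (h : ℂ → ℂ → ℂ)
    (hol : ∀ w ∈ D, DifferentiableOn ℂ (fun z => h z w) D)
    (herm : ∀ z ∈ D, ∀ w ∈ D, h z w = (starRingEnd ℂ) (h w z))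
    (hd : ∀ z ∈ D, h z z = 0) : ∀ z ∈ D, ∀ w ∈ D, h z w = 0 := by
  intro a ha
  obtain ⟨R, hR, hRD⟩ := nhds_basis_closedBall.mem_iff.mp (hDo.mem_nhds ha)
  have cont2 : ∀ z ∈ D, ContinuousOn (fun w => h z w) D := by
    intro z hz
    have : ContinuousOn (fun w => (starRingEnd ℂ) (h w z)) D :=
      Complex.continuous_conj.comp_continuousOn (hol z hz).continuousOn
    exact this.congr (fun w hw => herm z hz w hw)
  let F : ℕ → Set ℂ := fun n => (ball a R)ᶜ ∪
    (closedBall a R ∩ {w | ∀ z ∈ closedBall a R, ‖h z w‖ ≤ n})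
  have Fc : ∀ n, IsClosed (F n) := by
    intro n
    refine isOpen_ball.isClosed_compl.union ?_
    have : closedBall a R ∩ {w | ∀ z ∈ closedBall a R, ‖h z w‖ ≤ n}
        = closedBall a R ∩ ⋂ z ∈ closedBall a R, (closedBall a R ∩ (fun w => h z w) ⁻¹' closedBall 0 n) := by
      ext w
      simp only [Set.mem_inter_iff, Set.mem_iInter, Set.mem_ofPred_eq, Set.mem_preimage, mem_closedBall_zero_iff]
      constructor
      · rintro ⟨h1, h2⟩
        exact ⟨h1, fun z hz => ⟨h1, h2 z hz⟩⟩
      · rintro ⟨h1, h2⟩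
        exact ⟨h1, fun z hz => (h2 z hz).2⟩
    rw [this]
    refine isClosed_closedBall.inter (isClosed_biInter fun z hz => ?_)
    exact ((cont2 z (hRD hz)).mono hRD).preimage_isClosed_of_isClosed isClosed_closedBall isClosed_closedBall
  have FU : ⋃ n, F n = Set.univ := by
    rw [Set.eq_univ_iff_forall]
    intro w
    rw [Set.mem_iUnion]
    by_cases hw : w ∈ ball a R
    · have hw' := ball_subset_closedBall hw
      obtain ⟨C, hC⟩ := (isCompact_closedBall a R).exists_bound_of_continuousOn
        ((hol w (hRD hw')).continuousOn.mono hRD)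
      obtain ⟨n, hn⟩ := exists_nat_ge C
      exact ⟨n, Or.inr ⟨hw', fun z hz => (hC z hz).trans hn⟩⟩
    · exact ⟨0, Or.inl hw⟩
  obtain ⟨c, hc, hcU⟩ := (dense_iUnion_interior_of_closed Fc FU).exists_mem_open isOpen_ball
    (nonempty_ball.mpr hR : (ball a R).Nonempty)
  obtain ⟨n, hn⟩ := Set.mem_iUnion.mp hc
  obtain ⟨r, hr, hrs⟩ := Metric.mem_nhds_iff.mp
    ((isOpen_interior.inter isOpen_ball).mem_nhds ⟨hn, hcU⟩)
  have hball : ∀ z ∈ ball c r, z ∈ closedBall a R := fun z hz => ball_subset_closedBall (hrs hz).2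
  have hbd : ∀ z ∈ ball c r, ∀ w ∈ ball c r, ‖h z w‖ ≤ n := by
    intro z hz w hw
    rcases interior_subset (hrs hw).1 with h1 | h1
    · exact absurd (hrs hw).2 h1
    · exact h1.2 z (hball z hz)
  have tr : ∀ z ∈ ball (0:ℂ) r, c + z ∈ ball c r := by
    intro z hz; simpa using hz
  have trc : ∀ z ∈ ball (0:ℂ) r, c + (starRingEnd ℂ) z ∈ ball c r := by
    intro z hz; simpa using hz
  have hD' : ∀ z ∈ ball c r, z ∈ D := fun z hz => hRD (hball z hz)
  have L := local_zero (fun z w => h (c + z) (c + (starRingEnd ℂ) w)) r n hr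
    (by
      intro w hw z hz
      have := (hol _ (hD' _ (trc w hw))).differentiableAt (hDo.mem_nhds (hD' _ (tr z hz)))
      exact (DifferentiableAt.comp (f := fun z : ℂ => c + z) z this (by fun_prop)).differentiableWithinAt)
    (by
      intro z hz
      have e : Set.EqOn (fun w => h (c + z) (c + (starRingEnd ℂ) w))
          (fun w => (starRingEnd ℂ) (h (c + (starRingEnd ℂ) w) (c + z))) (ball 0 r) :=
        fun w hw => herm _ (hD' _ (tr z hz)) _ (hD' _ (trc w hw))
      refine DifferentiableOn.congr ?_ e
      intro w hw
      have := (hol _ (hD' _ (tr z hz))).differentiableAt (hDo.mem_nhds (hD' _ (trc w hw)))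
      have h3 : DifferentiableAt ℂ (fun u => h (c + u) (c + z)) ((starRingEnd ℂ) w) :=
        DifferentiableAt.comp (f := fun u : ℂ => c + u) _ this (by fun_prop)
      have h4 := h3.hasDerivAt.conj_conj
      rw [Complex.conj_conj] at h4
      exact h4.differentiableAt.differentiableWithinAt)
    (fun z hz w hw => hbd _ (tr z hz) _ (trc w hw))
    (by
      intro z hz
      simpa using hd _ (hD' _ (tr z hz)))
  have L' : ∀ z ∈ ball c (r/2), ∀ w ∈ ball c (r/2), h z w = 0 := by
    intro z hz w hw
    have := L (z - c) (by simpa [dist_eq_norm] using hz) ((starRingEnd ℂ) (w - c))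
      (by rw [mem_ball_zero_iff, RCLike.norm_conj]; simpa [dist_eq_norm] using hw)
    simpa using this
  have hr2 : 0 < r/2 := by positivity
  have hcD : c ∈ D := hD' _ (mem_ball_self hr)
  have ext : ∀ w ∈ D, (∀ z ∈ ball c (r/2), h z w = 0) → ∀ z ∈ D, h z w = 0 := by
    intro w hw h0
    refine ((hol w hw).analyticOnNhd hDo).eqOn_zero_of_preconnected_of_eventuallyEq_zero hDc hcD ?_
    filter_upwards [ball_mem_nhds c hr2] with z hz using h0 z hz
  have sub : ∀ z ∈ ball c (r/2), z ∈ D := fun z hz => hD' z (ball_subset_ball (by linarith) hz)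
  intro w hw
  refine ext w hw (fun z hz => ?_) a ha
  rw [herm z (sub z hz) w hw, ext z (sub z hz) (fun u hu => L' u hu z hz) w hw, map_zero]

/-- If a Hermitian kernel `k` on the unit ball `B ⊆ ℂ^d`, holomorphic in the first
variable, with `k(0,0) > 0`, solves the two-point interpolation problem at `(0, λ)`
exactly when `|z| ≤ ‖λ‖`, then `k` is a rescaling of the Drury–Arveson kernel:
`k(μ,λ) = f(μ) conj(f(λ)) (1 - ⟨μ,λ⟩)⁻¹` where `f(μ) = k(μ,0)/√(k(0,0))`. -/
theorem stmt6 (d : ℕ) (hd : 0 < d)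
    (k : EuclideanSpace ℂ (Fin d) → EuclideanSpace ℂ (Fin d) → ℂ)
    (hol : ∀ lam ∈ ball (0 : EuclideanSpace ℂ (Fin d)) 1,
      DifferentiableOn ℂ (fun mu => k mu lam) (ball (0 : EuclideanSpace ℂ (Fin d)) 1))
    (herm : ∀ lam ∈ ball (0 : EuclideanSpace ℂ (Fin d)) 1,
      ∀ mu ∈ ball (0 : EuclideanSpace ℂ (Fin d)) 1,
        k lam mu = (starRingEnd ℂ) (k mu lam))
    (hk0re : 0 < (k 0 0).re) (hk0im : (k 0 0).im = 0)
    (hiff : ∀ lam ∈ ball (0 : EuclideanSpace ℂ (Fin d)) 1, ∀ z : ℂ,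
      (!![k 0 0, (starRingEnd ℂ) (k lam 0);
          k lam 0, (1 - (‖z‖ : ℂ) ^ 2) * k lam lam] : Matrix (Fin 2) (Fin 2) ℂ).PosSemidef
        ↔ ‖z‖ ≤ ‖lam‖) :
    DifferentiableOn ℂ
      (fun mu => k mu 0 / (Real.sqrt ((k 0 0).re) : ℂ))
      (ball (0 : EuclideanSpace ℂ (Fin d)) 1) ∧
    (∀ mu ∈ ball (0 : EuclideanSpace ℂ (Fin d)) 1,
      k mu 0 / (Real.sqrt ((k 0 0).re) : ℂ) ≠ 0) ∧
    ∀ mu ∈ ball (0 : EuclideanSpace ℂ (Fin d)) 1,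
      ∀ lam ∈ ball (0 : EuclideanSpace ℂ (Fin d)) 1,
        k mu lam = (k mu 0 / (Real.sqrt ((k 0 0).re) : ℂ)) *
          (starRingEnd ℂ) (k lam 0 / (Real.sqrt ((k 0 0).re) : ℂ)) *
          (1 - ∑ i, mu i * (starRingEnd ℂ) (lam i))⁻¹ := by
  set c : ℝ := (k 0 0).re with hc
  have hk00 : k 0 0 = (c : ℂ) := by
    apply Complex.ext <;> simp [hc, hk0im]
  have h0B : (0 : EuclideanSpace ℂ (Fin d)) ∈ ball (0 : EuclideanSpace ℂ (Fin d)) 1 := by simp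
  have hdiag : ∀ lam ∈ ball (0 : EuclideanSpace ℂ (Fin d)) 1,
      k lam lam = ((k lam lam).re : ℂ) := fun lam hl =>
    (Complex.conj_eq_iff_re.mp (herm lam hl lam hl).symm).symm
  have hiff' : ∀ lam ∈ ball (0 : EuclideanSpace ℂ (Fin d)) 1, ∀ t : ℝ, 0 ≤ t →
      (normSq (k lam 0) ≤ c * ((1 - t ^ 2) * (k lam lam).re) ↔ t ≤ ‖lam‖) := by
    intro lam hl t ht
    have h := hiff lam hl (t : ℂ)
    have e : (1 - ((t : ℝ) : ℂ) ^ 2) * k lam lam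
        = (((1 - t ^ 2) * (k lam lam).re : ℝ) : ℂ) := by
      rw [hdiag lam hl]; push_cast; simp
    rw [Complex.norm_real, Real.norm_of_nonneg ht, e, hk00, psd_two_iff _ _ _ hk0re] at h
    exact h
  have hne : ∀ lam ∈ ball (0 : EuclideanSpace ℂ (Fin d)) 1, k lam 0 ≠ 0 := by
    intro lam hl h
    have := (hiff' lam hl 1 zero_le_one).mp (by simp [h])
    have := mem_ball_zero_iff.mp hl
    linarith
  have hval : ∀ lam ∈ ball (0 : EuclideanSpace ℂ (Fin d)) 1,
      normSq (k lam 0) = c * ((1 - ‖lam‖ ^ 2) * (k lam lam).re) := by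
    intro lam hl
    refine le_antisymm ((hiff' lam hl _ (norm_nonneg _)).mpr le_rfl) ?_
    have cont : Continuous (fun t : ℝ => c * ((1 - t ^ 2) * (k lam lam).re)) := by fun_prop
    refine le_of_tendsto ((cont.tendsto ‖lam‖).mono_left (nhdsWithin_le_nhds (s := Set.Ioi ‖lam‖))) ?_
    filter_upwards [self_mem_nhdsWithin] with t ht
    have ht' : ‖lam‖ < t := ht
    have := mt (hiff' lam hl t ((norm_nonneg _).trans ht'.le)).mp (not_le.mpr ht')
    exact (not_le.mp this).le
  have hsqrt : (Real.sqrt c : ℂ) ≠ 0 := by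
    exact_mod_cast (Real.sqrt_pos.mpr hk0re).ne'
  have hsq : (Real.sqrt c : ℂ) * (Real.sqrt c : ℂ) = c := by
    exact_mod_cast Real.mul_self_sqrt hk0re.le
  have hinner : ∀ mu lam : EuclideanSpace ℂ (Fin d),
      ∑ i, mu i * (starRingEnd ℂ) (lam i) = inner ℂ lam mu := by
    intro mu lam
    simp [PiLp.inner_apply]
  refine ⟨by simpa only [div_eq_mul_inv] using (hol 0 h0B).mul_const (Real.sqrt c : ℂ)⁻¹, fun mu hmu => div_ne_zero (hne mu hmu) hsqrt, ?_⟩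
  intro mu hmu lam hlam
  rw [hinner]
  set H : EuclideanSpace ℂ (Fin d) → EuclideanSpace ℂ (Fin d) → ℂ := fun x y =>
    c * (k x y * (1 - inner ℂ y x)) - k x 0 * (starRingEnd ℂ) (k y 0) with hH
  set p : ℂ → EuclideanSpace ℂ (Fin d) := fun z => lam + z • (mu - lam) with hp
  have hpd : Differentiable ℂ p := by fun_prop
  have key := polar (p ⁻¹' ball 0 1) (isOpen_ball.preimage hpd.continuous)
    (by
      apply Convex.isPreconnected
      intro x hx y hy a b ha hb hab
      have e : p (a • x + b • y) = a • p x + b • p y := by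
        have hab' : (a : ℂ) + b = 1 := by exact_mod_cast hab
        have hb' : (b : ℂ) = 1 - a := by rw [← hab']; ring
        simp only [hp, ← Complex.coe_smul, hb']
        module
      rw [Set.mem_preimage, e]
      exact convex_ball _ _ hx hy ha hb hab)
    (fun z w => H (p z) (p w))
    (by
      intro w hw z hz
      have d1 := DifferentiableAt.comp z ((hol _ hw).differentiableAt (isOpen_ball.mem_nhds hz)) (hpd z)
      have d2 := DifferentiableAt.comp z ((hol _ h0B).differentiableAt (isOpen_ball.mem_nhds hz)) (hpd z)
      have d3 : DifferentiableAt ℂ (fun z => inner ℂ (p w) (p z)) z :=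
        (innerSL ℂ (p w)).differentiableAt.comp z (hpd z)
      exact (((d1.mul (d3.const_sub 1)).const_mul (c : ℂ)).sub
        (d2.mul_const _)).differentiableWithinAt)
    (by
      intro z hz w hw
      simp only [hH, map_sub, map_mul, map_one, inner_conj_symm, Complex.conj_ofReal,
        Complex.conj_conj]
      rw [← herm _ hz _ hw]
      ring)
    (by
      intro z hz
      have hv := hval _ hz
      simp only [hH]
      rw [Complex.mul_conj, hv, hdiag _ hz, inner_self_eq_norm_sq_to_K]
      simp only [Complex.ofReal_re]
      push_cast
      simp only [Complex.coe_algebraMap]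
      ring)
    1 (by simpa [hp] using hmu) 0 (by simpa [hp] using hlam)
  have key' : c * (k mu lam * (1 - inner ℂ lam mu)) - k mu 0 * (starRingEnd ℂ) (k lam 0) = 0 := by
    simpa [hp, hH] using key
  have hden : (1 : ℂ) - inner ℂ lam mu ≠ 0 := by
    intro h
    have h1 : inner ℂ lam mu = (1 : ℂ) := (sub_eq_zero.mp h).symm
    have h2 := norm_inner_le_norm (𝕜 := ℂ) lam mu
    rw [h1, norm_one] at h2
    have := mem_ball_zero_iff.mp hmu
    have := mem_ball_zero_iff.mp hlam
    nlinarith [norm_nonneg lam, norm_nonneg mu]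
  have hc0 : (c : ℂ) ≠ 0 := by exact_mod_cast hk0re.ne'
  rw [map_div₀, Complex.conj_ofReal, div_mul_div_comm, hsq, ← div_eq_mul_inv,
    eq_div_iff hden, eq_div_iff hc0]
  linear_combination key'
end
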